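/- arXiv:1612.05232 — 9 statements merged into one kernel-verified Lean document; each statement's English description precedes it below -/
import Mathlib

section
/- Let k ≥ 1 and let i_1, ..., i_k be integers all at least 2. Then the symmetric sum of multiple t-values satisfies Σ_{σ ∈ S_k} t(i_{σ(1)}, ..., i_{σ(k)}) = Σ_{B = {B_1,...,B_l} ∈ Π_k} (−1)^{k−l} c(B) · Π_{s=1}^{l} t(Σ_{j ∈ B_s} i_j), where Π_k is the set of partitions of the set {1,2,...,k} into nonempty blocks, l is the number of blocks of B, and c(B) = (|B_1|−1)!(|B_2|−1)!···(|B_l|−1)!. -/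
/-- Multiple t-value: `t(a 0, ..., a (k-1))` is the sum of
`1/(n_0^(a 0) ⋯ n_(k-1)^(a (k-1)))` over strictly decreasing tuples of odd
positive integers. -/
noncomputable def multT {k : ℕ} (a : Fin k → ℕ) : ℝ :=
  ∑' n : {f : Fin k → ℕ // StrictAnti f ∧ ∀ i, Odd (f i)},
    ∏ i, 1 / ((n.1 i : ℝ) ^ (a i))

def MTins {α : Type*} [DecidableEq α] {s : Finset α} {x : α} (hx : x ∉ s)
    (P : Finpartition s) (B : Finset α) (hB : B ∈ insert ∅ P.parts) :
    Finpartition (insert x s) :=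
  Finpartition.ofExistsUnique (insert (insert x B) (P.parts.erase B))
    (by
      intro p hp
      rcases Finset.mem_insert.1 hp with rfl | hp
      · apply Finset.insert_subset_insert
        rcases Finset.mem_insert.1 hB with rfl | hB
        · simp
        · exact P.subset hB
      · exact (P.subset (Finset.mem_of_mem_erase hp)).trans (Finset.subset_insert _ _))
    (by
      intro y hy
      have hsub : ∀ C ∈ P.parts, x ∉ C := fun C hC h => hx (P.subset hC h)
      rcases Finset.mem_insert.1 hy with rfl | hy
      · refine ⟨insert y B, by simp, ?_⟩
        rintro t ⟨ht, hyt⟩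
        rcases Finset.mem_insert.1 ht with rfl | ht
        · rfl
        · exact absurd hyt (hsub t (Finset.mem_of_mem_erase ht))
      · have hyx : y ≠ x := fun h => hx (h ▸ hy)
        obtain ⟨t, ht, hyt⟩ := P.exists_mem hy
        by_cases htB : t = B
        · subst htB
          refine ⟨insert x t, by simp [hyt], ?_⟩
          rintro u ⟨hu, hyu⟩
          rcases Finset.mem_insert.1 hu with rfl | hu
          · rfl
          · exact absurd (P.eq_of_mem_parts (Finset.mem_of_mem_erase hu) ht hyu hyt)
              (Finset.ne_of_mem_erase hu)
        · refine ⟨t, by simp [ht, htB, hyt], ?_⟩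
          rintro u ⟨hu, hyu⟩
          rcases Finset.mem_insert.1 hu with rfl | hu
          · have hyB : y ∈ B := by simpa [hyx] using hyu
            rcases Finset.mem_insert.1 hB with rfl | hB
            · simp at hyB
            · exact absurd (P.eq_of_mem_parts ht hB hyt hyB) htB
          · exact (P.eq_of_mem_parts (Finset.mem_of_mem_erase hu) ht hyu hyt))
    (by
      intro h
      rcases Finset.mem_insert.1 h with h | h
      · exact (Finset.insert_ne_empty _ _ h.symm)
      · exact P.empty_notMem_parts (Finset.mem_of_mem_erase h))

theorem MTins_parts {α : Type*} [DecidableEq α] {s : Finset α} {x : α} (hx : x ∉ s)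
    (P : Finpartition s) (B : Finset α) (hB : B ∈ insert ∅ P.parts) :
    (MTins hx P B hB).parts = insert (insert x B) (P.parts.erase B) := rfl

def MTdel {α : Type*} [DecidableEq α] {s : Finset α} {x : α} (hx : x ∉ s)
    (Q : Finpartition (insert x s)) : Finpartition s :=
  Finpartition.ofErase (insert ((Q.part x).erase x) (Q.parts.erase (Q.part x)))
    (by
      rw [Finset.supIndep_iff_pairwiseDisjoint]
      have key : ∀ C ∈ Q.parts.erase (Q.part x), Disjoint ((Q.part x).erase x) C := by
        intro C hC
        have := Q.disjoint ((Q.part_mem).2 (Finset.mem_insert_self x s))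
          (Finset.mem_of_mem_erase hC) (Finset.ne_of_mem_erase hC).symm
        exact Finset.disjoint_of_subset_left (Finset.erase_subset _ _) this
      intro C hC D hD hne
      rcases Finset.mem_insert.1 hC with rfl | hC <;> rcases Finset.mem_insert.1 hD with rfl | hD
      · exact absurd rfl hne
      · exact key _ hD
      · exact (key _ hC).symm
      · exact Q.disjoint (Finset.mem_of_mem_erase hC) (Finset.mem_of_mem_erase hD) hne)
    (by
      have hpm := (Q.part_mem).2 (Finset.mem_insert_self x s)
      have hps := (Q.mem_part_self).2 (Finset.mem_insert_self x s)
      ext y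
      simp only [Finset.mem_sup, id]
      constructor
      · rintro ⟨C, hC, hy⟩
        rcases Finset.mem_insert.1 hC with rfl | hC
        · have := Q.subset hpm (Finset.mem_of_mem_erase hy)
          have := Finset.ne_of_mem_erase hy
          simp_all
        · have h1 := Q.subset (Finset.mem_of_mem_erase hC) hy
          rcases Finset.mem_insert.1 h1 with rfl | h1
          · exact absurd (Q.eq_of_mem_parts (Finset.mem_of_mem_erase hC) hpm hy hps)
              (Finset.ne_of_mem_erase hC)
          · exact h1
      · intro hy
        have hyx : y ≠ x := fun h => hx (h ▸ hy)
        obtain ⟨t, ht, hyt⟩ := Q.exists_mem (Finset.mem_insert_of_mem hy)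
        by_cases h : t = Q.part x
        · exact ⟨_, Finset.mem_insert_self _ _, by simp [hyx, ← h, hyt]⟩
        · exact ⟨t, by simp [h, ht], hyt⟩)

theorem MTdel_parts {α : Type*} [DecidableEq α] {s : Finset α} {x : α} (hx : x ∉ s)
    (Q : Finpartition (insert x s)) : (MTdel hx Q).parts =
      (insert ((Q.part x).erase x) (Q.parts.erase (Q.part x))).erase ∅ := rfl

theorem MT_rec {α : Type*} [DecidableEq α] {s : Finset α} {x : α} (hx : x ∉ s)
    (F : Finset α → ℝ) :
    ∑ Q : Finpartition (insert x s), ∏ B ∈ Q.parts, F B =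
    ∑ P : Finpartition s, ∑ B ∈ insert ∅ P.parts,
      F (insert x B) * ∏ C ∈ P.parts.erase B, F C := by
  rw [Finset.sum_sigma']
  symm
  have hpart : ∀ (P : Finpartition s) (B) (hB : B ∈ insert ∅ P.parts),
      (MTins hx P B hB).part x = insert x B := by
    intro P B hB
    apply Finpartition.part_eq_of_mem
    · rw [MTins_parts]; simp
    · simp
  have hnot : ∀ (P : Finpartition s), ∀ C ∈ P.parts, x ∉ C :=
    fun P C hC h => hx (P.subset hC h)
  have hB' : ∀ (P : Finpartition s) (B) (hB : B ∈ insert ∅ P.parts), x ∉ B := by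
    intro P B hB
    rcases Finset.mem_insert.1 hB with rfl | hB
    · simp
    · exact hnot P B hB
  have hni : ∀ (P : Finpartition s) (B : Finset α), insert x B ∉ P.parts.erase B := 
    fun P B h => hnot P _ (Finset.mem_of_mem_erase h) (by simp)
  refine Finset.sum_bij' (fun p hp => MTins hx p.1 p.2 (Finset.mem_sigma.1 hp).2)
    (fun Q _ => ⟨MTdel hx Q, (Q.part x).erase x⟩) ?_ ?_ ?_ ?_ ?_
  · simp
  · intro Q _
    simp only [Finset.mem_sigma, Finset.mem_univ, true_and, MTdel_parts, Finset.mem_insert,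
      Finset.mem_erase]
    tauto
  · rintro ⟨P, B⟩ hp
    have hB := (Finset.mem_sigma.1 hp).2
    dsimp only at hB
    have h2 : ((MTins hx P B hB).part x).erase x = B := by
      rw [hpart, Finset.erase_insert (hB' P B hB)]
    refine Sigma.ext ?_ (heq_of_eq h2)
    dsimp only
    ext1
    rw [MTdel_parts, h2, hpart, MTins_parts, Finset.erase_insert (hni P B)]
    rcases Finset.mem_insert.1 hB with rfl | hB
    · simp [Finset.erase_eq_of_notMem P.empty_notMem_parts]
    · rw [Finset.insert_erase hB, Finset.erase_eq_of_notMem P.empty_notMem_parts]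
  · intro Q _
    have hpm := (Q.part_mem).2 (Finset.mem_insert_self x s)
    have hps := (Q.mem_part_self).2 (Finset.mem_insert_self x s)
    ext1
    dsimp only
    rw [MTins_parts, MTdel_parts, Finset.insert_erase hps, Finset.erase_right_comm,
      Finset.erase_insert, Finset.erase_eq_of_notMem (a := ∅), Finset.insert_erase hpm]
    · intro h
      exact Q.empty_notMem_parts (Finset.mem_of_mem_erase h)
    · intro h
      have h1 := Finset.mem_of_mem_erase h
      have h2 := Finset.ne_of_mem_erase h
      obtain ⟨y, hy⟩ := Q.nonempty_of_mem_parts h1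
      exact h2 (Q.eq_of_mem_parts h1 hpm hy (Finset.mem_of_mem_erase hy))
  · rintro ⟨P, B⟩ hp
    dsimp only
    rw [MTins_parts, Finset.prod_insert (hni P B)]

open Classical in
noncomputable def MTF {α β : Type*} (f : α → β) (B : Finset α) : ℝ :=
  if (∀ i ∈ B, ∀ j ∈ B, f i = f j) then (-1) ^ (B.card - 1) * ((B.card - 1).factorial : ℝ) else 0

open Classical in
theorem MTF_insert {α β : Type*} [DecidableEq α] (f : α → β) {B : Finset α} (hB : B.Nonempty)
    {x : α} (hx : x ∉ B) :
    MTF f (insert x B) = - (∑ y ∈ B, if f y = f x then (1:ℝ) else 0) * MTF f B := by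
  unfold MTF
  by_cases h : ∀ i ∈ B, ∀ j ∈ B, f i = f j
  · rw [if_pos h]
    obtain ⟨b, hb⟩ := hB
    by_cases h2 : f b = f x
    · have h3 : ∀ y ∈ B, f y = f x := fun y hy => (h y hy b hb).trans h2
      rw [if_pos, Finset.sum_congr rfl (fun y hy => if_pos (h3 y hy)), Finset.card_insert_of_notMem hx]
      · obtain ⟨n, hn⟩ : ∃ n, B.card = n + 1 :=
          ⟨B.card - 1, by have := Finset.card_pos.2 ⟨b, hb⟩; omega⟩
        simp [hn, Nat.factorial_succ, pow_succ]
        ring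
      · intro i hi j hj
        have : ∀ i ∈ insert x B, f i = f x := by
          intro i hi
          rcases Finset.mem_insert.1 hi with rfl | hi
          · rfl
          · exact h3 i hi
        rw [this i hi, this j hj]
    · rw [if_neg, Finset.sum_eq_zero]
      · simp
      · intro y hy
        rw [if_neg]
        rw [h y hy b hb]; exact h2
      · intro h'
        exact h2 (h' b (by simp [hb]) x (by simp))
  · rw [if_neg h, if_neg, mul_zero]
    intro h'
    exact h fun i hi j hj => h' i (by simp [hi]) j (by simp [hj])

open Classical in
theorem MT_pointwise {α β : Type*} [DecidableEq α] (f : α → β) (s : Finset α) :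
    ∑ P : Finpartition s, ∏ B ∈ P.parts, MTF f B = if Set.InjOn f s then 1 else 0 := by
  induction s using Finset.induction_on with
  | empty =>
    have : ∀ P : Finpartition (∅ : Finset α), P.parts = ∅ := fun P => by
      rw [P.parts_eq_empty_iff]; rfl
    have hs : Subsingleton (Finpartition (∅ : Finset α)) :=
      ⟨fun P Q => by ext1; rw [this, this]⟩
    have hu : (Finset.univ : Finset (Finpartition (∅ : Finset α))) = {⊥} := by
      ext P; simp [Subsingleton.elim P ⊥]
    rw [hu]
    simp
  | insert x s hx ih =>
    rw [MT_rec hx]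
    have : ∀ P : Finpartition s, ∑ B ∈ insert ∅ P.parts,
        MTF f (insert x B) * ∏ C ∈ P.parts.erase B, MTF f C =
        (1 - ∑ y ∈ s, if f y = f x then (1:ℝ) else 0) * ∏ B ∈ P.parts, MTF f B := by
      intro P
      rw [Finset.sum_insert P.empty_notMem_parts, Finset.erase_eq_of_notMem P.empty_notMem_parts]
      have h1 : MTF f (insert x ∅) = 1 := by simp [MTF]
      rw [h1, sub_mul]
      have h2 : ∑ y ∈ s, (if f y = f x then (1:ℝ) else 0) =
          ∑ B ∈ P.parts, ∑ y ∈ B, if f y = f x then (1:ℝ) else 0 := by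
        conv_lhs => rw [← P.biUnion_parts]
        rw [Finset.sum_biUnion P.disjoint]
        rfl
      rw [h2, Finset.sum_mul, sub_eq_add_neg, ← Finset.sum_neg_distrib]
      congr 1
      apply Finset.sum_congr rfl
      intro B hB
      rw [MTF_insert f (P.nonempty_of_mem_parts hB) (fun h => hx (P.subset hB h)),
        ← Finset.mul_prod_erase _ _ hB]
      ring
    rw [Finset.sum_congr rfl (fun P _ => this P), ← Finset.mul_sum, ih]
    by_cases hs : Set.InjOn f s
    · rw [if_pos hs, mul_one]
      by_cases hxs : ∃ y ∈ s, f y = f x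
      · obtain ⟨y, hy, hyx⟩ := hxs
        rw [Finset.sum_eq_single y, if_pos hyx, if_neg, sub_self]
        · intro h
          have := h (by simp [hy]) (by simp) hyx
          exact hx (this ▸ hy)
        · intro z hz hzy
          rw [if_neg]
          intro h
          exact hzy (hs hz hy (h.trans hyx.symm))
        · exact fun h => absurd hy h
      · push Not at hxs
        rw [Finset.sum_eq_zero (fun y hy => if_neg (hxs y hy)), if_pos, sub_zero]
        rw [Finset.coe_insert, Set.injOn_insert (by simpa using hx)]
        refine ⟨hs, ?_⟩
        rintro ⟨y, hy, h⟩
        exact hxs y hy h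
    · rw [if_neg hs, if_neg, mul_zero]
      intro h
      exact hs (h.mono (by simp))

theorem MT_hasSum_pi {ι κ : Type*} [Fintype ι] (f : ι → κ → ℝ)
    (h0 : ∀ i n, 0 ≤ f i n) (hs : ∀ i, Summable (f i)) :
    HasSum (fun x : ι → κ => ∏ i, f i (x i)) (∏ i, ∑' n, f i n) := by
  classical
  have hcov : ∀ T : Finset (ι → κ), ∃ S : Finset κ, T ⊆ Fintype.piFinset (fun _ : ι => S) := by
    intro T
    refine ⟨T.biUnion (fun x => Finset.univ.image x), ?_⟩
    intro x hx
    rw [Fintype.mem_piFinset]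
    intro i
    rw [Finset.mem_biUnion]
    exact ⟨x, hx, Finset.mem_image_of_mem _ (Finset.mem_univ i)⟩
  have hfin : ∀ S : Finset κ, ∑ x ∈ Fintype.piFinset (fun _ : ι => S), ∏ i, f i (x i)
      = ∏ i, ∑ n ∈ S, f i n := fun S => (Finset.prod_univ_sum (fun _ => S) f).symm
  have hsum : Summable (fun x : ι → κ => ∏ i, f i (x i)) := by
    refine summable_of_sum_le (c := ∏ i, ∑' n, f i n)
      (fun x => Finset.prod_nonneg fun i _ => h0 _ _) ?_
    intro T
    obtain ⟨S, hS⟩ := hcov T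
    refine (Finset.sum_le_sum_of_subset_of_nonneg hS
      (fun x _ _ => Finset.prod_nonneg fun i _ => h0 _ _)).trans ?_
    rw [hfin]
    exact Finset.prod_le_prod (fun i _ => Finset.sum_nonneg fun n _ => h0 _ _)
      (fun i _ => (hs i).sum_le_tsum S (fun n _ => h0 _ _))
  have ht : Filter.Tendsto (fun S : Finset κ => Fintype.piFinset (fun _ : ι => S))
      Filter.atTop Filter.atTop := by
    refine Filter.tendsto_atTop_atTop.2 fun T => ?_
    obtain ⟨S, hS⟩ := hcov T
    exact ⟨S, fun S' h => hS.trans (Fintype.piFinset_subset _ _ (fun _ => h))⟩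
  have h1 := hsum.hasSum.comp ht
  have h2 : Filter.Tendsto (fun S : Finset κ => ∏ i, ∑ n ∈ S, f i n) Filter.atTop
      (nhds (∏ i, ∑' n, f i n)) := tendsto_finsetProd _ (fun i _ => (hs i).hasSum)
  have h3 := tendsto_nhds_unique (h1.congr hfin) h2
  rw [← h3]
  exact hsum.hasSum

abbrev MTO := {n : ℕ // Odd n}

noncomputable def MTv (b : ℕ) (n : MTO) : ℝ := 1 / ((n.1 : ℝ) ^ b)

theorem MTv_nonneg (b : ℕ) (n : MTO) : 0 ≤ MTv b n := by unfold MTv; positivity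

theorem MTv_summable {b : ℕ} (hb : 2 ≤ b) : Summable (MTv b) :=
  (Real.summable_one_div_nat_pow.2 (by omega : 1 < b)).comp_injective Subtype.val_injective

theorem MTv_sum {ι : Type*} (B : Finset ι) (a : ι → ℕ) (n : MTO) :
    MTv (∑ j ∈ B, a j) n = ∏ j ∈ B, MTv (a j) n := by
  simp [MTv, Finset.prod_pow_eq_pow_sum]

open Classical in
theorem multT_eq {k : ℕ} (a : Fin k → ℕ) :
    multT a = ∑' f : Fin k → MTO, if StrictAnti f then ∏ i, MTv (a i) (f i) else 0 := by
  have : (fun f : Fin k → MTO => if StrictAnti f then ∏ i, MTv (a i) (f i) else 0) =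
      Set.indicator {f | StrictAnti f} (fun f => ∏ i, MTv (a i) (f i)) := by
    ext f; simp [Set.indicator]
  rw [this, ← tsum_subtype]
  unfold multT
  let e : {f : Fin k → ℕ // StrictAnti f ∧ ∀ i, Odd (f i)} ≃
      {f : Fin k → MTO | StrictAnti f} :=
    { toFun := fun f => ⟨fun i => ⟨f.1 i, f.2.2 i⟩, fun i j h => f.2.1 h⟩
      invFun := fun f => ⟨fun i => (f.1 i).1, fun i j h => f.2 h, fun i => (f.1 i).2⟩
      left_inv := fun f => rfl
      right_inv := fun f => rfl }
  exact e.tsum_eq (fun f : {f : Fin k → MTO | StrictAnti f} => ∏ i, MTv (a i) (f.1 i))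

theorem multT_one (b : ℕ) : multT ![b] = ∑' n : MTO, MTv b n := by
  classical
  rw [multT_eq]
  rw [← (Equiv.funUnique (Fin 1) MTO).symm.tsum_eq]
  apply tsum_congr
  intro n
  rw [if_pos (Subsingleton.strictAnti _)]
  simp

open Classical in
theorem MT_perm {k : ℕ} (g : Fin k → MTO) :
    ∑ σ : Equiv.Perm (Fin k), (if StrictAnti (g ∘ σ) then (1:ℝ) else 0) =
      if Function.Injective g then 1 else 0 := by
  by_cases hg : Function.Injective g
  · rw [if_pos hg]
    let τ : Equiv.Perm (Fin k) := Fin.revPerm.trans (Tuple.sort g)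
    have hτ : StrictAnti (g ∘ τ) := by
      have h1 : StrictMono (g ∘ Tuple.sort g) :=
        (Tuple.monotone_sort g).strictMono_of_injective (hg.comp (Equiv.injective _))
      intro i j h
      exact h1 (Fin.rev_lt_rev.2 h)
    rw [Finset.sum_eq_single τ, if_pos hτ]
    · intro σ _ hne
      rw [if_neg]
      intro hσ
      apply hne
      have := Tuple.unique_antitone hσ.antitone hτ.antitone
      ext i
      exact congrArg Fin.val (hg (congrFun this i))
    · simp
  · rw [if_neg hg]
    apply Finset.sum_eq_zero
    intro σ _
    rw [if_neg]
    intro h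
    apply hg
    have := h.injective.comp σ.symm.injective
    simpa [Function.comp_assoc] using this

open Classical in
theorem MT_block {k : ℕ} (a : Fin k → ℕ) (ha : ∀ j, 2 ≤ a j)
    (P : Finpartition (Finset.univ : Finset (Fin k))) :
    HasSum (fun f : Fin k → MTO => if (∀ B ∈ P.parts, ∀ i ∈ B, ∀ j ∈ B, f i = f j) then
      ∏ i, MTv (a i) (f i) else 0) (∏ B ∈ P.parts, multT ![∑ j ∈ B, a j]) := by
  have h := MT_hasSum_pi (ι := P.parts) (fun B n => MTv (∑ j ∈ B.1, a j) n)
    (fun _ _ => MTv_nonneg _ _) (fun B => MTv_summable (by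
      obtain ⟨b, hb⟩ := P.nonempty_of_mem_parts B.2
      exact (ha b).trans (Finset.single_le_sum (f := a) (fun _ _ => Nat.zero_le _) hb)))
  have h2 : ∏ B ∈ P.parts, multT ![∑ j ∈ B, a j] =
      ∏ B : P.parts, ∑' n, MTv (∑ j ∈ B.1, a j) n := by
    rw [Finset.prod_coe_sort P.parts (fun B => ∑' n, MTv (∑ j ∈ B, a j) n)]
    exact Finset.prod_congr rfl fun B _ => multT_one _
  rw [h2]
  have hpm : ∀ i, P.part i ∈ P.parts := fun i => P.part_mem.2 (Finset.mem_univ i)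
  let G : (P.parts → MTO) → (Fin k → MTO) := fun g i => g ⟨P.part i, hpm i⟩
  have hGB : ∀ (g) (B : P.parts), ∀ i ∈ B.1, G g i = g B := by
    intro g B i hi
    have : P.part i = B.1 := P.part_eq_of_mem B.2 hi
    simp only [G]
    congr 1
    exact Subtype.ext this
  have hG : Function.Injective G := by
    intro g g' h
    ext1 B
    obtain ⟨b, hb⟩ := P.nonempty_of_mem_parts B.2
    rw [← hGB g B b hb, ← hGB g' B b hb, h]
  rw [← hG.hasSum_iff]
  · convert h using 1
    ext g
    rw [Function.comp_apply, if_pos]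
    · conv_lhs => rw [← P.biUnion_parts]
      rw [Finset.prod_biUnion P.disjoint, ← Finset.prod_coe_sort]
      apply Finset.prod_congr rfl
      intro B _
      rw [MTv_sum]
      apply Finset.prod_congr rfl
      intro i hi
      rw [hGB g B i hi]
    · intro B hB i hi j hj
      rw [hGB g ⟨B, hB⟩ i hi, hGB g ⟨B, hB⟩ j hj]
  · intro f hf
    rw [if_neg]
    intro hc
    apply hf
    choose c hc' using fun B : P.parts => P.nonempty_of_mem_parts B.2
    refine ⟨fun B => f (c B), ?_⟩
    ext1 i
    exact hc (P.part i) (hpm i) _ (hc' ⟨P.part i, hpm i⟩) _ (P.mem_part_self.2 (Finset.mem_univ i))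

theorem multT_symmetric_sum (k : ℕ) (hk : 1 ≤ k) (a : Fin k → ℕ)
    (ha : ∀ j, 2 ≤ a j) :
    ∑ σ : Equiv.Perm (Fin k), multT (fun j => a (σ j)) =
      ∑ P : Finpartition (Finset.univ : Finset (Fin k)),
        (-1 : ℝ) ^ (k - P.parts.card) *
          (∏ B ∈ P.parts, (Nat.factorial (B.card - 1) : ℝ)) *
          ∏ B ∈ P.parts, multT ![∑ j ∈ B, a j] := by
  classical
  let W : (Fin k → MTO) → ℝ := fun f => ∏ i, MTv (a i) (f i)
  have hW : Summable W := (MT_hasSum_pi (fun i n => MTv (a i) n)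
    (fun _ _ => MTv_nonneg _ _) (fun i => MTv_summable (ha i))).summable
  have hL : ∀ σ : Equiv.Perm (Fin k), HasSum
      (fun g : Fin k → MTO => (if StrictAnti (g ∘ σ) then (1:ℝ) else 0) * W g)
      (multT (fun j => a (σ j))) := by
    intro σ
    have hs : Summable
        (fun g : Fin k → MTO => (if StrictAnti (g ∘ σ) then (1:ℝ) else 0) * W g) := by
      refine Summable.of_nonneg_of_le (fun g => ?_) (fun g => ?_) hW
      · have : 0 ≤ W g := Finset.prod_nonneg fun _ _ => MTv_nonneg _ _
        split_ifs <;> simp [this]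
      · have : 0 ≤ W g := Finset.prod_nonneg fun _ _ => MTv_nonneg _ _
        split_ifs <;> simp [this]
    have : multT (fun j => a (σ j)) =
        ∑' g : Fin k → MTO, (if StrictAnti (g ∘ σ) then (1:ℝ) else 0) * W g := by
      rw [multT_eq, ← (Equiv.arrowCongr σ.symm (Equiv.refl MTO)).tsum_eq]
      apply tsum_congr
      intro g
      have h1 : (Equiv.arrowCongr σ.symm (Equiv.refl MTO)) g = g ∘ σ := by
        ext i; simp
      rw [h1]
      have h2 : ∏ i, MTv (a (σ i)) ((g ∘ σ) i) = W g :=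
        Equiv.prod_comp σ (fun i => MTv (a i) (g i))
      rw [h2]
      split_ifs <;> simp
    rw [this]
    exact hs.hasSum
  have hL' := hasSum_sum (s := Finset.univ) (fun σ _ => hL σ)
  have hR := hasSum_sum (s := Finset.univ) (fun P _ => (MT_block a ha P).mul_left
    ((-1 : ℝ) ^ (k - P.parts.card) * (∏ B ∈ P.parts, (Nat.factorial (B.card - 1) : ℝ))))
  refine hL'.unique ?_
  refine (congrArg (fun F => HasSum F _) (funext fun g => ?_)).mpr hR
  rw [← Finset.sum_mul, MT_perm]
  have hp : ∑ P : Finpartition (Finset.univ : Finset (Fin k)), ∏ B ∈ P.parts, MTF g B =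
      if Function.Injective g then 1 else 0 := by
    rw [MT_pointwise g (Finset.univ : Finset (Fin k))]
    simp [Set.injOn_univ]
  rw [← hp, Finset.sum_mul]
  apply Finset.sum_congr rfl
  intro P _
  have hsign : (-1 : ℝ) ^ (k - P.parts.card) = ∏ B ∈ P.parts, (-1 : ℝ) ^ (B.card - 1) := by
    rw [Finset.prod_pow_eq_pow_sum]
    congr 1
    have h1 := P.sum_card_parts
    rw [Finset.card_univ, Fintype.card_fin] at h1
    have h2 : ∑ B ∈ P.parts, B.card = ∑ B ∈ P.parts, (B.card - 1) + P.parts.card := by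
      rw [Finset.card_eq_sum_ones, ← Finset.sum_add_distrib]
      apply Finset.sum_congr rfl
      intro B hB
      have := Finset.card_pos.2 (P.nonempty_of_mem_parts hB)
      omega
    omega
  rw [hsign, ← Finset.prod_mul_distrib]
  by_cases h : ∀ B ∈ P.parts, ∀ i ∈ B, ∀ j ∈ B, g i = g j
  · rw [if_pos h]
    congr 1
    apply Finset.prod_congr rfl
    intro B hB
    rw [MTF, if_pos (h B hB)]
  · rw [if_neg h, mul_zero]
    push Not at h
    obtain ⟨B, hB, i, hi, j, hj, hij⟩ := h
    rw [Finset.prod_eq_zero hB, zero_mul]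
    rw [MTF, if_neg]
    intro h'
    exact hij (h' i hi j hj)
end

section
/- For integers n ≥ 2 and k ≥ 1, t({n}_k) = Σ_{λ ⊢ k} (−1)^{k−ℓ(λ)} / (m_1(λ)! · 1^{m_1(λ)} · m_2(λ)! · 2^{m_2(λ)} ···) · Π_{j=1}^{ℓ(λ)} t(n·λ_j), where the sum is over all integer partitions λ = (λ_1 ≥ λ_2 ≥ ... ≥ λ_{ℓ(λ)}) of k. -/
noncomputable def ww (s : Multiset ℕ) : ℝ :=
  ∏ i ∈ s.toFinset, ((Nat.factorial (s.count i) : ℝ) * (i : ℝ) ^ (s.count i))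

lemma ww_cons (i : ℕ) (t : Multiset ℕ) :
    ww (i ::ₘ t) = (i : ℝ) * ((i ::ₘ t).count i) * ww t := by
  classical
  have h1 : ww t = ∏ j ∈ (i ::ₘ t).toFinset, ((Nat.factorial (t.count j) : ℝ) * (j : ℝ) ^ (t.count j)) := by
    unfold ww
    apply Finset.prod_subset
    · intro j hj; simp at hj ⊢; exact Or.inr hj
    · intro j _ hj
      have : t.count j = 0 := by simpa using hj
      simp [this]
  have h2 : (i : ℝ) * ((i ::ₘ t).count i) = ∏ j ∈ (i ::ₘ t).toFinset,
      (if i = j then (i : ℝ) * ((i ::ₘ t).count i) else 1) := by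
    rw [Finset.prod_ite_eq]; simp
  rw [h1, h2, ← Finset.prod_mul_distrib]
  unfold ww
  apply Finset.prod_congr rfl
  intro j _
  by_cases h : i = j
  · subst h
    simp [Multiset.count_cons_self, Nat.factorial_succ, pow_succ]
    ring
  · simp [h, Multiset.count_cons_of_ne (Ne.symm h)]

lemma ww_pos (s : Multiset ℕ) (hs : ∀ i ∈ s, 0 < i) : 0 < ww s := by
  unfold ww
  apply Finset.prod_pos
  intro i hi
  have := hs i (by simpa using hi)
  positivity

noncomputable def Ms (k : ℕ) : Finset (Multiset ℕ) :=
  (Finset.univ : Finset (Nat.Partition k)).image (fun μ => μ.parts)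

lemma mem_Ms (k : ℕ) (s : Multiset ℕ) : s ∈ Ms k ↔ (∀ i ∈ s, 0 < i) ∧ s.sum = k := by
  unfold Ms
  simp only [Finset.mem_image, Finset.mem_univ, true_and]
  constructor
  · rintro ⟨μ, rfl⟩
    exact ⟨fun i hi => μ.parts_pos hi, μ.parts_sum⟩
  · rintro ⟨h1, h2⟩
    exact ⟨⟨s, fun {i} hi => h1 i hi, h2⟩, rfl⟩

noncomputable def BB (q : ℕ → ℝ) (k : ℕ) : ℝ := ∑ s ∈ Ms k, (s.map q).prod / ww s

lemma BB_eq (q : ℕ → ℝ) (k : ℕ) :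
    BB q k = ∑ μ : Nat.Partition k, (μ.parts.map q).prod / ww μ.parts := by
  unfold BB Ms
  rw [Finset.sum_image]
  intro a _ b _ h
  exact Nat.Partition.ext h

lemma BB_rec (q : ℕ → ℝ) (k : ℕ) :
    (k : ℝ) * BB q k = ∑ a ∈ Finset.HasAntidiagonal.antidiagonal k with a.1 < k, BB q a.1 * q a.2 := by
  classical
  have h1 : ∀ s ∈ Ms k, (k : ℝ) * ((s.map q).prod / ww s) =
      ∑ i ∈ s.toFinset, q i * (((s.erase i).map q).prod / ww (s.erase i)) := by
    intro s hs
    rw [mem_Ms] at hs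
    have hk : (k : ℝ) = ∑ i ∈ s.toFinset, (s.count i : ℝ) * i := by
      rw [← hs.2, Finset.sum_multiset_count]; simp
    rw [hk, Finset.sum_mul]
    apply Finset.sum_congr rfl
    intro i hi
    have hi' : i ∈ s := by simpa using hi
    obtain ⟨t, rfl⟩ := Multiset.exists_cons_of_mem hi'
    have ht := ww_pos t (fun j hj => hs.1 j (Multiset.mem_cons_of_mem hj))
    have hip : (i : ℝ) ≠ 0 := by have := hs.1 i hi'; positivity
    have hc : ((Multiset.count i (i ::ₘ t) : ℕ) : ℝ) ≠ 0 := by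
      rw [Multiset.count_cons_self]; positivity
    rw [ww_cons]
    rw [Multiset.erase_cons_head, Multiset.map_cons, Multiset.prod_cons]
    field_simp
  unfold BB
  rw [Finset.mul_sum, Finset.sum_congr rfl h1]
  simp_rw [Finset.sum_mul]
  rw [Finset.sum_sigma', Finset.sum_sigma']
  refine Finset.sum_bij' (fun x _ => ⟨(k - x.2, x.2), x.1.erase x.2⟩)
    (fun y _ => ⟨y.1.2 ::ₘ y.2, y.1.2⟩) ?_ ?_ ?_ ?_ ?_
  · rintro ⟨s, i⟩ h
    simp only [Finset.mem_sigma, mem_Ms, Multiset.mem_toFinset, Finset.mem_filter,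
      Finset.HasAntidiagonal.mem_antidiagonal] at h ⊢
    obtain ⟨⟨hp, hs⟩, hi⟩ := h
    obtain ⟨t, rfl⟩ := Multiset.exists_cons_of_mem hi
    have := hp i hi
    simp only [Multiset.sum_cons, Multiset.erase_cons_head] at hs ⊢
    refine ⟨⟨by omega, by omega⟩, fun j hj => hp j (Multiset.mem_cons_of_mem hj), by omega⟩
  · rintro ⟨⟨a, b⟩, t⟩ h
    simp only [Finset.mem_sigma, mem_Ms, Multiset.mem_toFinset, Finset.mem_filter,
      Finset.HasAntidiagonal.mem_antidiagonal] at h ⊢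
    obtain ⟨⟨hab, ha⟩, hp, hs⟩ := h
    refine ⟨⟨?_, by simp; omega⟩, by simp⟩
    intro j hj
    rcases Multiset.mem_cons.1 hj with rfl | hj
    · omega
    · exact hp j hj
  · rintro ⟨s, i⟩ h
    simp only [Finset.mem_sigma, mem_Ms, Multiset.mem_toFinset] at h
    simp [Multiset.cons_erase h.2]
  · rintro ⟨⟨a, b⟩, t⟩ h
    simp only [Finset.mem_sigma, Finset.mem_filter, Finset.HasAntidiagonal.mem_antidiagonal] at h
    have : k - b = a := by omega
    simp [this]
  · rintro ⟨s, i⟩ h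
    simp [mul_comm]

noncomputable def xx (n j : ℕ) : ℝ := 1 / ((2 * j + 1 : ℕ) : ℝ) ^ n

noncomputable def eN (n N k : ℕ) : ℝ := ∑ s ∈ Finset.powersetCard k (Finset.range N), ∏ j ∈ s, xx n j

noncomputable def pN (n N i : ℕ) : ℝ := ∑ j ∈ Finset.range N, xx (n * i) j

lemma newton (n N k : ℕ) : (k : ℝ) * ((-1) ^ k * eN n N k) =
    ∑ a ∈ Finset.HasAntidiagonal.antidiagonal k with a.1 < k, ((-1) ^ a.1 * eN n N a.1) * (- pN n N a.2) := by
  have h := MvPolynomial.mul_esymm_eq_sum (Fin N) ℝ k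
  have h' := congrArg (MvPolynomial.aeval (fun j : Fin N => xx n j)) h
  have he : ∀ k, MvPolynomial.aeval (fun j : Fin N => xx n j) (MvPolynomial.esymm (Fin N) ℝ k)
      = eN n N k := by
    intro k
    rw [MvPolynomial.aeval_esymm_eq_multiset_esymm]
    have : Multiset.map (fun j : Fin N => xx n j) Finset.univ.val
        = (Finset.range N).val.map (xx n) := by
      have h0 : Finset.range N = (Finset.univ : Finset (Fin N)).map Fin.valEmbedding := by
        ext a; simp
      rw [h0, Finset.map_val, Multiset.map_map]
      rfl
    rw [this, Finset.esymm_map_val]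
    rfl
  have hp : ∀ i, MvPolynomial.aeval (fun j : Fin N => xx n j) (MvPolynomial.psum (Fin N) ℝ i)
      = pN n N i := by
    intro i
    rw [pN, Finset.sum_range]
    simp [MvPolynomial.psum, xx, pow_mul]
  simp only [map_mul, map_natCast, map_pow, map_neg, map_one, map_sum, he, hp] at h'
  rw [mul_left_comm, h', ← mul_assoc, ← pow_add]
  have : (-1 : ℝ) ^ (k + (k + 1)) = -1 := by
    rw [← add_assoc, ← two_mul, pow_succ, pow_mul]; simp
  rw [this, neg_one_mul, ← Finset.sum_neg_distrib]
  exact Finset.sum_congr rfl fun _ _ => by ring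

lemma eN_eq (n N k : ℕ) : (-1) ^ k * eN n N k = BB (fun i => - pN n N i) k := by
  induction k using Nat.strong_induction_on with
  | _ k ih =>
    rcases Nat.eq_zero_or_pos k with rfl | hk
    · rw [BB_eq]
      have : ∀ μ : Nat.Partition 0, μ.parts = 0 := by
        intro μ; rw [Subsingleton.elim μ default]; rfl
      simp [eN, this, ww]
    · have hk' : (k : ℝ) ≠ 0 := by positivity
      apply mul_left_cancel₀ hk'
      rw [newton, BB_rec]
      apply Finset.sum_congr rfl
      intro a ha
      rw [ih a.1 (Finset.mem_filter.1 ha).2]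

lemma xx_nonneg (n j : ℕ) : 0 ≤ xx n j := by unfold xx; positivity

lemma xx_summable (n : ℕ) (hn : 2 ≤ n) : Summable (xx n) := by
  have h := (Real.summable_one_div_nat_pow (p := n)).2 (by omega)
  exact h.comp_injective (i := fun j : ℕ => 2 * j + 1) (fun a b h => by simpa using h)

/-- tuple from finset -/
noncomputable def tup (k : ℕ) (s : {s : Finset ℕ // s.card = k}) :
    {f : Fin k → ℕ // StrictAnti f ∧ ∀ i, Odd (f i)} :=
  ⟨fun i => 2 * (s.1.orderEmbOfFin s.2 i.rev) + 1, by
    constructor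
    · intro a b hab
      have : s.1.orderEmbOfFin s.2 b.rev < s.1.orderEmbOfFin s.2 a.rev :=
        (s.1.orderEmbOfFin s.2).strictMono (Fin.rev_lt_rev.2 hab)
      simp only
      omega
    · intro i; exact ⟨_, rfl⟩⟩

lemma tup_bij (k : ℕ) : Function.Bijective (tup k) := by
  constructor
  · rintro ⟨s, hs⟩ ⟨t, ht⟩ h
    have h1 : ∀ i : Fin k, s.orderEmbOfFin hs i = t.orderEmbOfFin ht i := by
      intro i
      have := congrFun (congrArg Subtype.val h) i.rev
      simpa [tup] using this
    apply Subtype.ext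
    apply Finset.coe_injective
    rw [← Finset.range_orderEmbOfFin s hs, ← Finset.range_orderEmbOfFin t ht]
    congr 1
    exact funext h1
  · rintro ⟨f, hf, ho⟩
    have hg : StrictMono (fun i : Fin k => f i.rev / 2) := by
      intro a b hab
      have h1 := hf (Fin.rev_lt_rev.2 hab)
      obtain ⟨c, hc⟩ := ho a.rev
      obtain ⟨d, hd⟩ := ho b.rev
      simp only
      omega
    have hcard : (Finset.univ.image (fun i : Fin k => f i.rev / 2)).card = k := by
      rw [Finset.card_image_of_injective _ hg.injective]; simp
    refine ⟨⟨_, hcard⟩, ?_⟩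
    apply Subtype.ext
    funext i
    have := Finset.orderEmbOfFin_unique hcard (f := fun i : Fin k => f i.rev / 2) (by simp) hg
    simp only [tup]
    rw [← this]
    obtain ⟨c, hc⟩ := ho i
    simp only [Fin.rev_rev]
    omega

lemma tup_prod (n k : ℕ) (s : {s : Finset ℕ // s.card = k}) :
    ∏ i, 1 / (((tup k s).1 i : ℝ) ^ n) = ∏ j ∈ s.1, xx n j := by
  have : s.1 = Finset.univ.map (s.1.orderEmbOfFin s.2).toEmbedding := by
    simp
  conv_rhs => rw [this, Finset.prod_map]
  rw [← Equiv.prod_comp Fin.revPerm]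
  simp [tup, xx]

lemma multT_eq_s1 (n k : ℕ) : multT (fun _ : Fin k => n) =
    ∑' s : {s : Finset ℕ // s.card = k}, ∏ j ∈ s.1, xx n j := by
  unfold multT
  rw [← (Equiv.ofBijective _ (tup_bij k)).tsum_eq]
  exact tsum_congr fun s => tup_prod n k s

lemma hasSum_of (n k : ℕ) (L : ℝ) (hL : Filter.Tendsto (fun N => eN n N k) Filter.atTop (nhds L)) :
    multT (fun _ : Fin k => n) = L := by
  classical
  rw [multT_eq_s1]
  set F : Finset ℕ → ℝ := fun s => ∏ j ∈ s, xx n j with hF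
  have hF0 : ∀ s, 0 ≤ F s := fun s => Finset.prod_nonneg fun j _ => xx_nonneg n j
  let G : ℕ → Finset {s : Finset ℕ // s.card = k} := fun N =>
    (Finset.powersetCard k (Finset.range N)).subtype _
  have hG : ∀ N, ∑ s ∈ G N, F s.1 = eN n N k := by
    intro N
    rw [Finset.sum_subtype_of_mem F (fun s hs => (Finset.mem_powersetCard.1 hs).2)]
    rfl
  have hGm : Monotone G := by
    intro a b hab s hs
    simp only [G, Finset.mem_subtype, Finset.mem_powersetCard] at hs ⊢
    exact ⟨hs.1.trans (Finset.range_mono hab), hs.2⟩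
  have hGt : Filter.Tendsto G Filter.atTop Filter.atTop := by
    apply Filter.tendsto_atTop_finset_of_monotone hGm
    rintro ⟨s, hs⟩
    refine ⟨s.sup id + 1, ?_⟩
    simp only [G, Finset.mem_subtype, Finset.mem_powersetCard]
    refine ⟨fun j hj => ?_, hs⟩
    have := Finset.le_sup (f := id) hj
    simp at this ⊢
    omega
  clear_value G
  have hmono : Monotone (fun N => eN n N k) := by
    intro a b hab
    show eN n a k ≤ eN n b k
    rw [← hG a, ← hG b]
    exact Finset.sum_le_sum_of_subset_of_nonneg (hGm hab) fun s _ _ => hF0 s.1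
  have hs : Summable (fun s : {s : Finset ℕ // s.card = k} => F s.1) := by
    have hnn : (0 : {s : Finset ℕ // s.card = k} → ℝ) ≤ fun s => F s.1 := fun s => hF0 s.1
    refine summable_of_sum_le (c := L) hnn ?_
    intro u
    obtain ⟨N, hN⟩ : ∃ N, u ≤ G N := (hGt.eventually (Filter.eventually_ge_atTop u)).exists
    calc _ ≤ ∑ s ∈ G N, F s.1 :=
          Finset.sum_le_sum_of_subset_of_nonneg hN fun s _ _ => hF0 s.1
      _ ≤ L := by rw [hG]; exact hmono.ge_of_tendsto hL N
  have h := hs.hasSum.comp hGt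
  have h' : Filter.Tendsto (fun N => ∑ s ∈ G N, F s.1) Filter.atTop (nhds L) := by
    simp only [hG]; exact hL
  exact tendsto_nhds_unique h h'

lemma eN_one (n N : ℕ) : eN n N 1 = ∑ j ∈ Finset.range N, xx n j := by
  simp [eN, Finset.powersetCard_one]

lemma pN_tendsto (n i : ℕ) (hn : 2 ≤ n) (hi : 0 < i) :
    Filter.Tendsto (fun N => pN n N i) Filter.atTop (nhds (multT ![n * i])) := by
  have h2 : 2 ≤ n * i := by nlinarith
  have h := (xx_summable _ h2).hasSum.tendsto_sum_nat
  have h3 : multT (fun _ : Fin 1 => n * i) = ∑' j, xx (n * i) j := by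
    apply hasSum_of
    simpa only [eN_one] using h
  have h4 : (![n * i] : Fin 1 → ℕ) = fun _ => n * i := by
    funext j; simp
  rw [h4, h3]
  exact h

/-- Formula for `t({n}_k)` as a sum over integer partitions of `k`
(Corollary `waus`). -/
theorem multT_repeat_eq_sum_partitions (n k : ℕ) (hn : 2 ≤ n) (hk : 1 ≤ k) :
    multT (fun _ : Fin k => n) =
      ∑ μ : Nat.Partition k,
        ((-1 : ℝ) ^ (k - μ.parts.card) /
            ∏ i ∈ μ.parts.toFinset,
              ((Nat.factorial (μ.parts.count i) : ℝ) * (i : ℝ) ^ (μ.parts.count i))) *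
          (μ.parts.map (fun p => multT ![n * p])).prod := by
  apply hasSum_of
  have h : ∀ N, eN n N k = ∑ μ : Nat.Partition k, ((-1 : ℝ) ^ (k - μ.parts.card) / ww μ.parts) *
      (μ.parts.map (fun p => pN n N p)).prod := by
    intro N
    have h1 : eN n N k = (-1) ^ k * ((-1) ^ k * eN n N k) := by
      rw [← mul_assoc, ← pow_add, ← two_mul, pow_mul]; simp
    rw [h1, eN_eq, BB_eq, Finset.mul_sum]
    apply Finset.sum_congr rfl
    intro μ _
    have hc : μ.parts.card ≤ k := by
      have := Multiset.card_nsmul_le_sum (s := μ.parts) (a := 1) (fun i hi => μ.parts_pos hi)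
      simpa [μ.parts_sum] using this
    have h2 : (μ.parts.map (fun i => - pN n N i)).prod
        = (-1) ^ μ.parts.card * (μ.parts.map (fun p => pN n N p)).prod := by
      have := Multiset.prod_map_neg (μ.parts.map (fun p => pN n N p))
      simpa using this
    have h3 : (-1 : ℝ) ^ (k - μ.parts.card) = (-1) ^ k * (-1) ^ μ.parts.card := by
      obtain ⟨d, hd⟩ := Nat.exists_eq_add_of_le hc
      generalize μ.parts.card = c at *
      subst hd
      rw [Nat.add_sub_cancel_left, pow_add, mul_right_comm, ← pow_add, ← two_mul, pow_mul]; simp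
    rw [h2, h3]; ring
  simp only [h]
  apply tendsto_finsetSum
  intro μ _
  apply Filter.Tendsto.const_mul
  apply tendsto_multiset_prod
  intro i hi
  exact pN_tendsto n i hn (μ.parts_pos hi)
end

section
/- For every integer n ≥ 1, t({4}_n) = π^{4n} / (2^{2n} (4n)!). -/
open Filter Topology in
lemma cos_prod_aux (z : ℂ) (hz : z ≠ 0) (hz1 : ‖z‖ < 1) :
    Tendsto (fun n : ℕ => ∏ j ∈ Finset.range n, ((1 : ℂ) - z ^ 2 / (2 * (j : ℂ) + 1) ^ 2))
      atTop (𝓝 (Complex.cos (Real.pi * (z / 2)))) := by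
  have hpi : (Real.pi : ℂ) ≠ 0 := by exact_mod_cast Real.pi_ne_zero
  have hs : Complex.sin (Real.pi * (z / 2)) ≠ 0 := by
    intro h
    obtain ⟨k, hk⟩ := Complex.sin_eq_zero_iff.1 h
    have h2 : z = 2 * (k : ℂ) := by
      have : (Real.pi : ℂ) * (z / 2) = Real.pi * k := by rw [hk]; ring
      have := mul_left_cancel₀ hpi this
      linear_combination 2 * this
    have hk0 : k ≠ 0 := by
      rintro rfl
      simp at h2
      exact hz h2
    have h3 : (1 : ℝ) ≤ |(k : ℝ)| := by exact_mod_cast Int.one_le_abs hk0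
    rw [h2] at hz1
    simp at hz1
    linarith
  have h1 := (Complex.tendsto_euler_sin_prod z).comp
    (tendsto_id.const_mul_atTop' (show 0 < 2 by norm_num) : Tendsto (fun n : ℕ => 2 * n) atTop atTop)
  have h2 := Complex.tendsto_euler_sin_prod (z / 2)
  have h3 := (h1.div h2 hs).div_const 2
  have hsplit : ∀ n : ℕ, ∏ j ∈ Finset.range (2 * n), ((1 : ℂ) - z ^ 2 / ((j : ℂ) + 1) ^ 2)
      = (∏ j ∈ Finset.range n, ((1 : ℂ) - z ^ 2 / (2 * (j : ℂ) + 1) ^ 2)) *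
        ∏ j ∈ Finset.range n, ((1 : ℂ) - (z / 2) ^ 2 / ((j : ℂ) + 1) ^ 2) := by
    intro n
    induction n with
    | zero => simp
    | succ n ih =>
      rw [show 2 * (n + 1) = 2 * n + 1 + 1 by ring, Finset.prod_range_succ, Finset.prod_range_succ,
        ih, Finset.prod_range_succ, Finset.prod_range_succ]
      have e : (1 : ℂ) - z ^ 2 / (((2 * n + 1 : ℕ) : ℂ) + 1) ^ 2
          = 1 - (z / 2) ^ 2 / ((n : ℂ) + 1) ^ 2 := by
        have : (n : ℂ) + 1 ≠ 0 := Nat.cast_add_one_ne_zero n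
        rw [show ((2 * n + 1 : ℕ) : ℂ) + 1 = 2 * ((n : ℂ) + 1) by push_cast; ring]
        field_simp
      rw [e]
      push_cast
      ring
  have hlim : Complex.sin (Real.pi * z) / Complex.sin (Real.pi * (z / 2)) / 2
      = Complex.cos (Real.pi * (z / 2)) := by
    rw [show (Real.pi : ℂ) * z = 2 * (Real.pi * (z / 2)) by ring, Complex.sin_two_mul, mul_assoc,
      mul_left_comm, mul_div_cancel_left₀ _ hs]
    ring
  rw [hlim] at h3
  refine h3.congr' ?_
  filter_upwards [h2.eventually_ne hs] with n hn
  simp only [Function.comp, Pi.div_apply]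
  rw [hsplit]
  have hn' := right_ne_zero_of_mul hn
  generalize (∏ j ∈ Finset.range n, ((1 : ℂ) - (z / 2) ^ 2 / ((j : ℂ) + 1) ^ 2)) = B at *
  generalize (∏ j ∈ Finset.range n, ((1 : ℂ) - z ^ 2 / (2 * (j : ℂ) + 1) ^ 2)) = A at *
  field_simp

lemma cos_cos_series (w : ℂ) :
    HasSum (fun n : ℕ => (-4) ^ n * w ^ (4 * n) / ((4 * n).factorial : ℂ))
      (Complex.cos w * Complex.cos (w * Complex.I)) := by
  have h := ((Complex.hasSum_cos (w + w * Complex.I)).add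
    (Complex.hasSum_cos (w - w * Complex.I))).div_const 2
  have e : (Complex.cos (w + w * Complex.I) + Complex.cos (w - w * Complex.I)) / 2
      = Complex.cos w * Complex.cos (w * Complex.I) := by
    rw [Complex.cos_add, Complex.cos_sub]; ring
  rw [e] at h
  have a1 : (w + w * Complex.I) ^ 2 = 2 * Complex.I * w ^ 2 := by
    linear_combination w ^ 2 * Complex.I_sq
  have a2 : (w - w * Complex.I) ^ 2 = -(2 * Complex.I * w ^ 2) := by
    linear_combination w ^ 2 * Complex.I_sq
  have hinj : Function.Injective (fun n : ℕ => 2 * n) := fun a b h => by simpa using h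
  rw [← hinj.hasSum_iff] at h
  · refine h.congr_fun fun n => ?_
    simp only [Function.comp]
    rw [pow_mul (w + _), pow_mul (w - _), a1, a2, pow_mul _ 2 n, pow_mul _ 2 n, pow_mul _ 2 n,
      show 2 * (2 * n) = 4 * n by ring, pow_mul w 4 n]
    have : (2 * Complex.I * w ^ 2) ^ 2 = (-4) * w ^ 4 := by
      linear_combination 4 * w ^ 4 * Complex.I_sq
    rw [neg_sq, neg_sq, this, mul_pow]
    simp
  · intro m hm
    have hodd : Odd m := by
      rw [← Nat.not_even_iff_odd]
      rintro ⟨k, hk⟩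
      exact hm ⟨k, by simp; omega⟩
    rw [pow_mul (w + _), pow_mul (w - _), a1, a2, hodd.neg_pow (2 * Complex.I * w ^ 2)]
    ring

noncomputable def eCoef (n : ℕ) : ℂ :=
  ∑' s : Set.powersetCard ℕ n, ∏ j ∈ (s : Finset ℕ), 1 / (2 * (j : ℂ) + 1) ^ 4

lemma summable_a : Summable (fun j : ℕ => ‖(1 : ℂ) / (2 * (j : ℂ) + 1) ^ 4‖) := by
  have h : Summable (fun j : ℕ => 1 / (j : ℝ) ^ 4) :=
    Real.summable_one_div_nat_pow.2 (by norm_num)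
  have h2 := h.comp_injective (i := fun j : ℕ => 2 * j + 1) (fun a b h => by simpa using h)
  refine h2.congr fun j => ?_
  simp only [Function.comp]
  rw [norm_div, norm_pow, show (2 * (j : ℂ) + 1) = ((2 * j + 1 : ℕ) : ℂ) by push_cast; ring,
    Complex.norm_natCast]
  simp

lemma hasSum_e (y : ℂ) :
    HasSum (fun n : ℕ => y ^ n * eCoef n) (∏' j : ℕ, (1 + y * (1 / (2 * (j : ℂ) + 1) ^ 4))) := by
  have hs : Summable (fun s : Finset ℕ => ∏ j ∈ s, y * (1 / (2 * (j : ℂ) + 1) ^ 4)) := by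
    apply summable_finsetProd_of_summable_norm
    simp_rw [norm_mul y]
    exact summable_a.mul_left _
  have hs1 : Summable (fun s : Finset ℕ => ∏ j ∈ s, (1 / (2 * (j : ℂ) + 1) ^ 4)) :=
    summable_finsetProd_of_summable_norm summable_a
  rw [tprod_one_add hs]
  have h := (Set.powersetCard.prodEquiv (α := ℕ)).hasSum_iff.2 hs.hasSum
  refine h.sigma fun n => ?_
  have h1 : Summable (fun s : Set.powersetCard ℕ n =>
      ∏ j ∈ (s : Finset ℕ), (1 / (2 * (j : ℂ) + 1) ^ 4)) :=
    hs1.comp_injective Subtype.val_injective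
  have h2 := h1.hasSum.mul_left (y ^ n)
  refine h2.congr_fun ?_ 
  intro s
  simp [Finset.prod_mul_distrib]

open Filter Topology in
lemma eCoef_eq (n : ℕ) : eCoef n = (Real.pi : ℂ) ^ (4 * n) / (2 ^ (2 * n) * (4 * n).factorial) := by
  set c : ℕ → ℂ := fun n => (Real.pi : ℂ) ^ (4 * n) / (2 ^ (2 * n) * (4 * n).factorial) with hc
  set F : ℂ → ℂ := fun y => ∏' j : ℕ, (1 + y * (1 / (2 * (j : ℂ) + 1) ^ 4)) with hF
  have h1 : HasFPowerSeriesAt F (FormalMultilinearSeries.ofScalars ℂ eCoef) 0 := by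
    rw [hasFPowerSeriesAt_iff]
    refine Eventually.of_forall fun y => ?_
    simp only [FormalMultilinearSeries.coeff_ofScalars, zero_add, smul_eq_mul]
    exact hasSum_e y
  have h2 : HasFPowerSeriesAt F (FormalMultilinearSeries.ofScalars ℂ c) 0 := by
    rw [hasFPowerSeriesAt_iff]
    filter_upwards [Metric.ball_mem_nhds (0 : ℂ) one_pos] with y hy
    simp only [FormalMultilinearSeries.coeff_ofScalars, zero_add, smul_eq_mul]
    by_cases hy0 : y = 0
    · subst hy0
      have : F 0 = (0 : ℂ) ^ 0 * c 0 := by simp [hF, hc]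
      rw [this]
      exact hasSum_single 0 (fun b hb => by simp [hb])
    obtain ⟨x, hx⟩ := IsAlgClosed.exists_pow_nat_eq (-y) (show 0 < 4 by norm_num)
    have hyx : y = -x ^ 4 := by rw [hx]; ring
    have hx0 : x ≠ 0 := by
      rintro rfl
      simp at hyx
      exact hy0 hyx
    have hxn : ‖x‖ < 1 := by
      have : ‖x‖ ^ 4 < 1 := by
        rw [← norm_pow, hx, norm_neg]; simpa using hy
      by_contra hcon
      exact absurd this (not_lt.2 (one_le_pow₀ (not_lt.1 hcon)))
    have t1 := cos_prod_aux x hx0 hxn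
    have t2 := cos_prod_aux (x * Complex.I) (mul_ne_zero hx0 Complex.I_ne_zero) (by simpa using hxn)
    have t3 := t1.mul t2
    have hmul : Multipliable (fun j : ℕ => (1 + y * (1 / (2 * (j : ℂ) + 1) ^ 4))) := by
      apply multipliable_one_add_of_summable
      simp_rw [norm_mul y]
      exact summable_a.mul_left _
    have t4 := hmul.hasProd.tendsto_prod_nat
    have hFy : F y = Complex.cos (Real.pi * (x / 2)) * Complex.cos (Real.pi * (x * Complex.I / 2)) := by
      refine tendsto_nhds_unique t4 (t3.congr fun n => ?_)
      rw [← Finset.prod_mul_distrib]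
      refine Finset.prod_congr rfl fun j _ => ?_
      have : (2 * (j : ℂ) + 1) ≠ 0 := by exact_mod_cast Nat.succ_ne_zero (2 * j)
      rw [hyx, mul_pow, Complex.I_sq]
      field_simp
      ring
    rw [hFy]
    have := cos_cos_series (Real.pi * (x / 2))
    rw [show (Real.pi : ℂ) * (x / 2) * Complex.I = Real.pi * (x * Complex.I / 2) by ring] at this
    refine this.congr_fun fun m => ?_
    simp only [hc]
    have e1 : (-x ^ 4) * ((Real.pi : ℂ) ^ 4 / 2 ^ 2) = -4 * (Real.pi * (x / 2)) ^ 4 := by ring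
    have e2 := congrArg (fun t => t ^ m) e1
    simp only [mul_pow (-x ^ 4), mul_pow (-4 : ℂ), div_pow ((Real.pi : ℂ) ^ 4), ← pow_mul] at e2
    rw [hyx, ← div_div, ← e2, mul_div_assoc]
  have h3 := h1.eq_formalMultilinearSeries h2
  have h4 := congrArg (fun p => FormalMultilinearSeries.coeff p n) h3
  simpa [FormalMultilinearSeries.coeff_ofScalars] using h4

/-- The set of halves of a decreasing tuple of odd numbers. -/
def toSet (n : ℕ) (f : {f : Fin n → ℕ // StrictAnti f ∧ ∀ i, Odd (f i)}) :
    Set.powersetCard ℕ n :=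
  ⟨Finset.univ.image (fun i => f.1 i / 2), by
    rw [Set.powersetCard.mem_iff, Finset.card_image_of_injective]
    · simp
    · intro i j h
      apply f.2.1.injective
      obtain ⟨a, ha⟩ := f.2.2 i
      obtain ⟨b, hb⟩ := f.2.2 j
      simp only at h
      omega⟩

lemma half_anti {n : ℕ} (f : {f : Fin n → ℕ // StrictAnti f ∧ ∀ i, Odd (f i)}) :
    StrictAnti (fun i => f.1 i / 2) := by
  intro i j h
  have := f.2.1 h
  obtain ⟨a, ha⟩ := f.2.2 i
  obtain ⟨b, hb⟩ := f.2.2 j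
  simp only
  omega

lemma toSet_bij (n : ℕ) : Function.Bijective (toSet n) := by
  constructor
  · intro f g h
    have h1 : Finset.univ.image (fun i => f.1 i / 2) = Finset.univ.image (fun i => g.1 i / 2) :=
      congrArg Subtype.val h
    have h2 : Set.range (fun i => f.1 i / 2) = Set.range (fun i => g.1 i / 2) := by
      have := congrArg (fun s : Finset ℕ => (s : Set ℕ)) h1
      simpa using this
    have h3 := ((half_anti f).range_inj (half_anti g)).1 h2
    apply Subtype.ext
    funext i
    have h4 := congrFun h3 i
    obtain ⟨a, ha⟩ := f.2.2 i
    obtain ⟨b, hb⟩ := g.2.2 i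
    omega
  · intro s
    refine ⟨⟨fun i => 2 * (s : Finset ℕ).orderEmbOfFin s.2 i.rev + 1, ?_, ?_⟩, ?_⟩
    · intro i j h
      have := ((s : Finset ℕ).orderEmbOfFin s.2).strictMono (Fin.rev_lt_rev.2 h)
      beta_reduce
      omega
    · intro i
      exact ⟨_, rfl⟩
    · apply Subtype.ext
      apply Finset.coe_injective
      simp only [toSet, Finset.coe_image, Finset.coe_univ, Set.image_univ]
      rw [← Finset.range_orderEmbOfFin (s : Finset ℕ) s.2]
      ext m
      constructor
      · rintro ⟨i, hi⟩
        exact ⟨i.rev, by simp only at hi; omega⟩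
      · rintro ⟨i, hi⟩
        exact ⟨i.rev, by simp only [Fin.rev_rev]; omega⟩

/-- `t({4}_n) = π^(4n) / (2^(2n) (4n)!)`. -/
theorem multT_repeat_four (n : ℕ) (hn : 1 ≤ n) :
    multT (fun _ : Fin n => 4) =
      Real.pi ^ (4 * n) / (2 ^ (2 * n) * Nat.factorial (4 * n)) := by
  have key : ((multT (fun _ : Fin n => 4) : ℝ) : ℂ) = eCoef n := by
    unfold multT eCoef
    rw [Complex.ofReal_tsum, ← (Equiv.ofBijective _ (toSet_bij n)).tsum_eq]
    refine tsum_congr fun f => ?_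
    simp only [Equiv.ofBijective_apply, toSet]
    rw [Finset.prod_image (fun i _ j _ h => (half_anti f).injective h)]
    push_cast
    refine Finset.prod_congr rfl fun i _ => ?_
    obtain ⟨a, ha⟩ := f.2.2 i
    rw [ha, show (2 * a + 1) / 2 = a by omega]
    push_cast
    rfl
  rw [eCoef_eq] at key
  exact_mod_cast key
end

section
/- For every integer n ≥ 1, t({6}_n) = 3·π^{6n} / (4·(6n)!). -/
lemma aux_summable (x : ℂ) : Summable (fun j : ℕ => ‖-x ^ 2 / ((j : ℂ) + 1) ^ 2‖) := by
  have h : Summable (fun j : ℕ => ‖x‖ ^ 2 * (1 / ((j : ℝ) + 1) ^ 2)) := by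
    apply Summable.mul_left
    have := (summable_nat_add_iff (f := fun j : ℕ => 1 / (j : ℝ) ^ 2) 1).2
      (Real.summable_one_div_nat_pow.2 (by norm_num))
    simpa using this
  refine h.congr fun j => ?_
  have : ‖(j : ℂ) + 1‖ = (j : ℝ) + 1 := by
    have := Complex.norm_natCast (j + 1)
    push_cast at this
    exact this
  rw [norm_div, norm_neg, norm_pow, norm_pow, this]
  ring

lemma aux_mult (x : ℂ) : Multipliable (fun j : ℕ => 1 - x ^ 2 / ((j : ℂ) + 1) ^ 2) := by
  have := multipliable_one_add_of_summable (aux_summable x)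
  refine this.congr fun j => ?_
  ring

lemma aux_mult_odd (x : ℂ) : Multipliable (fun k : ℕ => 1 - x ^ 2 / (2 * (k : ℂ) + 1) ^ 2) := by
  have := multipliable_one_add_of_summable
    ((aux_summable x).comp_injective (mul_right_injective₀ (two_ne_zero' ℕ)))
  refine this.congr fun j => ?_
  push_cast [Function.comp]
  ring

lemma aux_sin (x : ℂ) :
    Real.pi * x * ∏' j : ℕ, (1 - x ^ 2 / ((j : ℂ) + 1) ^ 2) = Complex.sin (Real.pi * x) :=
  tendsto_nhds_unique ((aux_mult x).hasProd.tendsto_prod_nat.const_mul _)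
    (Complex.tendsto_euler_sin_prod x)

lemma cos_hasProd (x : ℂ) (hx : ‖x‖ < 1) :
    HasProd (fun k : ℕ => 1 - x ^ 2 / (2 * (k : ℂ) + 1) ^ 2) (Complex.cos (Real.pi * x / 2)) := by
  have h1 := (aux_mult_odd x).hasProd
  convert h1 using 1
  by_cases h0 : x = 0
  · simp [h0]
  have hE := (aux_mult (x / 2)).hasProd
  have hT : HasProd (fun j : ℕ => 1 - x ^ 2 / ((j : ℂ) + 1) ^ 2)
      ((∏' k : ℕ, (1 - x ^ 2 / (2 * (k : ℂ) + 1) ^ 2)) *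
        ∏' j : ℕ, (1 - (x / 2) ^ 2 / ((j : ℂ) + 1) ^ 2)) := by
    refine HasProd.even_mul_odd (m := ∏' k : ℕ, (1 - x ^ 2 / (2 * (k : ℂ) + 1) ^ 2))
      (m' := ∏' j : ℕ, (1 - (x / 2) ^ 2 / ((j : ℂ) + 1) ^ 2)) ?_ ?_
    · simpa using h1
    · convert hE using 2 with j
      have : (j : ℂ) + 1 ≠ 0 := by exact_mod_cast Nat.succ_ne_zero j
      push_cast
      rw [show (2 * (j : ℂ) + 1 + 1) = 2 * (j + 1) by ring]
      field_simp
  have hs := aux_sin x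
  rw [hT.tprod_eq] at hs
  have hs2 := aux_sin (x / 2)
  have hd : Complex.sin (Real.pi * x) =
      2 * Complex.sin (Real.pi * (x / 2)) * Complex.cos (Real.pi * x / 2) := by
    rw [show (Real.pi * x : ℂ) = 2 * (Real.pi * (x / 2)) by ring, Complex.sin_two_mul]
    congr 2
    ring
  have hne : Complex.sin (Real.pi * (x / 2)) ≠ 0 := by
    intro h
    obtain ⟨k, hk⟩ := Complex.sin_eq_zero_iff.1 h
    have hpi : (Real.pi : ℂ) ≠ 0 := by exact_mod_cast Real.pi_ne_zero
    have hxk : x = ((2 * k : ℤ) : ℂ) := by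
      push_cast
      have : (Real.pi : ℂ) * x = Real.pi * (2 * k) := by linear_combination 2 * hk
      exact mul_left_cancel₀ hpi this
    rw [hxk, Complex.norm_intCast] at hx
    have hx' : |2 * k| < 1 := by exact_mod_cast hx
    have hk0 : k = 0 := by
      rw [abs_lt] at hx'
      omega
    exact h0 (by simp [hxk, hk0])
  apply mul_left_cancel₀ (mul_ne_zero two_ne_zero hne)
  rw [← hd, ← hs, ← hs2]
  ring

lemma cos_three (a b c : ℂ) (h : a + b + c = 0) :
    Complex.cos a * Complex.cos b * Complex.cos c =
      (1 + Complex.cos (2 * a) + Complex.cos (2 * b) + Complex.cos (2 * c)) / 4 := by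
  obtain rfl : c = -(a + b) := by linear_combination h
  rw [mul_neg, Complex.cos_neg, Complex.cos_neg, mul_add, Complex.cos_add, Complex.cos_add,
    Complex.cos_two_mul, Complex.cos_two_mul, Complex.sin_two_mul, Complex.sin_two_mul]
  have h1 := Complex.sin_sq_add_cos_sq a
  have h2 := Complex.sin_sq_add_cos_sq b
  ring_nf

/-- coefficients -/
noncomputable def bco (j : ℕ) : ℂ :=
  (if j = 0 then 1 / 4 else 0) + 3 / 4 * (Real.pi ^ (6 * j) / (Nat.factorial (6 * j) : ℂ))

lemma exists_om : ∃ w : ℂ, w ^ 3 = 1 ∧ 1 + w + w ^ 2 = 0 := by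
  have h := Complex.isPrimitiveRoot_exp 3 (by norm_num)
  refine ⟨_, h.pow_eq_one, ?_⟩
  have := h.geom_sum_eq_zero (by norm_num)
  simpa [Finset.sum_range_succ] using this

lemma cos_sum_series (w x : ℂ) (h3 : w ^ 3 = 1) (h1 : 1 + w + w ^ 2 = 0) :
    HasSum (fun j : ℕ => (-x ^ 6) ^ j * bco j)
      ((1 + Complex.cos (Real.pi * x) + Complex.cos (Real.pi * (w * x)) +
        Complex.cos (Real.pi * (w ^ 2 * x))) / 4) := by
  have hA := ((Complex.hasSum_cos (Real.pi * x)).add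
    (Complex.hasSum_cos (Real.pi * (w * x)))).add (Complex.hasSum_cos (Real.pi * (w ^ 2 * x)))
  have hinj : Function.Injective (fun j : ℕ => 3 * j) := mul_right_injective₀ (by norm_num)
  rw [← hinj.hasSum_iff] at hA
  · have hB := ((hasSum_ite_eq (0 : ℕ) (1 : ℂ)).add hA).div_const 4
    convert! hB using 1
    · funext j
      have e1 : w ^ (2 * (3 * j)) = 1 := by
        rw [show 2 * (3 * j) = 3 * (2 * j) by ring, pow_mul, h3, one_pow]
      have e2 : (w ^ 2) ^ (2 * (3 * j)) = 1 := by
        rw [← pow_mul, show 2 * (2 * (3 * j)) = 3 * (4 * j) by ring, pow_mul, h3, one_pow]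
      have e3 : (-x ^ 6) ^ j = (-1) ^ (3 * j) * x ^ (2 * (3 * j)) := by
        rw [neg_pow, ← pow_mul, pow_mul (-1 : ℂ) 3 j, show 6 * j = 2 * (3 * j) by ring]
        norm_num
      simp only [Function.comp, mul_pow, e1, e2, bco, one_mul]
      rw [e3, show 6 * j = 2 * (3 * j) by ring]
      by_cases hj : j = 0
      · subst hj
        norm_num
      · simp only [hj, if_false]
        ring
    · ring
  · intro m hm
    have key : 1 + w ^ (2 * m) + (w ^ 2) ^ (2 * m) = 0 := by
      have hm' : m % 3 = 1 ∨ m % 3 = 2 := by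
        have : m % 3 ≠ 0 := by
          intro h
          exact hm ⟨m / 3, by simp only []; omega⟩
        omega
      rw [← pow_mul]
      rcases hm' with h | h
      · obtain ⟨q, rfl⟩ : ∃ q, m = 3 * q + 1 := ⟨m / 3, by omega⟩
        rw [show 2 * (3 * q + 1) = 3 * (2 * q) + 2 by ring,
          show 2 * (3 * (2 * q) + 2) = 3 * (4 * q + 1) + 1 by ring,
          pow_add, pow_mul w 3, h3, pow_add w (3 * _), pow_mul w 3, h3]
        simp only [one_pow]
        linear_combination h1
      · obtain ⟨q, rfl⟩ : ∃ q, m = 3 * q + 2 := ⟨m / 3, by omega⟩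
        rw [show 2 * (3 * q + 2) = 3 * (2 * q + 1) + 1 by ring,
          show 2 * (3 * (2 * q + 1) + 1) = 3 * (4 * q + 2) + 2 by ring,
          pow_add, pow_mul w 3, h3, pow_add w (3 * _), pow_mul w 3, h3]
        simp only [one_pow]
        linear_combination h1
    simp only [mul_pow]
    linear_combination ((-1) ^ m * (Real.pi ^ (2 * m) * x ^ (2 * m)) /
      ((2 * m).factorial : ℂ)) * key

lemma prod_series (y : ℂ) (hy : ‖y‖ < 1) :
    ∃ S : ℂ, HasProd (fun k : ℕ => 1 + y * (1 / (2 * (k : ℂ) + 1) ^ 6)) S ∧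
      HasSum (fun j : ℕ => y ^ j * bco j) S := by
  obtain ⟨w, h3, h1⟩ := exists_om
  obtain ⟨x, hx⟩ := IsAlgClosed.exists_pow_nat_eq (-y) (n := 6) (by norm_num)
  have hxn : ‖x‖ < 1 := by
    have : ‖x‖ ^ 6 < 1 := by rw [← norm_pow, hx, norm_neg]; exact hy
    exact lt_of_pow_lt_pow_left₀ 6 zero_le_one (by simpa using this)
  have hw : ‖w‖ = 1 := by
    have : ‖w‖ ^ 3 = 1 := by rw [← norm_pow, h3, norm_one]
    exact (pow_eq_one_iff_of_nonneg (norm_nonneg _) (by norm_num)).1 this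
  have p1 := cos_hasProd x hxn
  have p2 := cos_hasProd (w * x) (by simpa [hw] using hxn)
  have p3 := cos_hasProd (w ^ 2 * x) (by simpa [hw] using hxn)
  have p := (p1.mul p2).mul p3
  rw [cos_three _ _ _ (by linear_combination (Real.pi * x / 2 : ℂ) * h1)] at p
  have hs := cos_sum_series w x h3 h1
  refine ⟨(1 + Complex.cos (Real.pi * x) + Complex.cos (Real.pi * (w * x)) +
        Complex.cos (Real.pi * (w ^ 2 * x))) / 4, ?_, ?_⟩
  rotate_left
  · convert! hs using 3
    rw [hx, neg_neg]
  · convert! p using 1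
    · funext k
      have hk : (2 * (k : ℂ) + 1) ≠ 0 := by exact_mod_cast Nat.succ_ne_zero (2 * k)
      rw [show y = -x ^ 6 by rw [hx, neg_neg]]
      generalize 2 * (k : ℂ) + 1 = d at hk
      have hw4 : w ^ 4 = w := by linear_combination w * h3
      have hw6 : w ^ 6 = 1 := by linear_combination (w ^ 3 + 1) * h3
      have e : ∀ A : ℂ, (1 - A) * (1 - w ^ 2 * A) * (1 - w ^ 4 * A) = 1 - A ^ 3 := fun A => by
        linear_combination (-A + A ^ 2) * h1 + (-A + A ^ 2 * (1 + w ^ 2)) * hw4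
          + (A ^ 2 - A ^ 3) * hw6 - A ^ 2 * (hw6 - w ^ 2 * hw4 + w ^ 2 * hw4) + A ^ 2 * h3
      have e' := e (x ^ 2 / d ^ 2)
      have l : 1 + -x ^ 6 * (1 / d ^ 6) = 1 - (x ^ 2 / d ^ 2) ^ 3 := by ring
      rw [l, ← e']
      ring
    · rw [show ∀ z : ℂ, 2 * (z / 2) = z from fun z => by ring,
        show ∀ z : ℂ, 2 * (z / 2) = z from fun z => by ring,
        show ∀ z : ℂ, 2 * (z / 2) = z from fun z => by ring]

lemma summ6 : Summable (fun k : ℕ => ‖(1 : ℂ) / (2 * (k : ℂ) + 1) ^ 6‖) := by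
  have h := (Real.summable_one_div_nat_pow (p := 6)).2 (by norm_num)
  have h' := h.comp_injective (i := fun k : ℕ => 2 * k + 1) (fun a b h => by simpa using h)
  refine h'.congr fun k => ?_
  have : ‖2 * (k : ℂ) + 1‖ = 2 * (k : ℝ) + 1 := by
    have := Complex.norm_natCast (2 * k + 1)
    push_cast at this
    exact this
  rw [norm_div, norm_pow, this, norm_one]
  simp

/-- elementary symmetric sums -/
noncomputable def eco (n : ℕ) : ℂ :=
  ∑' s : {s : Finset ℕ // s.card = n}, ∏ k ∈ s.1, (1 : ℂ) / (2 * (k : ℂ) + 1) ^ 6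

lemma eco_series (y : ℂ) (S : ℂ)
    (hp : HasProd (fun k : ℕ => 1 + y * (1 / (2 * (k : ℂ) + 1) ^ 6)) S) :
    HasSum (fun j : ℕ => y ^ j * eco j) S := by
  have hsum : Summable (fun k : ℕ => ‖y * ((1 : ℂ) / (2 * (k : ℂ) + 1) ^ 6)‖) := by
    simpa only [norm_mul] using summ6.mul_left ‖y‖
  have h := (summable_finsetProd_of_summable_norm hsum).hasSum
  have hS := (hasProd_one_add_of_hasSum_prod h).unique hp
  rw [hS] at h
  rw [← (Equiv.sigmaFiberEquiv (Finset.card : Finset ℕ → ℕ)).hasSum_iff] at h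
  refine h.sigma fun j => ?_
  have h2 : Summable (fun s : {s : Finset ℕ // s.card = j} =>
      ∏ k ∈ s.1, (1 : ℂ) / (2 * (k : ℂ) + 1) ^ 6) :=
    (summable_finsetProd_of_summable_norm summ6).comp_injective Subtype.val_injective
  convert! h2.hasSum.mul_left (y ^ j) using 1
  funext s
  simp only [Function.comp, Equiv.sigmaFiberEquiv, Equiv.coe_fn_mk]
  rw [Finset.prod_mul_distrib, Finset.prod_const, s.2]

lemma eco_eq_bco (n : ℕ) : eco n = bco n := by
  classical
  have hev : ∀ᶠ y : ℂ in nhds 0, ‖y‖ < 1 := by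
    have := Metric.ball_mem_nhds (0 : ℂ) one_pos
    filter_upwards [this] with y hy using by simpa using hy
  let f : ℂ → ℂ := fun y => ∑' j, y ^ j * bco j
  have hb : HasFPowerSeriesAt f (FormalMultilinearSeries.ofScalars ℂ bco) 0 := by
    rw [hasFPowerSeriesAt_iff]
    filter_upwards [hev] with y hy
    obtain ⟨S, -, h⟩ := prod_series y hy
    simpa [f] using h.summable.hasSum
  have he : HasFPowerSeriesAt f (FormalMultilinearSeries.ofScalars ℂ eco) 0 := by
    rw [hasFPowerSeriesAt_iff]
    filter_upwards [hev] with y hy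
    obtain ⟨S, hp, h⟩ := prod_series y hy
    have := eco_series y S hp
    rw [← h.tsum_eq] at this
    simpa [f] using this
  have := he.eq_formalMultilinearSeries hb
  exact congrFun (FormalMultilinearSeries.ofScalars_series_injective ℂ ℂ this) n

lemma card_bij (n : ℕ) : Function.Bijective
    (fun s : {s : Finset ℕ // s.card = n} =>
      (⟨fun i => 2 * s.1.orderEmbOfFin s.2 i.rev + 1,
        fun i j h => by
          have := (s.1.orderEmbOfFin s.2).strictMono (Fin.rev_lt_rev.2 h)
          simp only []
          omega,
        fun i => ⟨_, rfl⟩⟩ : {f : Fin n → ℕ // StrictAnti f ∧ ∀ i, Odd (f i)})) := by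
  constructor
  · rintro ⟨s, hs⟩ ⟨t, ht⟩ h
    simp only [Subtype.mk.injEq] at h ⊢
    have h' : ∀ i, s.orderEmbOfFin hs i = t.orderEmbOfFin ht i := fun i => by
      have := congrFun h i.rev
      simp only [Fin.rev_rev] at this
      omega
    rw [← Finset.coe_inj, ← Finset.range_orderEmbOfFin s hs, ← Finset.range_orderEmbOfFin t ht]
    congr 1
    exact funext h'
  · rintro ⟨f, hf, ho⟩
    have hm : StrictMono (fun i : Fin n => f i.rev / 2) := by
      intro i j h
      have h1 := hf (Fin.rev_lt_rev.2 h)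
      obtain ⟨a, ha⟩ := ho i.rev
      obtain ⟨b, hb⟩ := ho j.rev
      simp only []
      omega
    have hc : (Finset.univ.image (fun i : Fin n => f i.rev / 2)).card = n := by
      rw [Finset.card_image_of_injective _ hm.injective]; simp
    refine ⟨⟨_, hc⟩, ?_⟩
    have := Finset.orderEmbOfFin_unique hc (f := fun i : Fin n => f i.rev / 2)
      (fun i => Finset.mem_image_of_mem _ (Finset.mem_univ _)) hm
    apply Subtype.ext
    funext i
    have h := congrFun this i.rev
    simp only [Fin.rev_rev] at h
    obtain ⟨a, ha⟩ := ho i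
    simp only []
    rw [← h]
    omega

lemma multT_eq_s5 (n : ℕ) : ((multT (fun _ : Fin n => 6) : ℝ) : ℂ) = eco n := by
  unfold multT eco
  rw [Complex.ofReal_tsum, ← (Equiv.ofBijective _ (card_bij n)).tsum_eq]
  refine tsum_congr fun s => ?_
  simp only [Equiv.ofBijective_apply]
  push_cast
  refine (Equiv.prod_comp Fin.revPerm
    (fun i => (1 : ℂ) / (2 * ((s.1.orderEmbOfFin s.2 i : ℕ) : ℂ) + 1) ^ 6)).trans ?_
  conv_rhs => rw [← Finset.map_orderEmbOfFin_univ s.1 s.2, Finset.prod_map]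
  rfl

/-- `t({6}_n) = 3π^(6n) / (4(6n)!)`. -/
theorem multT_repeat_six (n : ℕ) (hn : 1 ≤ n) :
    multT (fun _ : Fin n => 6) =
      3 * Real.pi ^ (6 * n) / (4 * Nat.factorial (6 * n)) := by
  have h := (multT_eq_s5 n).trans (eco_eq_bco n)
  rw [bco, if_neg (by omega)] at h
  apply Complex.ofReal_injective
  rw [h]
  push_cast
  rw [zero_add, div_mul_div_comm]
end

section
/- For every integer k ≥ 1, t({8}_k) = π^{8k} / (2^{2k+1} (8k)!) · [ (3 + 2√2)^{2k} + (3 − 2√2)^{2k} ]. -/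
open Filter Topology in
lemma aux_unique {a b : ℕ → ℂ} {f : ℂ → ℂ}
    (ha : ∀ᶠ z in 𝓝 (0:ℂ), HasSum (fun n => a n * z ^ n) (f z))
    (hb : ∀ᶠ z in 𝓝 (0:ℂ), HasSum (fun n => b n * z ^ n) (f z)) (n : ℕ) : a n = b n := by
  have h1 : HasFPowerSeriesAt f (FormalMultilinearSeries.ofScalars ℂ a) 0 := by
    rw [hasFPowerSeriesAt_iff]
    filter_upwards [ha] with z hz
    simpa [FormalMultilinearSeries.coeff_ofScalars, mul_comm] using hz
  have h2 : HasFPowerSeriesAt f (FormalMultilinearSeries.ofScalars ℂ b) 0 := by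
    rw [hasFPowerSeriesAt_iff]
    filter_upwards [hb] with z hz
    simpa [FormalMultilinearSeries.coeff_ofScalars, mul_comm] using hz
  simpa [FormalMultilinearSeries.coeff_ofScalars] using
    congr_arg (FormalMultilinearSeries.coeff · n) (h1.eq_formalMultilinearSeries h2)

lemma aux_split (z : ℂ) (N : ℕ) :
    ∏ j ∈ Finset.range (2 * N), ((1 : ℂ) - z ^ 2 / ((j : ℂ) + 1) ^ 2) =
    (∏ j ∈ Finset.range N, ((1 : ℂ) - z ^ 2 / (2 * (j : ℂ) + 1) ^ 2)) *
      ∏ j ∈ Finset.range N, ((1 : ℂ) - (z / 2) ^ 2 / ((j : ℂ) + 1) ^ 2) := by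
  induction N with
  | zero => simp
  | succ N ih =>
    rw [Nat.mul_succ, Finset.prod_range_succ, Finset.prod_range_succ, ih,
      Finset.prod_range_succ, Finset.prod_range_succ]
    have h : (1 : ℂ) - z ^ 2 / (((2 * N + 1 : ℕ) : ℂ) + 1) ^ 2
        = 1 - (z / 2) ^ 2 / ((N : ℂ) + 1) ^ 2 := by
      have : (N : ℂ) + 1 ≠ 0 := Nat.cast_add_one_ne_zero N
      have h2 : (2 : ℂ) * N + 1 + 1 = 2 * (N + 1) := by ring
      push_cast
      rw [h2]
      field_simp
    rw [h]
    push_cast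
    ring

open Filter Topology in
lemma aux_cos (z : ℂ) (hz : ‖z‖ < 1) :
    Tendsto (fun N : ℕ => ∏ j ∈ Finset.range N, ((1 : ℂ) - z ^ 2 / (2 * (j : ℂ) + 1) ^ 2))
      atTop (𝓝 (Complex.cos (Real.pi * z / 2))) := by
  by_cases h0 : z = 0
  · subst h0; simp
  have hpi : (Real.pi : ℂ) ≠ 0 := by exact_mod_cast Real.pi_ne_zero
  have hs : Complex.sin (Real.pi * (z / 2)) ≠ 0 := by
    intro h
    obtain ⟨k, hk⟩ := Complex.sin_eq_zero_iff.1 h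
    have hzk : z = 2 * k := by
      have : (Real.pi : ℂ) * (z - 2 * k) = 0 := by linear_combination 2 * hk
      rcases mul_eq_zero.1 this with h | h
      · exact absurd h hpi
      · linear_combination h
    have : k ≠ 0 := by rintro rfl; simp at hzk; exact h0 hzk
    have h1 : (1 : ℝ) ≤ |(k : ℝ)| := by exact_mod_cast Int.one_le_abs this
    rw [hzk, norm_mul, Complex.norm_intCast] at hz
    simp at hz
    linarith
  have A := (Complex.tendsto_euler_sin_prod z).comp (tendsto_id.const_mul_atTop' (zero_lt_two (α := ℕ)))
  have B := Complex.tendsto_euler_sin_prod (z / 2)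
  have hsin : Complex.sin (Real.pi * z) =
      2 * Complex.cos (Real.pi * z / 2) * Complex.sin (Real.pi * (z / 2)) := by
    have : (Real.pi : ℂ) * z = 2 * (Real.pi * z / 2) := by ring
    rw [this, Complex.sin_two_mul, show (Real.pi : ℂ) * (z / 2) = Real.pi * z / 2 by ring,
      show (2 : ℂ) * (Real.pi * z / 2) / 2 = Real.pi * z / 2 by ring]
    ring
  have C := (A.div B hs).div_const 2
  rw [hsin] at C
  have e1 : 2 * Complex.cos (Real.pi * z / 2) * Complex.sin (Real.pi * (z / 2)) /
      Complex.sin (Real.pi * (z / 2)) / 2 = Complex.cos (Real.pi * z / 2) := by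
    rw [mul_div_cancel_right₀ _ hs]; ring
  rw [e1] at C
  refine C.congr' ?_
  filter_upwards [B.eventually_ne hs] with N hN
  simp only [Function.comp, id, Pi.div_apply]
  rw [aux_split]
  set P := ∏ j ∈ Finset.range N, ((1 : ℂ) - (z / 2) ^ 2 / ((j : ℂ) + 1) ^ 2)
  have hP : P ≠ 0 := right_ne_zero_of_mul hN
  field_simp

lemma aux_cos4 (a b c d : ℂ) : Complex.cos a * Complex.cos b * Complex.cos c * Complex.cos d =
    (Complex.cos (a + b + (c + d)) + Complex.cos (a + b - (c + d)) +
     Complex.cos (a - b + (c + d)) + Complex.cos (a - b - (c + d)) +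
     Complex.cos (a + b + (c - d)) + Complex.cos (a + b - (c - d)) +
     Complex.cos (a - b + (c - d)) + Complex.cos (a - b - (c - d))) / 8 := by
  simp only [Complex.cos_add, Complex.cos_sub, Complex.sin_add, Complex.sin_sub]
  ring

/-- Taylor coefficients of `cos (c z)`. -/
noncomputable def auxC (c : ℂ) (n : ℕ) : ℂ :=
  ((c * Complex.I) ^ n + (-(c * Complex.I)) ^ n) / 2 / (n.factorial : ℂ)

lemma auxC_hasSum (c z : ℂ) : HasSum (fun n => auxC c n * z ^ n) (Complex.cos (c * z)) := by
  have h1 := NormedSpace.expSeries_div_hasSum_exp (c * z * Complex.I)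
  have h2 := NormedSpace.expSeries_div_hasSum_exp (-(c * z) * Complex.I)
  rw [← Complex.exp_eq_exp_ℂ] at h1 h2
  have h := (h1.add h2).div_const 2
  rw [Complex.cos]
  convert! h using 1
  funext n
  rw [auxC, show c * z * Complex.I = c * Complex.I * z by ring,
    show -(c * z) * Complex.I = -(c * Complex.I) * z by ring, mul_pow, mul_pow]
  ring

lemma auxC_eight (c : ℂ) (k : ℕ) : auxC c (8 * k) = (c ^ 8) ^ k / ((8 * k).factorial : ℂ) := by
  have h : (c * Complex.I) ^ 8 = c ^ 8 := by
    rw [mul_pow, show Complex.I ^ 8 = (Complex.I ^ 4) ^ 2 by ring, Complex.I_pow_four]; simp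
  have h' : (-(c * Complex.I)) ^ 8 = c ^ 8 := by
    rw [← h]; ring
  rw [auxC, pow_mul, pow_mul, h, h']
  ring

lemma aux_p1 (J s : ℂ) (hJ : J ^ 2 = -1) (hs : s ^ 2 = 2) :
    (1 + J + s) ^ 8 = -64 * (3 + 2 * s) ^ 2 := by
  have h1 : (1 + J + s) ^ 2 = 2 * (1 + J) * (1 + s) := by linear_combination hJ + hs
  have h2 : (1 + J) ^ 2 = 2 * J := by linear_combination hJ
  have h3 : (1 + s) ^ 2 = 3 + 2 * s := by linear_combination hs
  calc (1 + J + s) ^ 8 = ((1 + J + s) ^ 2) ^ 4 := by ring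
    _ = 16 * ((1 + J) ^ 2) ^ 2 * ((1 + s) ^ 2) ^ 2 := by rw [h1]; ring
    _ = 64 * J ^ 2 * (3 + 2 * s) ^ 2 := by rw [h2, h3]; ring
    _ = _ := by rw [hJ]; ring

lemma aux_p2 (J s : ℂ) (hJ : J ^ 2 = -1) (hs : s ^ 2 = 2) :
    (1 + J + s * J) ^ 8 = -64 * (3 + 2 * s) ^ 2 := by
  have h1 : (1 + J + s * J) = J * (1 + -J + s) := by linear_combination hJ
  have h8 : J ^ 8 = 1 := by
    calc J ^ 8 = (J ^ 2) ^ 4 := by ring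
      _ = 1 := by rw [hJ]; norm_num
  rw [h1, mul_pow, h8, aux_p1 (-J) s (by rw [neg_sq, hJ]) hs, one_mul]

/-- terms -/
noncomputable def auxA (n : ℕ) : ℂ := 1 / (2 * (n : ℂ) + 1) ^ 8

lemma auxA_summable : Summable (fun n => ‖auxA n‖) := by
  have h : Summable (fun n : ℕ => 1 / ((n : ℝ)) ^ 8) :=
    Real.summable_one_div_nat_pow.2 (by norm_num)
  have h2 := h.comp_injective (i := fun n : ℕ => 2 * n + 1) (fun a b hab => by simpa using hab)
  refine h2.congr fun n => ?_
  have : (2 * (n : ℂ) + 1) = ((2 * n + 1 : ℕ) : ℂ) := by push_cast; ring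
  rw [auxA, this, norm_div, norm_pow, Complex.norm_natCast]
  simp

/-- elementary symmetric sums -/
noncomputable def auxE (k : ℕ) : ℂ := ∑' S : {S : Finset ℕ // S.card = k}, ∏ n ∈ S.1, auxA n

lemma aux_gen (x : ℂ) : ∃ p : ℂ, HasSum (fun k => auxE k * x ^ k) p ∧
    HasProd (fun n => 1 + auxA n * x) p := by
  have hs : Summable (fun n => ‖auxA n * x‖) := by
    simp_rw [norm_mul]; exact auxA_summable.mul_right _
  have h := (summable_finsetProd_of_summable_norm hs)
  obtain ⟨p, hp⟩ := h
  refine ⟨p, ?_, hasProd_one_add_of_hasSum_prod hp⟩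
  have hA : Summable (fun S : Finset ℕ => ∏ n ∈ S, auxA n) :=
    summable_finsetProd_of_summable_norm auxA_summable
  have h2 := (Equiv.sigmaFiberEquiv (Finset.card : Finset ℕ → ℕ)).hasSum_iff.2 hp
  refine h2.sigma fun k => ?_
  have h3 : HasSum (fun S : {S : Finset ℕ // S.card = k} => ∏ n ∈ S.1, auxA n) (auxE k) :=
    (hA.comp_injective (Subtype.val_injective)).hasSum
  convert! h3.mul_right (x ^ k) using 1
  funext S
  simp [Equiv.sigmaFiberEquiv, Finset.prod_mul_distrib, S.2]

/-- finsets to tuples -/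
noncomputable def auxMap (k : ℕ) (S : {S : Finset ℕ // S.card = k}) :
    {f : Fin k → ℕ // StrictAnti f ∧ ∀ i, Odd (f i)} :=
  ⟨fun i => 2 * (S.1.orderEmbOfFin S.2 (Fin.rev i)) + 1, by
    intro i j hij
    have : S.1.orderEmbOfFin S.2 (Fin.rev j) < S.1.orderEmbOfFin S.2 (Fin.rev i) := by
      simpa using hij
    dsimp only
    omega, fun i => ⟨_, rfl⟩⟩

lemma auxMap_bij (k : ℕ) : Function.Bijective (auxMap k) := by
  constructor
  · intro S T h
    have h1 : ∀ i, S.1.orderEmbOfFin S.2 i = T.1.orderEmbOfFin T.2 i := by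
      intro i
      have := congr_fun (congr_arg Subtype.val h) (Fin.rev i)
      simpa [auxMap] using this
    apply Subtype.ext
    rw [← Finset.coe_inj, ← Finset.range_orderEmbOfFin S.1 S.2,
      ← Finset.range_orderEmbOfFin T.1 T.2, funext h1]
  · rintro ⟨f, hf, ho⟩
    have ho' := ho
    choose g hg using ho'
    have hgm : StrictMono (fun i => g (Fin.rev i)) := by
      intro i j hij
      have := hf (Fin.rev_lt_rev.2 hij)
      rw [hg, hg (Fin.rev j)] at this
      dsimp only
      omega
    have hc : (Finset.univ.image (fun i => g (Fin.rev i))).card = k := by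
      rw [Finset.card_image_of_injective _ hgm.injective]; simp
    refine ⟨⟨_, hc⟩, ?_⟩
    have := Finset.orderEmbOfFin_unique hc (fun x => Finset.mem_image_of_mem _ (Finset.mem_univ x)) hgm
    apply Subtype.ext
    funext i
    simp only [auxMap]
    rw [← this, hg i]
    simp only [Fin.rev_rev]

lemma auxE_eq (k : ℕ) : ((multT (fun _ : Fin k => 8) : ℝ) : ℂ) = auxE k := by
  rw [multT, Complex.ofReal_tsum, auxE, ← (Equiv.ofBijective _ (auxMap_bij k)).tsum_eq]
  refine tsum_congr fun S => ?_
  have h1 : ∏ n ∈ S.1, auxA n = ∏ i : Fin k, auxA (S.1.orderEmbOfFin S.2 i) := by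
    conv_lhs => rw [← Finset.image_orderEmbOfFin_univ S.1 S.2]
    rw [Finset.prod_image (fun _ _ _ _ h => (S.1.orderEmbOfFin S.2).injective h)]
  rw [h1, ← Equiv.prod_comp Fin.revPerm]
  push_cast
  refine Finset.prod_congr rfl fun i _ => ?_
  simp [auxMap, auxA]

open Filter Topology in
lemma aux_F (s : ℂ) (hs : s ^ 2 = 2) (hsn : ‖s‖ ≤ 3 / 2) (z : ℂ) (hz : ‖z‖ < 1 / 4) :
    HasSum (fun k => auxE k * (-z ^ 8) ^ k)
      (Complex.cos (Real.pi * z / 2) * Complex.cos (Real.pi * (Complex.I * z) / 2) *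
       Complex.cos (Real.pi * (s * (1 + Complex.I) / 2 * z) / 2) *
       Complex.cos (Real.pi * (s * (1 - Complex.I) / 2 * z) / 2)) := by
  obtain ⟨p, hp, hP⟩ := aux_gen (-z ^ 8)
  have hI := Complex.I_sq
  have hb : ∀ w : ℂ, ‖w‖ ≤ 2 → ‖s * w / 2 * z‖ < 1 := by
    intro w hw
    rw [norm_mul, norm_div, norm_mul]
    have h2 : ‖(2 : ℂ)‖ = 2 := by simp
    rw [h2]
    have : ‖s‖ * ‖w‖ ≤ 3 / 2 * 2 := by gcongr
    nlinarith [norm_nonneg z, norm_nonneg s, norm_nonneg w]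
  have c1 := aux_cos z (by linarith)
  have c2 := aux_cos (Complex.I * z) (by simp; linarith)
  have c3 := aux_cos (s * (1 + Complex.I) / 2 * z)
    (hb _ ((norm_add_le _ _).trans (by simp; norm_num)))
  have c4 := aux_cos (s * (1 - Complex.I) / 2 * z)
    (hb _ ((norm_sub_le _ _).trans (by simp; norm_num)))
  have h := ((c1.mul c2).mul c3).mul c4
  have := tendsto_nhds_unique hP.tendsto_prod_nat (h.congr fun N => ?_)
  · rw [← this]; exact hp
  · rw [← Finset.prod_mul_distrib, ← Finset.prod_mul_distrib, ← Finset.prod_mul_distrib]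
    refine Finset.prod_congr rfl fun n _ => ?_
    rw [auxA]
    have e2 : (Complex.I * z) ^ 2 = - z ^ 2 := by rw [mul_pow, hI]; ring
    have e3 : (s * (1 + Complex.I) / 2 * z) ^ 2 = Complex.I * z ^ 2 := by
      linear_combination (1 + Complex.I) ^ 2 / 4 * z ^ 2 * hs + z ^ 2 / 2 * hI
    have e4 : (s * (1 - Complex.I) / 2 * z) ^ 2 = -Complex.I * z ^ 2 := by
      linear_combination (1 - Complex.I) ^ 2 / 4 * z ^ 2 * hs + z ^ 2 / 2 * hI
    rw [e2, e3, e4]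
    generalize (2 * (n : ℂ) + 1) = m
    have e5 : ∀ J : ℂ, J ^ 2 = -1 → ∀ y : ℂ, (1 - y) * (1 - -y) * (1 - J * y) * (1 - -J * y)
        = 1 - y ^ 4 := by
      intro J hJ y
      linear_combination (-(1 - y ^ 2) * y ^ 2) * hJ
    have := e5 _ hI (z ^ 2 / m ^ 2)
    calc _ = (1 - z ^ 2 / m ^ 2) * (1 - -(z ^ 2 / m ^ 2)) * (1 - Complex.I * (z ^ 2 / m ^ 2)) *
          (1 - -Complex.I * (z ^ 2 / m ^ 2)) := by ring
      _ = _ := by rw [this]; ring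

open Filter Topology in
lemma aux_main (s : ℂ) (hs : s ^ 2 = 2) (hsn : ‖s‖ ≤ 3 / 2) (k : ℕ) :
    auxE k * (-1) ^ k = (Real.pi / 2) ^ (8 * k) / ((8 * k).factorial : ℂ) *
      ((-64 * (3 + 2 * s) ^ 2) ^ k + (-64 * (3 - 2 * s) ^ 2) ^ k) / 2 := by
  set I := Complex.I with hIdef
  have hI : I ^ 2 = -1 := Complex.I_sq
  set q : ℂ := Real.pi / 2 with hq
  let f : ℂ → ℂ := fun z => (Complex.cos (Real.pi * z / 2) * Complex.cos (Real.pi * (I * z) / 2) *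
       Complex.cos (Real.pi * (s * (1 + I) / 2 * z) / 2) *
       Complex.cos (Real.pi * (s * (1 - I) / 2 * z) / 2))
  let a : ℕ → ℂ := fun n => if 8 ∣ n then auxE (n / 8) * (-1) ^ (n / 8) else 0
  let b : ℕ → ℂ := fun n => (auxC (q * (1 + I + s)) n + auxC (q * (1 + I + -s)) n +
    auxC (q * (1 + -I + s)) n + auxC (q * (1 + -I + -s)) n +
    auxC (q * (1 + I + s * I)) n + auxC (q * (1 + I + -s * I)) n +
    auxC (q * (1 + -I + -s * -I)) n + auxC (q * (1 + -I + s * -I)) n) / 8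
  have ha : ∀ᶠ z in 𝓝 (0:ℂ), HasSum (fun n => a n * z ^ n) (f z) := by
    filter_upwards [Metric.ball_mem_nhds (0:ℂ) (by norm_num : (0:ℝ) < 1 / 4)] with z hz
    have h := aux_F s hs hsn z (by simpa using hz)
    have inj : Function.Injective (fun k : ℕ => 8 * k) := fun x y h => by simpa using h
    rw [← inj.hasSum_iff]
    · convert! h using 1
      funext j
      simp only [Function.comp, a]
      rw [if_pos (dvd_mul_right _ _), Nat.mul_div_cancel_left _ (by norm_num), neg_pow (z ^ 8),
        pow_mul]
      ring
    · intro n hn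
      have : ¬ 8 ∣ n := fun ⟨j, hj⟩ => hn ⟨j, hj.symm⟩
      simp [a, this]
  have hb : ∀ᶠ z in 𝓝 (0:ℂ), HasSum (fun n => b n * z ^ n) (f z) := by
    refine Eventually.of_forall fun z => ?_
    have h := ((((((((auxC_hasSum (q * (1 + I + s)) z).add (auxC_hasSum (q * (1 + I + -s)) z)).add
      (auxC_hasSum (q * (1 + -I + s)) z)).add (auxC_hasSum (q * (1 + -I + -s)) z)).add
      (auxC_hasSum (q * (1 + I + s * I)) z)).add (auxC_hasSum (q * (1 + I + -s * I)) z)).add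
      (auxC_hasSum (q * (1 + -I + -s * -I)) z)).add
      (auxC_hasSum (q * (1 + -I + s * -I)) z)).div_const 8
    convert! h using 1
    · funext n; simp only [b]; ring
    · simp only [f]
      rw [aux_cos4]
      congr 1
      congr 1
      · congr 1
        · congr 1
          · congr 1
            · congr 1
              · congr 1
                · congr 1
                  · congr 1; rw [hq]; ring
                  · congr 1; rw [hq]; ring
                · congr 1; rw [hq]; ring
              · congr 1; rw [hq]; ring
            · congr 1; rw [hq]; ring
          · congr 1; rw [hq]; ring
        · congr 1; rw [hq]; ring
      · congr 1; rw [hq]; ring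
  have key := aux_unique ha hb (8 * k)
  have hI' : (-I) ^ 2 = -1 := by rw [neg_sq, hI]
  have hs' : (-s) ^ 2 = 2 := by rw [neg_sq, hs]
  simp only [a, b] at key
  rw [if_pos (dvd_mul_right _ _), Nat.mul_div_cancel_left _ (by norm_num)] at key
  rw [key]
  simp only [auxC_eight, mul_pow q]
  rw [aux_p1 I s hI hs, aux_p1 I (-s) hI hs', aux_p1 (-I) s hI' hs, aux_p1 (-I) (-s) hI' hs',
    aux_p2 I s hI hs, aux_p2 I (-s) hI hs', aux_p2 (-I) s hI' hs, aux_p2 (-I) (-s) hI' hs']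
  rw [show 3 + 2 * -s = 3 - 2 * s by ring, pow_mul q]
  simp only [mul_pow (q ^ 8)]
  ring

/-- `t({8}_k) = π^(8k)/(2^(2k+1)(8k)!) * ((3+2√2)^(2k) + (3−2√2)^(2k))`. -/
theorem multT_repeat_eight (k : ℕ) (hk : 1 ≤ k) :
    multT (fun _ : Fin k => 8) =
      Real.pi ^ (8 * k) / (2 ^ (2 * k + 1) * Nat.factorial (8 * k)) *
        ((3 + 2 * Real.sqrt 2) ^ (2 * k) + (3 - 2 * Real.sqrt 2) ^ (2 * k)) := by
  have hs : ((Real.sqrt 2 : ℝ) : ℂ) ^ 2 = 2 := by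
    rw [← Complex.ofReal_pow, Real.sq_sqrt (by norm_num)]; simp
  have hsn : ‖((Real.sqrt 2 : ℝ) : ℂ)‖ ≤ 3 / 2 := by
    rw [Complex.norm_real, Real.norm_of_nonneg (Real.sqrt_nonneg _)]
    rw [Real.sqrt_le_left (by norm_num)]; norm_num
  have h := aux_main _ hs hsn k
  rw [← auxE_eq] at h
  have h' : multT (fun _ : Fin k => 8) * (-1) ^ k =
      (Real.pi / 2) ^ (8 * k) / ((8 * k).factorial : ℝ) *
      ((-64 * (3 + 2 * Real.sqrt 2) ^ 2) ^ k + (-64 * (3 - 2 * Real.sqrt 2) ^ 2) ^ k) / 2 := by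
    exact_mod_cast h
  have h1 : ((-1 : ℝ) ^ k) * (-1) ^ k = 1 := by rw [← mul_pow]; norm_num
  have h64 : (-64 : ℝ) ^ k = (-1) ^ k * 64 ^ k := by rw [← mul_pow]; norm_num
  rw [mul_pow, mul_pow, h64, ← pow_mul, ← pow_mul] at h'
  have h2 : (2 : ℝ) ^ (8 * k) = 64 ^ k * 2 ^ (2 * k) := by
    rw [pow_mul, pow_mul, ← mul_pow]; norm_num
  rw [div_pow, h2] at h'
  calc multT (fun _ : Fin k => 8) = multT (fun _ : Fin k => 8) * (-1) ^ k * (-1) ^ k := by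
        rw [mul_assoc, h1, mul_one]
    _ = _ := by
        rw [h', pow_succ]
        have h64' : (64 : ℝ) ^ k ≠ 0 := by positivity
        have hf : ((8 * k).factorial : ℝ) ≠ 0 := by positivity
        field_simp
        rw [show ((-1 : ℝ) ^ k) ^ 2 = 1 by rw [sq, h1]]
        try ring
end

section
/- For every integer k ≥ 1, t({10}_k) = 5·π^{10k}·(L_{10k} + 1) / (16·(10k)!), where L_n is the n-th Lucas number. -/
/-- The Lucas numbers: `L_0 = 2`, `L_1 = 1`, `L_(n+2) = L_(n+1) + L_n`. -/
def lucas : ℕ → ℕ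
  | 0 => 2
  | 1 => 1
  | n + 2 => lucas (n + 1) + lucas n

open Filter Topology

namespace MT

lemma coeff_unique (a b : ℕ → ℂ) (F : ℂ → ℂ)
    (ha : ∀ z : ℂ, ‖z‖ < 1 → HasSum (fun n => z ^ n * a n) (F z))
    (hb : ∀ z : ℂ, ‖z‖ < 1 → HasSum (fun n => z ^ n * b n) (F z)) : a = b := by
  have key : ∀ c : ℕ → ℂ, (∀ z : ℂ, ‖z‖ < 1 → HasSum (fun n => z ^ n * c n) (F z)) →
      HasFPowerSeriesAt F (FormalMultilinearSeries.ofScalars ℂ c) 0 := by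
    intro c hc
    rw [hasFPowerSeriesAt_iff]
    filter_upwards [Metric.ball_mem_nhds (0 : ℂ) one_pos] with z hz
    have := hc z (by simpa using hz)
    simpa [FormalMultilinearSeries.coeff_ofScalars] using this
  have h := (key a ha).eq_formalMultilinearSeries (key b hb)
  funext n
  have := congrArg (fun p => FormalMultilinearSeries.coeff p n) h
  simpa [FormalMultilinearSeries.coeff_ofScalars] using this

lemma cos_prod (z : ℂ) (hz : ‖z‖ < 1) :
    Tendsto (fun n : ℕ => ∏ i ∈ Finset.range n, (1 - z ^ 2 / (2 * (i : ℂ) + 1) ^ 2)) atTop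
      (𝓝 (Complex.cos (Real.pi / 2 * z))) := by
  by_cases h0 : z = 0
  · subst h0
    simp
  have hpi : (Real.pi : ℂ) ≠ 0 := by exact_mod_cast Real.pi_ne_zero
  have hsin : Complex.sin (Real.pi * (z / 2)) ≠ 0 := by
    intro h
    rw [Complex.sin_eq_zero_iff] at h
    obtain ⟨k, hk⟩ := h
    have hzk : z = 2 * (k : ℂ) := by
      have : (Real.pi : ℂ) * (z / 2 - k) = 0 := by linear_combination hk
      rcases mul_eq_zero.1 this with h | h
      · exact absurd h hpi
      · linear_combination 2 * h
    have hk0 : k ≠ 0 := by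
      rintro rfl
      simp at hzk
      exact h0 hzk
    have h1 : (1 : ℝ) ≤ |(k : ℝ)| := by exact_mod_cast Int.one_le_abs hk0
    rw [hzk] at hz
    simp at hz
    linarith
  have A := (Complex.tendsto_euler_sin_prod z).comp
    (tendsto_id.const_mul_atTop' (show 0 < 2 by norm_num) : Tendsto (fun n : ℕ => 2 * n) atTop atTop)
  have B := Complex.tendsto_euler_sin_prod (z / 2)
  have split : ∀ n : ℕ, ∏ j ∈ Finset.range (2 * n), ((1 : ℂ) - z ^ 2 / ((j : ℂ) + 1) ^ 2) =
      (∏ i ∈ Finset.range n, (1 - z ^ 2 / (2 * (i : ℂ) + 1) ^ 2)) *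
      ∏ j ∈ Finset.range n, ((1 : ℂ) - (z / 2) ^ 2 / ((j : ℂ) + 1) ^ 2) := by
    intro n
    induction n with
    | zero => simp
    | succ n ih =>
      rw [show 2 * (n + 1) = 2 * n + 1 + 1 by ring, Finset.prod_range_succ, Finset.prod_range_succ,
        ih, Finset.prod_range_succ, Finset.prod_range_succ]
      have e : z ^ 2 / (((2 * n + 1 : ℕ) : ℂ) + 1) ^ 2 = (z / 2) ^ 2 / ((n : ℂ) + 1) ^ 2 := by
        have : (n : ℂ) + 1 ≠ 0 := by exact_mod_cast Nat.succ_ne_zero n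
        have h2 : (2 * (n : ℂ) + 1) + 1 ≠ 0 := by exact_mod_cast Nat.succ_ne_zero (2 * n + 1)
        push_cast
        rw [div_eq_div_iff (pow_ne_zero _ h2) (pow_ne_zero _ this)]
        ring
      rw [e]
      push_cast
      ring
  have C := A.div B hsin
  have hlim : Complex.sin (Real.pi * z) / Complex.sin (Real.pi * (z / 2)) =
      2 * Complex.cos (Real.pi / 2 * z) := by
    rw [div_eq_iff hsin, show (Real.pi : ℂ) * z = 2 * (Real.pi * (z / 2)) by ring,
      Complex.sin_two_mul, show (Real.pi : ℂ) / 2 * z = Real.pi * (z / 2) by ring]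
    ring
  rw [hlim] at C
  have C2 := C.div_const 2
  rw [mul_div_cancel_left₀ _ (two_ne_zero)] at C2
  refine C2.congr' ?_
  filter_upwards [B.eventually_ne hsin] with n hn
  simp only [Function.comp, Pi.div_apply, split]
  have hn2 := right_ne_zero_of_mul hn
  generalize ∏ j ∈ Finset.range n, ((1 : ℂ) - (z / 2) ^ 2 / ((j : ℂ) + 1) ^ 2) = P at *
  generalize ∏ i ∈ Finset.range n, (1 - z ^ 2 / (2 * (i : ℂ) + 1) ^ 2) = Q at *
  field_simp

lemma trig_id (x0 x1 x2 x3 x4 : ℂ) (h : x0 + x1 + x2 + x3 + x4 = 0) :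
    16 * (Complex.cos x0 * Complex.cos x1 * Complex.cos x2 * Complex.cos x3 * Complex.cos x4) =
    1 + (Complex.cos (2 * x0) + Complex.cos (2 * x1) + Complex.cos (2 * x2) + Complex.cos (2 * x3)
      + Complex.cos (2 * x4)) +
    (Complex.cos (2 * (x0 + x1)) + Complex.cos (2 * (x0 + x2)) + Complex.cos (2 * (x0 + x3))
    + Complex.cos (2 * (x0 + x4)) + Complex.cos (2 * (x1 + x2)) + Complex.cos (2 * (x1 + x3))
    + Complex.cos (2 * (x1 + x4)) + Complex.cos (2 * (x2 + x3)) + Complex.cos (2 * (x2 + x4))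
    + Complex.cos (2 * (x3 + x4))) := by
  have h4 : x4 = -(x0 + x1 + x2 + x3) := by linear_combination h
  subst h4
  simp only [Complex.cos, neg_mul, mul_add, two_mul, add_mul, mul_neg, neg_add, neg_neg,
    Complex.exp_add, Complex.exp_neg]
  have e0 := Complex.exp_ne_zero (x0 * Complex.I)
  have e1 := Complex.exp_ne_zero (x1 * Complex.I)
  have e2 := Complex.exp_ne_zero (x2 * Complex.I)
  have e3 := Complex.exp_ne_zero (x3 * Complex.I)
  generalize Complex.exp (x0 * Complex.I) = a at *
  generalize Complex.exp (x1 * Complex.I) = b at *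
  generalize Complex.exp (x2 * Complex.I) = c at *
  generalize Complex.exp (x3 * Complex.I) = d at *
  field_simp
  ring

lemma cos_series (a z : ℂ) : HasSum (fun n : ℕ => z ^ n *
    ((Complex.I ^ n + (-Complex.I) ^ n) / 2 / (n.factorial : ℂ) * a ^ n)) (Complex.cos (a * z)) := by
  have h1 := NormedSpace.expSeries_div_hasSum_exp (a * z * Complex.I)
  have h2 := NormedSpace.expSeries_div_hasSum_exp (-(a * z) * Complex.I)
  have h := (h1.add h2).div_const 2
  rw [← Complex.exp_eq_exp_ℂ] at h
  unfold Complex.cos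
  convert! h using 1
  funext n
  rw [show -(a * z) * Complex.I = a * z * (-Complex.I) by ring, mul_pow, mul_pow, mul_pow]
  ring

/-- symmetric sums -/
noncomputable def E (k : ℕ) : ℂ :=
  ∑' s : (Finset.card ⁻¹' {k} : Set (Finset ℕ)), ∏ i ∈ s.1, 1 / (2 * (i : ℂ) + 1) ^ 10

lemma summ : Summable (fun i : ℕ => ‖1 / (2 * (i : ℂ) + 1) ^ 10‖) := by
  have h : Summable (fun i : ℕ => 1 / ((i + 1 : ℕ) : ℝ) ^ 10) :=
    (summable_nat_add_iff 1).2 (Real.summable_one_div_nat_pow.2 (by norm_num))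
  refine Summable.of_nonneg_of_le (fun _ => norm_nonneg _) (fun i => ?_) h
  have : (2 * (i : ℂ) + 1) = ((2 * i + 1 : ℕ) : ℂ) := by push_cast; ring
  rw [this, norm_div, norm_pow, Complex.norm_natCast, norm_one]
  gcongr
  omega

lemma gen (z L : ℂ)
    (hL : Tendsto (fun n : ℕ => ∏ i ∈ Finset.range n, (1 - z ^ 10 / (2 * (i : ℂ) + 1) ^ 10)) atTop
      (𝓝 L)) : HasSum (fun k : ℕ => (-z ^ 10) ^ k * E k) L := by
  have hs : Summable (fun i : ℕ => ‖(-z ^ 10) * (1 / (2 * (i : ℂ) + 1) ^ 10)‖) := by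
    simp_rw [norm_mul (-z ^ 10)]
    exact summ.mul_left _
  have h1 := (summable_finsetProd_of_summable_norm hs).hasSum
  have h2 := (hasProd_one_add_of_hasSum_prod h1).tendsto_prod_nat
  have h3 : L = _ := tendsto_nhds_unique (hL.congr (fun n => by
    refine Finset.prod_congr rfl fun i _ => ?_
    ring)) h2
  rw [← h3] at h1
  have h4 := h1.tsum_fiberwise Finset.card
  convert! h4 using 1
  funext k
  rw [E, ← tsum_mul_left]
  refine tsum_congr fun s => ?_
  have hc : s.1.card = k := s.2
  rw [Finset.prod_mul_distrib, Finset.prod_const, hc]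

lemma multT_eq (k : ℕ) : ((multT (fun _ : Fin k => 10) : ℝ) : ℂ) = E k := by
  unfold multT E
  rw [Complex.ofReal_tsum]
  let φ : (Finset.card ⁻¹' {k} : Set (Finset ℕ)) →
      {f : Fin k → ℕ // StrictAnti f ∧ ∀ i, Odd (f i)} := fun s =>
    ⟨fun i => 2 * (s.1.orderEmbOfFin s.2 (Fin.rev i)) + 1, by
      constructor
      · intro i j hij
        have := (s.1.orderEmbOfFin s.2).strictMono (Fin.rev_lt_rev.2 hij)
        simp only
        omega
      · intro i
        exact ⟨_, rfl⟩⟩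
  have hφ : Function.Bijective φ := by
    constructor
    · intro s t hst
      have h1 : ∀ i, s.1.orderEmbOfFin s.2 i = t.1.orderEmbOfFin t.2 i := by
        intro i
        have := congrFun (congrArg Subtype.val hst) (Fin.rev i)
        simp only [φ, Fin.rev_rev] at this
        omega
      apply Subtype.ext
      apply Finset.coe_injective
      rw [← Finset.range_orderEmbOfFin s.1 s.2, ← Finset.range_orderEmbOfFin t.1 t.2]
      congr 1
      funext i
      exact h1 i
    · rintro ⟨f, hf, ho⟩
      have hm : StrictMono (fun i => f (Fin.rev i) / 2) := by
        intro i j hij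
        have h1 := hf (Fin.rev_lt_rev.2 hij)
        obtain ⟨a, ha⟩ := ho (Fin.rev i)
        obtain ⟨b, hb⟩ := ho (Fin.rev j)
        simp only
        omega
      have hc : (Finset.univ.image (fun i => f (Fin.rev i) / 2)).card = k := by
        rw [Finset.card_image_of_injective _ hm.injective]
        simp
      refine ⟨⟨_, hc⟩, ?_⟩
      apply Subtype.ext
      funext i
      have := Finset.orderEmbOfFin_unique hc (f := fun i => f (Fin.rev i) / 2)
        (fun x => Finset.mem_image_of_mem _ (Finset.mem_univ x)) hm
      simp only [φ]
      rw [← this]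
      simp only [Fin.rev_rev]
      obtain ⟨a, ha⟩ := ho i
      omega
  rw [← (Equiv.ofBijective φ hφ).tsum_eq]
  refine tsum_congr fun s => ?_
  simp only [Equiv.ofBijective_apply, φ]
  push_cast
  have e : ∏ i ∈ s.1, 1 / (2 * (i : ℂ) + 1) ^ 10 =
      ∏ i : Fin k, 1 / (2 * ((s.1.orderEmbOfFin s.2 i : ℕ) : ℂ) + 1) ^ 10 := by
    conv_lhs => rw [← Finset.map_orderEmbOfFin_univ s.1 s.2]
    rw [Finset.prod_map]
    rfl
  rw [e]
  exact Equiv.prod_comp Fin.revPerm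
    (fun i : Fin k => 1 / (2 * ((s.1.orderEmbOfFin s.2 i : ℕ) : ℂ) + 1) ^ 10)

lemma lucas_pow (g h : ℂ) (h1 : g + h = -1) (h2 : g * h = -1) (n : ℕ) :
    (-g) ^ n + (-h) ^ n = (lucas n : ℂ) := by
  have hg : g ^ 2 = 1 - g := by linear_combination g * h1 - h2
  have hh : h ^ 2 = 1 - h := by linear_combination h * h1 - h2
  induction n using Nat.twoStepInduction with
  | zero => norm_num [lucas]
  | one => simp [lucas]; linear_combination -h1
  | more n i1 i2 =>
    rw [lucas]
    push_cast
    rw [← i1, ← i2]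
    linear_combination (-g) ^ n * hg + (-h) ^ n * hh

lemma main_id (w u : ℂ) (hw : 1 + w + w ^ 2 + w ^ 3 + w ^ 4 = 0) :
    Complex.cos u * Complex.cos (u * w) * Complex.cos (u * w ^ 2) * Complex.cos (u * w ^ 3) *
      Complex.cos (u * w ^ 4) = 1 / 16 * (Complex.cos (0 * u) +
      ∑ j ∈ Finset.range 5, (Complex.cos (2 * w ^ j * u) +
        Complex.cos (2 * (w + w ^ 4) * w ^ j * u) + Complex.cos (2 * (w ^ 2 + w ^ 3) * w ^ j * u))) := by
  have h5 : w ^ 5 = 1 := by linear_combination (w - 1) * hw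
  have := trig_id u (u * w) (u * w ^ 2) (u * w ^ 3) (u * w ^ 4) (by linear_combination u * hw)
  simp only [Finset.sum_range_succ, Finset.sum_range_zero]
  have a01 : 2 * (u + u * w) = 2 * (w ^ 2 + w ^ 3) * w ^ 3 * u := by
    linear_combination (-2 * u - 2 * u * w) * h5
  have a12 : 2 * (u * w + u * w ^ 2) = 2 * (w ^ 2 + w ^ 3) * w ^ 4 * u := by
    linear_combination (-2 * u * w - 2 * u * w ^ 2) * h5
  have a23 : 2 * (u * w ^ 2 + u * w ^ 3) = 2 * (w ^ 2 + w ^ 3) * w ^ 0 * u := by ring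
  have a34 : 2 * (u * w ^ 3 + u * w ^ 4) = 2 * (w ^ 2 + w ^ 3) * w ^ 1 * u := by ring
  have a04 : 2 * (u + u * w ^ 4) = 2 * (w ^ 2 + w ^ 3) * w ^ 2 * u := by
    linear_combination (-2 * u) * h5
  have a14 : 2 * (u * w + u * w ^ 4) = 2 * (w + w ^ 4) * w ^ 0 * u := by ring
  have a02 : 2 * (u + u * w ^ 2) = 2 * (w + w ^ 4) * w ^ 1 * u := by
    linear_combination (-2 * u) * h5
  have a13 : 2 * (u * w + u * w ^ 3) = 2 * (w + w ^ 4) * w ^ 2 * u := by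
    linear_combination (-2 * u * w) * h5
  have a24 : 2 * (u * w ^ 2 + u * w ^ 4) = 2 * (w + w ^ 4) * w ^ 3 * u := by
    linear_combination (-2 * u * w ^ 2) * h5
  have a03 : 2 * (u + u * w ^ 3) = 2 * (w + w ^ 4) * w ^ 4 * u := by
    linear_combination (-2 * u - 2 * u * w ^ 3) * h5
  rw [a01, a12, a23, a34, a04, a14, a02, a13, a24, a03] at this
  have b0 : 2 * u = 2 * w ^ 0 * u := by ring
  have b1 : 2 * (u * w) = 2 * w ^ 1 * u := by ring
  have b2 : 2 * (u * w ^ 2) = 2 * w ^ 2 * u := by ring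
  have b3 : 2 * (u * w ^ 3) = 2 * w ^ 3 * u := by ring
  have b4 : 2 * (u * w ^ 4) = 2 * w ^ 4 * u := by ring
  rw [b0, b1, b2, b3, b4] at this
  rw [zero_mul, Complex.cos_zero]
  linear_combination 1 / 16 * this

lemma fact10 (w y : ℂ) (hw : 1 + w + w ^ 2 + w ^ 3 + w ^ 4 = 0) :
    (1 - y) * (1 - w ^ 2 * y) * (1 - w ^ 4 * y) * (1 - w ^ 6 * y) * (1 - w ^ 8 * y) = 1 - y ^ 5 := by
  have h5 : w ^ 5 = 1 := by linear_combination (w - 1) * hw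
  have h6 : w ^ 6 = w := by linear_combination w * h5
  have h8 : w ^ 8 = w ^ 3 := by linear_combination w ^ 3 * h5
  rw [h6, h8]
  have h4 : w ^ 4 = -(1 + w + w ^ 2 + w ^ 3) := by linear_combination hw
  grind

theorem final (k : ℕ) (hk : 1 ≤ k) : E k =
      5 * (Real.pi : ℂ) ^ (10 * k) * (lucas (10 * k) + 1) / (16 * Nat.factorial (10 * k)) := by
  obtain ⟨w, hw⟩ : ∃ w : ℂ, 1 + w + w ^ 2 + w ^ 3 + w ^ 4 = 0 ∧ ‖w‖ = 1 := by
    have hp := Complex.isPrimitiveRoot_exp 5 (by norm_num)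
    refine ⟨_, ?_, hp.norm'_eq_one (by norm_num)⟩
    have := hp.geom_sum_eq_zero (by norm_num)
    simpa [Finset.sum_range_succ] using this
  obtain ⟨hw, hnw⟩ := hw
  have h5 : w ^ 5 = 1 := by linear_combination (w - 1) * hw
  have hwk : ∀ j : ℕ, (w ^ j) ^ (10 * k) = 1 := by
    intro j
    rw [← pow_mul, show j * (10 * k) = 5 * (2 * j * k) by ring, pow_mul, h5, one_pow]
  set F : ℂ → ℂ := fun z => 1 / 16 * (Complex.cos (0 * (Real.pi / 2 * z)) +
      ∑ j ∈ Finset.range 5, (Complex.cos (2 * w ^ j * (Real.pi / 2 * z)) +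
        Complex.cos (2 * (w + w ^ 4) * w ^ j * (Real.pi / 2 * z)) +
        Complex.cos (2 * (w ^ 2 + w ^ 3) * w ^ j * (Real.pi / 2 * z)))) with hF
  set a : ℕ → ℂ := Function.extend (fun k : ℕ => 10 * k) (fun k => (-1) ^ k * E k) 0 with ha
  have hinj : Function.Injective (fun k : ℕ => 10 * k) := fun x y h => by simpa using h
  have HA : ∀ z : ℂ, ‖z‖ < 1 → HasSum (fun n => z ^ n * a n) (F z) := by
    intro z hz
    have hn : ∀ j : ℕ, ‖z * w ^ j‖ < 1 := by
      intro j
      rw [norm_mul, norm_pow, hnw]; simpa using hz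
    have hT := ((((cos_prod _ (hn 0)).mul (cos_prod _ (hn 1))).mul (cos_prod _ (hn 2))).mul
      (cos_prod _ (hn 3))).mul (cos_prod _ (hn 4))
    have hlim : F z = Complex.cos (Real.pi / 2 * (z * w ^ 0)) *
        Complex.cos (Real.pi / 2 * (z * w ^ 1)) * Complex.cos (Real.pi / 2 * (z * w ^ 2)) *
        Complex.cos (Real.pi / 2 * (z * w ^ 3)) * Complex.cos (Real.pi / 2 * (z * w ^ 4)) := by
      rw [hF]
      simp only
      rw [← main_id w _ hw]
      simp only [mul_assoc, pow_zero, pow_one, mul_one]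
    rw [← hlim] at hT
    have hS := gen z (F z) (hT.congr fun n => by
      simp only [← Finset.prod_mul_distrib]
      refine Finset.prod_congr rfl fun i _ => ?_
      have := fact10 w (z ^ 2 / (2 * (i : ℂ) + 1) ^ 2) hw
      rw [show z ^ 10 / (2 * (i : ℂ) + 1) ^ 10 = (z ^ 2 / (2 * (i : ℂ) + 1) ^ 2) ^ 5 by
        rw [div_pow, ← pow_mul, ← pow_mul], ← this]
      ring)
    rw [← hinj.hasSum_iff]
    · convert! hS using 1
      funext m
      simp only [Function.comp, ha, hinj.extend_apply]
      rw [neg_pow (z ^ 10), ← pow_mul]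
      ring
    · intro n hn
      rw [ha, Function.extend_apply' _ _ _ hn]
      simp
  have HB : ∀ z : ℂ, ‖z‖ < 1 → HasSum (fun n => z ^ n * (1 / 16 *
      ((Complex.I ^ n + (-Complex.I) ^ n) / 2 / (n.factorial : ℂ) * ((0 * (Real.pi / 2)) ^ n +
      ∑ j ∈ Finset.range 5, ((2 * w ^ j * (Real.pi / 2)) ^ n +
        (2 * (w + w ^ 4) * w ^ j * (Real.pi / 2)) ^ n +
        (2 * (w ^ 2 + w ^ 3) * w ^ j * (Real.pi / 2)) ^ n))))) (F z) := by
    intro z _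
    have h := ((cos_series (0 * (Real.pi / 2)) z).add (hasSum_sum (s := Finset.range 5)
      (fun j _ => ((cos_series (2 * w ^ j * (Real.pi / 2)) z).add
        (cos_series (2 * (w + w ^ 4) * w ^ j * (Real.pi / 2)) z)).add
        (cos_series (2 * (w ^ 2 + w ^ 3) * w ^ j * (Real.pi / 2)) z)))).mul_left (1 / 16)
    convert! h using 1
    · funext n
      simp only [Finset.sum_range_succ, Finset.sum_range_zero]
      ring
    · rw [hF]
      simp only [mul_assoc]
  have key := congrFun (coeff_unique _ _ F HA HB) (10 * k)
  simp only [ha, hinj.extend_apply] at key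
  have hI : Complex.I ^ (10 * k) = (-1) ^ k := by
    rw [pow_mul, show (10 : ℕ) = 2 * 5 by norm_num, pow_mul, Complex.I_sq]
    norm_num
  have hI2 : (-Complex.I) ^ (10 * k) = (-1) ^ k := by
    rw [Even.neg_pow ⟨5 * k, by ring⟩, hI]
  have hL := lucas_pow (w + w ^ 4) (w ^ 2 + w ^ 3) (by linear_combination hw)
    (by linear_combination hw + (w + w ^ 2) * h5) (10 * k)
  rw [Even.neg_pow ⟨5 * k, by ring⟩, Even.neg_pow ⟨5 * k, by ring⟩] at hL
  rw [hI, hI2] at key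
  simp only [mul_pow, hwk, Finset.sum_const, Finset.card_range, div_pow] at key
  rw [zero_pow (by omega), ← hL] at *
  have hm : ((-1 : ℂ) ^ k) ≠ 0 := pow_ne_zero _ (by norm_num)
  have h2 : ((2 : ℂ) ^ (10 * k)) ≠ 0 := pow_ne_zero _ (by norm_num)
  have hf : ((10 * k).factorial : ℂ) ≠ 0 := by exact_mod_cast Nat.factorial_ne_zero _
  apply mul_left_cancel₀ hm
  rw [key]
  simp only [nsmul_eq_mul]
  field_simp
  push_cast
  ring

end MT

/-- `t({10}_k) = 5π^(10k)(L_(10k) + 1)/(16(10k)!)`. -/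
theorem multT_repeat_ten (k : ℕ) (hk : 1 ≤ k) :
    multT (fun _ : Fin k => 10) =
      5 * Real.pi ^ (10 * k) * (lucas (10 * k) + 1) /
        (16 * Nat.factorial (10 * k)) := by
  have h := (MT.multT_eq k).trans (MT.final k hk)
  exact_mod_cast h
end

section
/- For every integer k ≥ 1, t({12}_k) = 3·π^{12k} / (16·(12k)!) · [ (2 + √3)^{6k} + (2 − √3)^{6k} + 2^{6k} + 2·(−1)^k ]. -/
open Finset in
noncomputable def tw_equiv (k : ℕ) : {s : Finset ℕ // s.card = k} ≃
    {f : Fin k → ℕ // StrictAnti f ∧ ∀ i, Odd (f i)} :=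
  Equiv.ofBijective
    (fun s => ⟨fun i => 2 * (s.1.orderEmbOfFin s.2 i.rev) + 1, by
      constructor
      · intro i j hij
        have : s.1.orderEmbOfFin s.2 j.rev < s.1.orderEmbOfFin s.2 i.rev :=
          (s.1.orderEmbOfFin s.2).strictMono (Fin.rev_lt_rev.mpr hij)
        show 2 * _ + 1 < 2 * _ + 1
        omega
      · intro i
        exact ⟨_, rfl⟩⟩)
    (by
      constructor
      · intro s t h
        have h1 : ∀ i, s.1.orderEmbOfFin s.2 i = t.1.orderEmbOfFin t.2 i := by
          intro i
          have := congrFun (congrArg Subtype.val h) i.rev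
          simp only [Fin.rev_rev] at this
          omega
        apply Subtype.ext
        rw [← Finset.map_orderEmbOfFin_univ s.1 s.2, ← Finset.map_orderEmbOfFin_univ t.1 t.2]
        congr 1
        ext i
        exact h1 i
      · rintro ⟨f, hf, ho⟩
        have hm : StrictMono (fun i : Fin k => f i.rev / 2) := by
          intro i j hij
          have h1 := hf (Fin.rev_lt_rev.mpr hij)
          obtain ⟨a, ha⟩ := ho i.rev
          obtain ⟨b, hb⟩ := ho j.rev
          show f i.rev / 2 < f j.rev / 2
          omega
        have hc : (Finset.univ.image (fun i : Fin k => f i.rev / 2)).card = k := by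
          rw [Finset.card_image_of_injective _ hm.injective]; simp
        refine ⟨⟨_, hc⟩, ?_⟩
        apply Subtype.ext
        funext i
        have := Finset.orderEmbOfFin_unique hc (f := fun i : Fin k => f i.rev / 2)
          (fun x => Finset.mem_image_of_mem _ (Finset.mem_univ _)) hm
        have h2 := congrFun this i.rev
        simp only [Fin.rev_rev] at h2
        show 2 * _ + 1 = f i
        rw [← h2]
        obtain ⟨a, ha⟩ := ho i
        omega)

lemma tw_multT (k : ℕ) : (multT (fun _ : Fin k => 12) : ℂ) =
    ∑' s : {s : Finset ℕ // s.card = k}, ∏ n ∈ s.1, 1 / (2 * (n : ℂ) + 1) ^ 12 := by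
  unfold multT
  rw [← (tw_equiv k).tsum_eq, Complex.ofReal_tsum]
  apply tsum_congr
  intro s
  conv_rhs => rw [← Finset.map_orderEmbOfFin_univ s.1 s.2, Finset.prod_map]
  rw [← Equiv.prod_comp Fin.revPerm]
  have h : ∀ i : Fin k, (tw_equiv k s).1 (Fin.revPerm i) = 2 * (s.1.orderEmbOfFin s.2 i) + 1 := by
    intro i
    show 2 * (s.1.orderEmbOfFin s.2 (Fin.rev (Fin.rev i))) + 1 = _
    rw [Fin.rev_rev]
  simp_rw [h]
  push_cast
  rfl

lemma tw_summ (m : ℕ) (hm : 2 ≤ m) (y : ℂ) :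
    Summable (fun n : ℕ => ‖y * (1 / (2 * (n : ℂ) + 1) ^ m)‖) := by
  simp_rw [norm_mul]
  apply Summable.mul_left
  have h := (summable_nat_add_iff 1).mpr (Real.summable_one_div_nat_pow.mpr (show 1 < m by omega))
  refine Summable.of_nonneg_of_le (fun n => norm_nonneg _) (fun n => ?_) h
  have e : (2 * (n : ℂ) + 1) = ((2 * n + 1 : ℕ) : ℂ) := by push_cast; ring
  rw [e, norm_div, norm_pow, Complex.norm_natCast, norm_one]
  gcongr
  omega

lemma tw_gen (y : ℂ) : HasSum (fun k : ℕ => y ^ k * (multT (fun _ : Fin k => 12) : ℂ))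
    (∏' n : ℕ, (1 + y * (1 / (2 * (n : ℂ) + 1) ^ 12))) := by
  have hs := summable_finsetProd_of_summable_norm (tw_summ 12 (by norm_num) y)
  rw [tprod_one_add hs]
  have h1 := (Equiv.hasSum_iff (Equiv.sigmaFiberEquiv (Finset.card (α := ℕ)))).mpr hs.hasSum
  refine h1.sigma (fun k => ?_)
  have h2 := h1.summable.sigma_factor k
  suffices h : y ^ k * (multT (fun _ : Fin k => 12) : ℂ) = ∑' c, _ from h ▸ h2.hasSum
  rw [tw_multT, ← tsum_mul_left]
  apply tsum_congr
  intro s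
  simp only [Function.comp, Equiv.sigmaFiberEquiv, Equiv.coe_fn_mk]
  rw [Finset.prod_mul_distrib, Finset.prod_const, s.2]

open Filter Topology in
lemma tw_cos (z : ℂ) (hz : ‖z‖ < 2) :
    HasProd (fun n : ℕ => 1 - z ^ 2 * (1 / (2 * (n : ℂ) + 1) ^ 2)) (Complex.cos (Real.pi * z / 2)) := by
  have hmul : Multipliable (fun n : ℕ => 1 - z ^ 2 * (1 / (2 * (n : ℂ) + 1) ^ 2)) := by
    have := multipliable_one_add_of_summable (tw_summ 2 le_rfl (-z ^ 2))
    refine this.congr (fun n => ?_)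
    ring
  by_cases h0 : z = 0
  · subst h0
    simp
  have hpi : (Real.pi : ℂ) ≠ 0 := by exact_mod_cast Real.pi_ne_zero
  have hsin : Complex.sin (Real.pi * z / 2) ≠ 0 := by
    intro h
    obtain ⟨k, hk⟩ := Complex.sin_eq_zero_iff.mp h
    have hz2 : z = 2 * (k : ℂ) := by
      apply mul_left_cancel₀ hpi
      linear_combination 2 * hk
    rw [hz2, norm_mul, Complex.norm_intCast] at hz
    simp only [Complex.norm_ofNat] at hz
    have : |(k : ℝ)| < 1 := by linarith
    have : |k| < 1 := by exact_mod_cast this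
    have : k = 0 := Int.abs_lt_one_iff.mp this
    apply h0; rw [hz2, this]; simp
  have hsplit : ∀ n : ℕ, ∏ j ∈ Finset.range (2 * n), ((1 : ℂ) - z ^ 2 / ((j : ℂ) + 1) ^ 2) =
      (∏ j ∈ Finset.range n, ((1 : ℂ) - (z / 2) ^ 2 / ((j : ℂ) + 1) ^ 2)) *
      ∏ j ∈ Finset.range n, (1 - z ^ 2 * (1 / (2 * (j : ℂ) + 1) ^ 2)) := by
    intro n
    induction n with
    | zero => simp
    | succ n ih =>
      rw [show 2 * (n + 1) = 2 * n + 1 + 1 by ring, Finset.prod_range_succ, Finset.prod_range_succ, ih,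
        Finset.prod_range_succ, Finset.prod_range_succ]
      have h1 : (1 : ℂ) - z ^ 2 / (((2 * n + 1 : ℕ) : ℂ) + 1) ^ 2 =
          1 - (z / 2) ^ 2 / ((n : ℂ) + 1) ^ 2 := by
        have : (n : ℂ) + 1 ≠ 0 := by exact_mod_cast Nat.succ_ne_zero n
        have e : ((2 * n + 1 : ℕ) : ℂ) + 1 = 2 * ((n : ℂ) + 1) := by push_cast; ring
        rw [e]
        field_simp
      rw [h1]
      push_cast
      ring
  have A := (Complex.tendsto_euler_sin_prod z).comp
    (tendsto_id.const_mul_atTop' (zero_lt_two : (0 : ℕ) < 2))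
  have B := ((Complex.tendsto_euler_sin_prod (z / 2)).const_mul 2).mul hmul.hasProd.tendsto_prod_nat
  have C : Complex.sin (Real.pi * z) = 2 * Complex.sin (Real.pi * (z / 2)) *
      ∏' n : ℕ, (1 - z ^ 2 * (1 / (2 * (n : ℂ) + 1) ^ 2)) := by
    refine tendsto_nhds_unique A (B.congr (fun n => ?_))
    simp only [Function.comp, id]
    rw [hsplit]
    ring
  have D : Complex.sin (Real.pi * z) =
      2 * Complex.sin (Real.pi * z / 2) * Complex.cos (Real.pi * z / 2) := by
    rw [← Complex.sin_two_mul]; congr 1; ring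
  rw [D, ← mul_div_assoc] at C
  have := mul_left_cancel₀ (mul_ne_zero two_ne_zero hsin) C
  rw [this]
  exact hmul.hasProd

lemma tw_three (A B C : ℂ) (h : B = A + C) : 4 * (Complex.cos A * Complex.cos B * Complex.cos C) =
    1 + Complex.cos (2 * A) + Complex.cos (2 * B) + Complex.cos (2 * C) := by
  subst h
  have h1 := Complex.sin_sq_add_cos_sq A
  have h2 := Complex.sin_sq_add_cos_sq C
  rw [Complex.cos_two_mul, Complex.cos_two_mul, Complex.cos_two_mul, Complex.cos_add]
  have hA : Complex.sin A ^ 2 = 1 - Complex.cos A ^ 2 := by linear_combination h1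
  have hC : Complex.sin C ^ 2 = 1 - Complex.cos C ^ 2 := by linear_combination h2
  linear_combination (-2 * Complex.sin C ^ 2) * hA - 2 * (1 - Complex.cos A ^ 2) * hC

noncomputable def twG (w b : ℂ) : ℂ := ∑ j ∈ Finset.range 6, Complex.cos (w ^ j * b)

lemma tw_G (w b : ℂ) (hw : w ^ 4 = w ^ 2 - 1) :
    HasSum (fun k : ℕ => 6 * (b ^ (12 * k) / ((12 * k).factorial : ℂ))) (twG w b) := by
  have h6 : w ^ 6 = -1 := by linear_combination (w ^ 2 + 1) * hw
  have h12 : w ^ 12 = 1 := by linear_combination (w ^ 6 - 1) * h6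
  have H : HasSum (fun n : ℕ => ∑ j ∈ Finset.range 6,
      (-1) ^ n * (w ^ j * b) ^ (2 * n) / ((2 * n).factorial : ℂ)) (twG w b) :=
    hasSum_sum (fun j _ => Complex.hasSum_cos _)
  have hinj : Function.Injective (fun k : ℕ => 6 * k) := fun a b h => by
    simp only at h; omega
  rw [← hinj.hasSum_iff] at H
  · convert H using 1
    funext k
    simp only [Function.comp]
    have e : ∀ j ∈ Finset.range 6, (-1 : ℂ) ^ (6 * k) * (w ^ j * b) ^ (2 * (6 * k)) /
        ((2 * (6 * k)).factorial : ℂ) = b ^ (12 * k) / ((12 * k).factorial : ℂ) := by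
      intro j _
      have : 2 * (6 * k) = 12 * k := by ring
      rw [this, mul_pow, ← pow_mul, show j * (12 * k) = 12 * (j * k) by ring, pow_mul w, h12,
        pow_mul (-1 : ℂ)]
      norm_num
    rw [Finset.sum_congr rfl e]
    simp
  · intro n hn
    have e : ∀ j, (-1 : ℂ) ^ n * (w ^ j * b) ^ (2 * n) / ((2 * n).factorial : ℂ)
        = (-1 : ℂ) ^ n * b ^ (2 * n) / ((2 * n).factorial : ℂ) * ((w ^ (2 * n)) ^ j) := by
      intro j
      rw [mul_pow, ← pow_mul, ← pow_mul, mul_comm j]; ring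
    simp_rw [e]
    rw [← Finset.mul_sum]
    apply mul_eq_zero_of_right
    have hd : n % 6 ≠ 0 := by
      intro h; exact hn ⟨n / 6, by simp only; omega⟩
    have e2 : w ^ (2 * n) = w ^ (2 * (n % 6)) := by
      conv_lhs => rw [← Nat.div_add_mod n 6]
      rw [show 2 * (6 * (n / 6) + n % 6) = 12 * (n / 6) + 2 * (n % 6) by ring, pow_add, pow_mul w,
        h12]
      simp
    rw [e2]
    have : n % 6 < 6 := Nat.mod_lt _ (by norm_num)
    have h8 : w ^ 8 = -w ^ 2 := by linear_combination w ^ 2 * h6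
    have h10 : w ^ 10 = 1 - w ^ 2 := by linear_combination w ^ 4 * h6 - hw
    generalize n % 6 = m at *
    generalize hu : w ^ 2 = u at *
    have hu2 : u ^ 2 = u - 1 := by rw [← hw, ← hu]; ring
    have hu3 : u ^ 3 = -1 := by linear_combination (u + 1) * hu2
    simp only [pow_mul w, hu, Finset.sum_range_succ, Finset.sum_range_zero]
    interval_cases m
    · omega
    · linear_combination (1 + u + u ^ 2) * hu3
    · linear_combination (1 + u ^ 6) * (u ^ 2 + u + 1) * hu2
    · linear_combination (1 + u ^ 6 + u ^ 12) * hu3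
    · linear_combination (1 + u ^ 12) * (u ^ 4 - u ^ 2 + 1) * (u ^ 2 + u + 1) * hu2
    · linear_combination (u ^ 12 - u ^ 9 + u ^ 6 - u ^ 3 + 1) * (1 + u ^ 5 + u ^ 10) * hu3

lemma tw_prod (w a : ℂ) (hw : w ^ 4 = w ^ 2 - 1) :
    Complex.cos a * Complex.cos (w * a) * Complex.cos (w ^ 2 * a) * Complex.cos (w ^ 3 * a) *
      Complex.cos (w ^ 4 * a) * Complex.cos (w ^ 5 * a) =
    1 / 16 * (1 + twG w (2 * a) + 1 / 2 * (twG w ((1 + w) * (2 * a)) + twG w ((1 + w ^ 3) * (2 * a))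
      + twG w ((1 + w ^ 5) * (2 * a)))) := by
  have h6 : w ^ 6 = -1 := by linear_combination (w ^ 2 + 1) * hw
  have hE := tw_three a (w ^ 2 * a) (w ^ 4 * a) (by rw [hw]; ring)
  have hO := tw_three (w * a) (w ^ 3 * a) (w ^ 5 * a) (by linear_combination (-w * a) * hw)
  have cc : ∀ x y : ℂ, Complex.cos x * Complex.cos y =
      1 / 2 * (Complex.cos (x + y) + Complex.cos (x - y)) := by
    intro x y; rw [Complex.cos_add, Complex.cos_sub]; ring
  have key : Complex.cos a * Complex.cos (w * a) * Complex.cos (w ^ 2 * a) * Complex.cos (w ^ 3 * a) *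
      Complex.cos (w ^ 4 * a) * Complex.cos (w ^ 5 * a) = 1 / 16 *
      ((1 + Complex.cos (2 * a) + Complex.cos (2 * (w ^ 2 * a)) + Complex.cos (2 * (w ^ 4 * a))) *
      (1 + Complex.cos (2 * (w * a)) + Complex.cos (2 * (w ^ 3 * a)) +
        Complex.cos (2 * (w ^ 5 * a)))) := by
    rw [← hE, ← hO]; ring
  rw [key]
  unfold twG
  simp only [Finset.sum_range_succ, Finset.sum_range_zero]
  have ee : ∀ x y : ℂ, x = y → Complex.cos x = Complex.cos y := fun x y h => by rw [h]
  have en : ∀ x y : ℂ, x = -y → Complex.cos x = Complex.cos y := fun x y h => by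
    rw [h, Complex.cos_neg]
  have p01 := cc (2 * a) (2 * (w * a))
  have p03 := cc (2 * a) (2 * (w ^ 3 * a))
  have p05 := cc (2 * a) (2 * (w ^ 5 * a))
  have p21 := cc (2 * (w ^ 2 * a)) (2 * (w * a))
  have p23 := cc (2 * (w ^ 2 * a)) (2 * (w ^ 3 * a))
  have p25 := cc (2 * (w ^ 2 * a)) (2 * (w ^ 5 * a))
  have p41 := cc (2 * (w ^ 4 * a)) (2 * (w * a))
  have p43 := cc (2 * (w ^ 4 * a)) (2 * (w ^ 3 * a))
  have p45 := cc (2 * (w ^ 4 * a)) (2 * (w ^ 5 * a))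
  rw [ee (w ^ 0 * ((1 + w) * (2 * a))) (2 * a + 2 * (w * a)) (by ring),
    ee (w ^ 1 * ((1 + w) * (2 * a))) (2 * (w ^ 2 * a) + 2 * (w * a)) (by ring),
    ee (w ^ 2 * ((1 + w) * (2 * a))) (2 * (w ^ 2 * a) + 2 * (w ^ 3 * a)) (by ring),
    ee (w ^ 3 * ((1 + w) * (2 * a))) (2 * (w ^ 4 * a) + 2 * (w ^ 3 * a)) (by ring),
    ee (w ^ 4 * ((1 + w) * (2 * a))) (2 * (w ^ 4 * a) + 2 * (w ^ 5 * a)) (by ring),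
    en (w ^ 5 * ((1 + w) * (2 * a))) (2 * a - 2 * (w ^ 5 * a)) (by linear_combination (2 * a * w ^ 0) * h6),
    ee (w ^ 0 * ((1 + w ^ 3) * (2 * a))) (2 * a + 2 * (w ^ 3 * a)) (by ring),
    ee (w ^ 1 * ((1 + w ^ 3) * (2 * a))) (2 * (w ^ 4 * a) + 2 * (w * a)) (by ring),
    ee (w ^ 2 * ((1 + w ^ 3) * (2 * a))) (2 * (w ^ 2 * a) + 2 * (w ^ 5 * a)) (by ring),
    en (w ^ 3 * ((1 + w ^ 3) * (2 * a))) (2 * a - 2 * (w ^ 3 * a)) (by linear_combination (2 * a * w ^ 0) * h6),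
    ee (w ^ 4 * ((1 + w ^ 3) * (2 * a))) (2 * (w ^ 4 * a) - 2 * (w * a)) (by linear_combination (2 * a * w ^ 1) * h6),
    en (w ^ 5 * ((1 + w ^ 3) * (2 * a))) (2 * (w ^ 2 * a) - 2 * (w ^ 5 * a)) (by linear_combination (2 * a * w ^ 2) * h6),
    ee (w ^ 0 * ((1 + w ^ 5) * (2 * a))) (2 * a + 2 * (w ^ 5 * a)) (by ring),
    en (w ^ 1 * ((1 + w ^ 5) * (2 * a))) (2 * a - 2 * (w * a)) (by linear_combination (2 * a * w ^ 0) * h6),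
    ee (w ^ 2 * ((1 + w ^ 5) * (2 * a))) (2 * (w ^ 2 * a) - 2 * (w * a)) (by linear_combination (2 * a * w ^ 1) * h6),
    en (w ^ 3 * ((1 + w ^ 5) * (2 * a))) (2 * (w ^ 2 * a) - 2 * (w ^ 3 * a)) (by linear_combination (2 * a * w ^ 2) * h6),
    ee (w ^ 4 * ((1 + w ^ 5) * (2 * a))) (2 * (w ^ 4 * a) - 2 * (w ^ 3 * a)) (by linear_combination (2 * a * w ^ 3) * h6),
    en (w ^ 5 * ((1 + w ^ 5) * (2 * a))) (2 * (w ^ 4 * a) - 2 * (w ^ 5 * a)) (by linear_combination (2 * a * w ^ 4) * h6),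
    ee (w ^ 0 * (2 * a)) (2 * a) (by ring),
    ee (w ^ 1 * (2 * a)) (2 * (w * a)) (by ring),
    ee (w ^ 2 * (2 * a)) (2 * (w ^ 2 * a)) (by ring),
    ee (w ^ 3 * (2 * a)) (2 * (w ^ 3 * a)) (by ring),
    ee (w ^ 4 * (2 * a)) (2 * (w ^ 4 * a)) (by ring),
    ee (w ^ 5 * (2 * a)) (2 * (w ^ 5 * a)) (by ring)]
  linear_combination 1 / 16 * p01 + 1 / 16 * p03 + 1 / 16 * p05 + 1 / 16 * p21 + 1 / 16 * p23 + 1 / 16 * p25 + 1 / 16 * p41 + 1 / 16 * p43 + 1 / 16 * p45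

lemma tw_uniq (a b : ℕ → ℂ) (F : ℂ → ℂ) (ha : ∀ y : ℂ, ‖y‖ < 1 → HasSum (fun k => y ^ k * a k) (F y))
    (hb : ∀ y : ℂ, ‖y‖ < 1 → HasSum (fun k => y ^ k * b k) (F y)) (k : ℕ) : a k = b k := by
  have hn : ∀ᶠ y : ℂ in nhds 0, ‖y‖ < 1 := by
    have := Metric.ball_mem_nhds (0 : ℂ) one_pos
    filter_upwards [this] with y hy
    simpa using hy
  have h1 : HasFPowerSeriesAt F (FormalMultilinearSeries.ofScalars ℂ a) 0 := by
    rw [hasFPowerSeriesAt_iff]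
    filter_upwards [hn] with y hy
    simpa [FormalMultilinearSeries.coeff_ofScalars] using ha y hy
  have h2 : HasFPowerSeriesAt F (FormalMultilinearSeries.ofScalars ℂ b) 0 := by
    rw [hasFPowerSeriesAt_iff]
    filter_upwards [hn] with y hy
    simpa [FormalMultilinearSeries.coeff_ofScalars] using hb y hy
  have := congrArg (fun p => FormalMultilinearSeries.coeff p k) (h1.eq_formalMultilinearSeries h2)
  simpa [FormalMultilinearSeries.coeff_ofScalars] using this

lemma tw_cosprod (w x : ℂ) (hw : w ^ 4 = w ^ 2 - 1) (hn : ‖w‖ = 1) (hx : ‖x‖ < 1) :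
    ∏' n : ℕ, (1 + (-x ^ 12) * (1 / (2 * (n : ℂ) + 1) ^ 12)) =
    1 / 16 * (1 + twG w (Real.pi * x) + 1 / 2 * (twG w ((1 + w) * (Real.pi * x)) +
      twG w ((1 + w ^ 3) * (Real.pi * x)) + twG w ((1 + w ^ 5) * (Real.pi * x)))) := by
  have hj : ∀ j : ℕ, HasProd (fun n : ℕ => 1 - (w ^ j * x) ^ 2 * (1 / (2 * (n : ℂ) + 1) ^ 2))
      (Complex.cos (w ^ j * (Real.pi * x / 2))) := by
    intro j
    have := tw_cos (w ^ j * x) (by rw [norm_mul, norm_pow, hn]; simp; linarith)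
    convert this using 2
    ring
  have H := (((((hj 0).mul (hj 1)).mul (hj 2)).mul (hj 3)).mul (hj 4)).mul (hj 5)
  have h2 := tw_prod w (Real.pi * x / 2) hw
  rw [show 2 * ((Real.pi : ℂ) * x / 2) = Real.pi * x by ring] at h2
  rw [← h2]
  simp only [pow_zero, pow_one, one_mul] at H
  rw [← H.tprod_eq]
  apply tprod_congr
  intro n
  have e : (1 / (2 * (n : ℂ) + 1) ^ 12) = (1 / (2 * (n : ℂ) + 1) ^ 2) ^ 6 := by
    rw [div_pow, ← pow_mul]; simp
  rw [e]
  generalize 1 / (2 * (n : ℂ) + 1) ^ 2 = q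
  have key : ∀ u v : ℂ, u ^ 2 = u - 1 → 1 - v ^ 6 =
      (1 - v) * (1 - u * v) * (1 - u ^ 2 * v) * (1 - u ^ 3 * v) * (1 - u ^ 4 * v) *
        (1 - u ^ 5 * v) := by
    intro u v hu
    have h3 : u ^ 3 = -1 := by linear_combination (u + 1) * hu
    have h4 : u ^ 4 = -u := by linear_combination u * h3
    have h5 : u ^ 5 = 1 - u := by linear_combination u ^ 2 * h3 - hu
    rw [h5, h4, h3, hu]
    have h1 : (1 - u * v) * (1 - (1 - u) * v) = 1 - v + v ^ 2 := by
      linear_combination (-v ^ 2) * hu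
    have h2 : (1 - (u - 1) * v) * (1 - -u * v) = 1 + v + v ^ 2 := by
      linear_combination (-v ^ 2) * hu
    calc 1 - v ^ 6 = (1 - v) * (1 + v) * (1 - v + v ^ 2) * (1 + v + v ^ 2) := by ring
      _ = _ := by rw [← h1, ← h2]; ring
  have := key (w ^ 2) (x ^ 2 * q) (by rw [← hw]; ring)
  calc _ = 1 - (x ^ 2 * q) ^ 6 := by ring
    _ = _ := by rw [this]; ring

lemma tw_coeff (w s : ℂ) (hs : s ^ 2 = 3) (hw2 : w ^ 2 = s * w - 1) (hn : ‖w‖ = 1) (k : ℕ)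
    (hk : 1 ≤ k) :
    (multT (fun _ : Fin k => 12) : ℂ) = 3 * (Real.pi : ℂ) ^ (12 * k) / (16 * ((12 * k).factorial : ℂ)) *
        ((2 + s) ^ (6 * k) + (2 - s) ^ (6 * k) + 2 ^ (6 * k) + 2 * (-1 : ℂ) ^ k) := by
  have hw : w ^ 4 = w ^ 2 - 1 := by
    linear_combination (w ^ 2 + s * w + s ^ 2 - 1) * hw2 + (s * w - 1) * hs - hw2
  have h6 : w ^ 6 = -1 := by linear_combination (w ^ 2 + 1) * hw
  have r1 : (1 + w) ^ 12 = -(2 + s) ^ 6 := by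
    have : (1 + w) ^ 2 = w * (2 + s) := by linear_combination hw2
    calc (1 + w) ^ 12 = ((1 + w) ^ 2) ^ 6 := by ring
      _ = _ := by rw [this, mul_pow, h6]; ring
  have r2 : (1 + w ^ 3) ^ 12 = -2 ^ 6 := by
    have : (1 + w ^ 3) ^ 2 = w ^ 3 * 2 := by linear_combination h6
    calc (1 + w ^ 3) ^ 12 = ((1 + w ^ 3) ^ 2) ^ 6 := by ring
      _ = (w ^ 6) ^ 3 * 2 ^ 6 := by rw [this]; ring
      _ = _ := by rw [h6]; ring
  have r3 : (1 + w ^ 5) ^ 12 = -(2 - s) ^ 6 := by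
    have hw3 : w ^ 3 = 2 * w - s := by linear_combination (w + s) * hw2 + w * hs
    have hw5 : w ^ 5 = w - s := by linear_combination w * hw + hw3
    have : (1 + w ^ 5) ^ 2 = w ^ 5 * (2 - s) := by
      rw [hw5]; linear_combination hw2
    calc (1 + w ^ 5) ^ 12 = ((1 + w ^ 5) ^ 2) ^ 6 := by ring
      _ = (w ^ 6) ^ 5 * (2 - s) ^ 6 := by rw [this]; ring
      _ = _ := by rw [h6]; ring
  have main := tw_uniq (fun k => (multT (fun _ : Fin k => 12) : ℂ))
    (fun k => (if k = 0 then (1 / 16 : ℂ) else 0) +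
      3 * (Real.pi : ℂ) ^ (12 * k) / (16 * ((12 * k).factorial : ℂ)) *
        ((2 + s) ^ (6 * k) + (2 - s) ^ (6 * k) + 2 ^ (6 * k) + 2 * (-1 : ℂ) ^ k))
    (fun y => ∏' n : ℕ, (1 + y * (1 / (2 * (n : ℂ) + 1) ^ 12)))
    (fun y _ => tw_gen y) ?_ k
  · rw [main, if_neg (by omega), zero_add]
  intro y hy
  obtain ⟨x, hx⟩ := IsAlgClosed.exists_pow_nat_eq (-y) (show 0 < 12 by norm_num)
  have hyx : y = -x ^ 12 := by rw [hx]; ring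
  have hx1 : ‖x‖ < 1 := by
    have : ‖x‖ ^ 12 < 1 := by rw [← norm_pow, hx, norm_neg]; exact hy
    by_contra hc
    exact absurd (one_le_pow₀ (n := 12) (not_lt.mp hc)) (not_le.mpr this)
  rw [hyx, tw_cosprod w x hw hn hx1]
  have g := fun b => tw_G w b hw
  have H := ((hasSum_ite_eq (0 : ℕ) (1 : ℂ)).add (g (Real.pi * x))).add
    ((((g ((1 + w) * (Real.pi * x))).add (g ((1 + w ^ 3) * (Real.pi * x)))).add
      (g ((1 + w ^ 5) * (Real.pi * x)))).mul_left (1 / 2)) |>.mul_left (1 / 16)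
  refine Eq.mp (congrArg (fun q => HasSum q _) (funext fun m => ?_)) H
  symm
  have q : ∀ r R : ℂ, r ^ 12 = -R ^ 6 → (r * (Real.pi * x)) ^ (12 * m) =
      (-1) ^ m * R ^ (6 * m) * (Real.pi ^ (12 * m) * x ^ (12 * m)) := by
    intro r R h
    rw [mul_pow, mul_pow, pow_mul r, h, neg_pow (R ^ 6), ← pow_mul]
  rw [q _ _ r1, q _ _ r2, q _ _ r3, mul_pow, neg_pow, ← pow_mul]
  have hsq : ((-1 : ℂ) ^ m) * (-1) ^ m = 1 := by rw [← mul_pow]; simp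
  have hf : ((12 * m).factorial : ℂ) ≠ 0 := by exact_mod_cast Nat.factorial_ne_zero _
  have hi : (-1 : ℂ) ^ m * x ^ (12 * m) * (if m = 0 then (1 / 16 : ℂ) else 0) =
      1 / 16 * (if m = 0 then 1 else 0) := by
    split_ifs with h
    · subst h; simp
    · simp
  rw [mul_add, hi]
  generalize (if m = 0 then (1 : ℂ) else 0) = z
  generalize (-1 : ℂ) ^ m = e at *
  linear_combination (3 / 8 * (Real.pi : ℂ) ^ (12 * m) * x ^ (12 * m) / ((12 * m).factorial : ℂ)) * hsq

/-- `t({12}_k) = 3π^(12k)/(16(12k)!) * ((2+√3)^(6k) + (2−√3)^(6k) + 2^(6k) + 2(−1)^k)`. -/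
theorem multT_repeat_twelve (k : ℕ) (hk : 1 ≤ k) :
    multT (fun _ : Fin k => 12) =
      3 * Real.pi ^ (12 * k) / (16 * Nat.factorial (12 * k)) *
        ((2 + Real.sqrt 3) ^ (6 * k) + (2 - Real.sqrt 3) ^ (6 * k) +
          2 ^ (6 * k) + 2 * (-1 : ℝ) ^ k) := by
  have hsR : Real.sqrt 3 ^ 2 = 3 := Real.sq_sqrt (by norm_num)
  have hs : ((Real.sqrt 3 : ℝ) : ℂ) ^ 2 = 3 := by exact_mod_cast hsR
  have key := tw_coeff (((Real.sqrt 3 : ℝ) : ℂ) / 2 + Complex.I / 2) ((Real.sqrt 3 : ℝ) : ℂ) hs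
    (by linear_combination (-1 / 4 : ℂ) * hs + 1 / 4 * Complex.I_sq)
    (by
      have h : (((Real.sqrt 3 : ℝ) : ℂ) / 2 + Complex.I / 2) =
          ((Real.sqrt 3 / 2 : ℝ) : ℂ) + ((1 / 2 : ℝ) : ℂ) * Complex.I := by push_cast; ring
      rw [h, Complex.norm_add_mul_I, div_pow, hsR]
      norm_num) k hk
  apply Complex.ofReal_injective
  rw [key]
  push_cast
  ring
end

section
/- Let k ≥ 1 and let i_1, ..., i_k be integers all at least 2. Then Σ_{σ ∈ S_k} t*(i_{σ(1)}, ..., i_{σ(k)}) = Σ_{B = {B_1,...,B_l} ∈ Π_k} c(B) · Π_{s=1}^{l} t(Σ_{j ∈ B_s} i_j), where Π_k is the set of partitions of the set {1,2,...,k} into nonempty blocks, l is the number of blocks of B, and c(B) = (|B_1|−1)!(|B_2|−1)!···(|B_l|−1)!. -/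
/-- Multiple t-star value: sum over weakly decreasing tuples of odd positive
integers. -/
noncomputable def multTStar {k : ℕ} (a : Fin k → ℕ) : ℝ :=
  ∑' n : {f : Fin k → ℕ // Antitone f ∧ ∀ i, Odd (f i)},
    ∏ i, 1 / ((n.1 i : ℝ) ^ (a i))

open Finset Filter Topology in
theorem pi_hasSum {ι : Type*} [Fintype ι] [DecidableEq ι] (f : ι → ℕ → ℝ) (h0 : ∀ i n, 0 ≤ f i n)
    (hs : ∀ i, Summable (f i)) :
    HasSum (fun m : ι → ℕ => ∏ i, f i (m i)) (∏ i, ∑' n, f i n) := by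
  have hS : Summable (fun m : ι → ℕ => ∏ i, f i (m i)) := by
    refine summable_of_sum_le (c := ∏ i, ∑' n, f i n)
      (fun m => Finset.prod_nonneg fun i _ => h0 i _) ?_
    intro u
    calc ∑ m ∈ u, ∏ i, f i (m i)
        ≤ ∑ m ∈ Fintype.piFinset (fun i => u.image (fun m => m i)), ∏ i, f i (m i) := by
          refine Finset.sum_le_sum_of_subset_of_nonneg ?_
            (fun m _ _ => Finset.prod_nonneg fun i _ => h0 i _)
          intro m hm
          rw [Fintype.mem_piFinset]
          intro i
          exact Finset.mem_image_of_mem _ hm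
      _ = ∏ i, ∑ n ∈ u.image (fun m => m i), f i n := by
          rw [Finset.prod_univ_sum]
      _ ≤ _ := Finset.prod_le_prod (fun i _ => Finset.sum_nonneg fun n _ => h0 i n)
          (fun i _ => (hs i).sum_le_tsum _ (fun n _ => h0 i n))
  have hT : Tendsto (fun N => Fintype.piFinset (fun _ : ι => Finset.range N)) atTop atTop := by
    refine Filter.tendsto_atTop_finset_of_monotone ?_ ?_
    · intro a b hab
      exact Fintype.piFinset_subset _ _ (fun _ => Finset.range_mono hab)
    · intro m
      refine ⟨(∑ i, m i) + 1, ?_⟩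
      rw [Fintype.mem_piFinset]
      intro i
      rw [Finset.mem_range, Nat.lt_succ_iff]
      exact Finset.single_le_sum (f := m) (fun _ _ => Nat.zero_le _) (Finset.mem_univ i)
  have h1 : Tendsto (fun N => ∏ i, ∑ n ∈ Finset.range N, f i n) atTop
      (𝓝 (∏ i, ∑' n, f i n)) :=
    tendsto_finsetProd _ (fun i _ => (hs i).hasSum.tendsto_sum_nat)
  have h2 := Tendsto.comp hS.hasSum hT
  have : (fun N => ∏ i, ∑ n ∈ Finset.range N, f i n) =
    (fun s : Finset (ι → ℕ) => ∑ m ∈ s, ∏ i, f i (m i)) ∘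
      (fun N => Fintype.piFinset (fun _ : ι => Finset.range N)) := by
    funext N
    simp only [Function.comp]
    rw [Finset.prod_univ_sum]
  rw [this] at h1
  rw [tendsto_nhds_unique h1 h2]
  exact hS.hasSum

/-- weight -/
noncomputable def uw (e n : ℕ) : ℝ := if Odd n then 1 / (n : ℝ) ^ e else 0

theorem uw_nonneg (e n : ℕ) : 0 ≤ uw e n := by
  unfold uw; split_ifs <;> positivity

theorem uw_summable (e : ℕ) (he : 2 ≤ e) : Summable (uw e) := by
  refine Summable.of_nonneg_of_le (uw_nonneg e) ?_
    (Real.summable_one_div_nat_pow.2 (show 1 < e by omega))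
  intro n
  unfold uw; split_ifs
  · exact le_rfl
  · positivity

theorem multT_single (e : ℕ) : multT ![e] = ∑' n, uw e n := by
  unfold multT
  let φ : {f : Fin 1 → ℕ // StrictAnti f ∧ ∀ i, Odd (f i)} → ℕ := fun f => f.1 0
  have hφ : Function.Injective φ := by
    intro f g h
    apply Subtype.ext
    funext i
    rw [Subsingleton.elim i 0]
    exact h
  rw [← hφ.tsum_eq (f := uw e)]
  · refine tsum_congr fun f => ?_
    simp [φ, uw, f.2.2 0]
  · intro n hn
    have : Odd n := by
      by_contra h
      exact hn (by simp [uw, h])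
    exact ⟨⟨fun _ => n, Subsingleton.strictAnti _, fun _ => this⟩, rfl⟩

open Classical in
theorem multTStar_eq (k : ℕ) (a : Fin k → ℕ) (σ : Equiv.Perm (Fin k)) :
    multTStar (fun j => a (σ j)) =
      ∑' m : Fin k → ℕ, if Antitone (m ∘ σ) then ∏ j, uw (a j) (m j) else 0 := by
  unfold multTStar
  let φ : {f : Fin k → ℕ // Antitone f ∧ ∀ i, Odd (f i)} → (Fin k → ℕ) := fun f => f.1 ∘ σ.symm
  have hφ : Function.Injective φ := by
    intro f g h
    apply Subtype.ext
    funext i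
    have := congrFun h (σ i)
    simpa [φ] using this
  rw [← hφ.tsum_eq (f := fun m : Fin k → ℕ =>
    if Antitone (m ∘ σ) then ∏ j, uw (a j) (m j) else 0)]
  · refine tsum_congr fun f => ?_
    have h1 : φ f ∘ σ = f.1 := by funext i; simp [φ]
    rw [h1, if_pos f.2.1, ← Equiv.prod_comp σ (fun j => uw (a j) (φ f j))]
    refine Finset.prod_congr rfl fun i _ => ?_
    simp [φ, uw, f.2.2 i]
  · intro m hm
    have hA : Antitone (m ∘ σ) := by
      by_contra h
      exact hm (by simp [h])
    have hO : ∀ i, Odd (m i) := by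
      intro i
      by_contra h
      apply hm
      simp only [hA, if_true]
      exact Finset.prod_eq_zero (Finset.mem_univ i) (by simp [uw, h])
    refine ⟨⟨m ∘ σ, hA, fun i => hO _⟩, ?_⟩
    funext i; simp [φ]

open Classical in
theorem card_antitone (k : ℕ) (m : Fin k → ℕ) :
    (Finset.univ.filter fun σ : Equiv.Perm (Fin k) => Antitone (m ∘ σ)).card =
      ∏ v ∈ Finset.univ.image m, (Finset.univ.filter fun i => m i = v).card.factorial := by
  have h := DomMulAct.stabilizer_card' (f := m)
  simp only [Fintype.card_subtype] at h
  rw [← h]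
  obtain ⟨τ, hτ⟩ : ∃ τ : Equiv.Perm (Fin k), Antitone (m ∘ τ) :=
    ⟨Tuple.sort (OrderDual.toDual ∘ m), Tuple.monotone_sort (OrderDual.toDual ∘ m)⟩
  refine Finset.card_bij' (fun σ _ => σ * τ⁻¹) (fun σ _ => σ * τ) ?_ ?_ ?_ ?_
  · intro σ hσ
    simp only [Finset.mem_filter, Finset.mem_univ, true_and] at hσ ⊢
    have := Tuple.unique_antitone hσ hτ
    funext i
    have := congrFun this (τ⁻¹ i)
    simpa using this
  · intro σ hσ
    simp only [Finset.mem_filter, Finset.mem_univ, true_and] at hσ ⊢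
    rw [Equiv.Perm.coe_mul, ← Function.comp_assoc, hσ]
    exact hτ
  · intro σ _; simp
  · intro σ _; simp

section Comb
open Finset

variable {α : Type*} [DecidableEq α]

theorem Finp_eq_of_mem {s : Finset α} (P : Finpartition s) {B C : Finset α} (hB : B ∈ P.parts)
    (hC : C ∈ P.parts) {y : α} (h1 : y ∈ B) (h2 : y ∈ C) : B = C := by
  rw [← P.part_eq_of_mem hB h1, ← P.part_eq_of_mem hC h2]

/-- add `x` to block `B` -/
def addPt {s : Finset α} {x : α} (hx : x ∉ s) (P : Finpartition s) (B : Finset α)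
    (hB : B ∈ insert ∅ P.parts) : Finpartition (insert x s) :=
  Finpartition.ofExistsUnique (insert (insert x B) (P.parts.erase B))
    (by
      have hs : ∀ C ∈ P.parts, C ⊆ s := fun C hC => P.le hC
      intro p hp
      rw [mem_insert, mem_erase] at hp
      rcases hp with rfl | ⟨_, hp⟩
      · apply insert_subset_insert
        rw [mem_insert] at hB
        rcases hB with rfl | hB
        · exact empty_subset _
        · exact hs _ hB
      · exact (hs _ hp).trans (subset_insert _ _))
    (by
      have hs : ∀ C ∈ P.parts, C ⊆ s := fun C hC => P.le hC
      intro y hy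
      by_cases hyB : y ∈ insert x B
      · refine ⟨insert x B, ⟨mem_insert_self _ _, hyB⟩, ?_⟩
        rintro C ⟨hC, hyC⟩
        rw [mem_insert, mem_erase] at hC
        rcases hC with rfl | ⟨hne, hC⟩
        · rfl
        · exfalso
          rw [mem_insert] at hyB
          rcases hyB with rfl | hyB
          · exact hx (hs _ hC hyC)
          · rw [mem_insert] at hB
            rcases hB with rfl | hB
            · simp at hyB
            · exact hne (Finp_eq_of_mem P hC hB hyC hyB)
      · have hys : y ∈ s := by
          rw [mem_insert] at hy hyB
          tauto
        obtain ⟨C, ⟨hC, hyC⟩, hu⟩ := P.existsUnique_mem hys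
        refine ⟨C, ⟨?_, hyC⟩, ?_⟩
        · rw [mem_insert, mem_erase]
          right
          refine ⟨?_, hC⟩
          rintro rfl
          exact hyB (mem_insert_of_mem hyC)
        · rintro D ⟨hD, hyD⟩
          rw [mem_insert, mem_erase] at hD
          rcases hD with rfl | ⟨_, hD⟩
          · exact absurd hyD hyB
          · exact hu D ⟨hD, hyD⟩)
    (by
      rw [mem_insert, mem_erase, not_or]
      exact ⟨(insert_ne_empty _ _).symm, fun h => P.bot_notMem h.2⟩)

theorem sum_finp_insert {M : Type*} [AddCommMonoid M] {s : Finset α} {x : α} (hx : x ∉ s)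
    (G : Finset (Finset α) → M) :
    ∑ Q : Finpartition (insert x s), G Q.parts =
      ∑ P : Finpartition s, ∑ B ∈ insert ∅ P.parts,
        G (insert (insert x B) (P.parts.erase B)) := by
  rw [Finset.sum_sigma']
  symm
  refine Finset.sum_bij (fun PB h => addPt hx PB.1 PB.2 (Finset.mem_sigma.1 h).2) ?_ ?_ ?_ ?_
  · intros; exact mem_univ _
  · rintro ⟨P, B⟩ h ⟨P', B'⟩ h' heq
    have hB := (Finset.mem_sigma.1 h).2
    have hB' := (Finset.mem_sigma.1 h').2
    simp only at hB hB'
    have key : insert (insert x B) (P.parts.erase B) = insert (insert x B') (P'.parts.erase B') :=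
      congrArg Finpartition.parts heq
    have hxP : ∀ (R : Finpartition s) (C : Finset α), C ∈ insert ∅ R.parts → x ∉ C := by
      intro R C hC hxC
      rw [mem_insert] at hC
      rcases hC with rfl | hC
      · simp at hxC
      · exact hx (R.le hC hxC)
    have hBB : B = B' := by
      have h1 : insert x B ∈ insert (insert x B') (P'.parts.erase B') := by
        rw [← key]; exact mem_insert_self _ _
      rw [mem_insert, mem_erase] at h1
      rcases h1 with h1 | ⟨_, h1⟩
      · rw [← erase_insert (hxP P B hB), h1, erase_insert (hxP P' B' hB')]
      · exact absurd (mem_insert_self x B) (hxP P' _ (mem_insert_of_mem h1))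
    subst hBB
    have hn : ∀ R : Finpartition s, insert x B ∉ R.parts.erase B := fun R hR =>
      hxP R _ (mem_insert_of_mem (mem_of_mem_erase hR)) (mem_insert_self _ _)
    have he : P.parts.erase B = P'.parts.erase B := by
      rw [← erase_insert (hn P), key, erase_insert (hn P')]
    have hPP : P.parts = P'.parts := by
      rcases eq_or_ne B ∅ with rfl | hne
      · have e1 : ∅ ∉ P.parts := P.bot_notMem
        have e2 : ∅ ∉ P'.parts := P'.bot_notMem
        rwa [erase_eq_of_notMem e1, erase_eq_of_notMem e2] at he
      · rw [mem_insert] at hB hB'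
        rw [← insert_erase (hB.resolve_left hne), he, insert_erase (hB'.resolve_left hne)]
    have : P = P' := Finpartition.ext hPP
    subst this
    rfl
  · intro Q _
    set C := Q.part x with hC
    have hxs : x ∈ insert x s := mem_insert_self _ _
    have hCm : C ∈ Q.parts := Q.part_mem.2 hxs
    have hxC : x ∈ C := Q.mem_part hxs
    have hne : ∅ ∉ Q.parts := Q.bot_notMem
    have hdis : ∀ D ∈ Q.parts, x ∈ D → D = C := fun D hD h => Finp_eq_of_mem Q hD hCm h hxC
    let P : Finpartition s := Finpartition.ofExistsUnique
      ((insert (C.erase x) (Q.parts.erase C)).erase ∅)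
      (by
        intro p hp
        rw [mem_erase, mem_insert, mem_erase] at hp
        rcases hp with ⟨_, rfl | ⟨h1, h2⟩⟩
        · rw [← erase_insert hx]
          exact erase_subset_erase _ (Q.le hCm)
        · intro y hy
          have := Q.le h2 hy
          rcases mem_insert.1 this with rfl | h
          · exact absurd (hdis p h2 hy) h1
          · exact h)
      (by
        intro y hy
        have hyx : y ≠ x := fun h => hx (h ▸ hy)
        obtain ⟨D, ⟨hD, hyD⟩, hu⟩ := Q.existsUnique_mem (mem_insert_of_mem hy : y ∈ insert x s)
        have hu' : ∀ E ∈ Q.parts, y ∈ E → E = D := fun E h1 h2 => hu E ⟨h1, h2⟩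
        by_cases hDC : D = C
        · refine ⟨C.erase x, ⟨?_, ?_⟩, ?_⟩
          · rw [mem_erase]
            refine ⟨?_, mem_insert_self _ _⟩
            apply ne_empty_of_mem (a := y)
            rw [mem_erase, ← hDC]; exact ⟨hyx, hyD⟩
          · rw [mem_erase, ← hDC]; exact ⟨hyx, hyD⟩
          · rintro E ⟨hE, hyE⟩
            rw [mem_erase, mem_insert, mem_erase] at hE
            rcases hE with ⟨_, rfl | ⟨h1, h2⟩⟩
            · rfl
            · exact absurd ((hu' E h2 hyE).trans hDC) h1
        · refine ⟨D, ⟨?_, hyD⟩, ?_⟩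
          · rw [mem_erase, mem_insert, mem_erase]
            exact ⟨ne_empty_of_mem hyD, Or.inr ⟨hDC, hD⟩⟩
          · rintro E ⟨hE, hyE⟩
            rw [mem_erase, mem_insert, mem_erase] at hE
            rcases hE with ⟨_, rfl | ⟨h1, h2⟩⟩
            · exact absurd (hu' C hCm (mem_of_mem_erase hyE)).symm hDC
            · exact hu' E h2 hyE)
      (by simp)
    have hPp : P.parts = (insert (C.erase x) (Q.parts.erase C)).erase ∅ := rfl
    have hmem : C.erase x ∈ insert ∅ P.parts := by
      rw [hPp, mem_insert, mem_erase]
      by_cases h : C.erase x = ∅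
      · exact Or.inl h
      · exact Or.inr ⟨h, mem_insert_self _ _⟩
    refine ⟨⟨P, C.erase x⟩, Finset.mem_sigma.2 ⟨mem_univ _, hmem⟩, ?_⟩
    apply Finpartition.ext
    change insert (insert x (C.erase x)) (P.parts.erase (C.erase x)) = Q.parts
    rw [insert_erase hxC, hPp]
    have hnm : C.erase x ∉ Q.parts := by
      intro h
      have h0 : (C.erase x).Nonempty := Q.nonempty_of_mem_parts h
      obtain ⟨y, hy⟩ := h0
      have := Finp_eq_of_mem Q h hCm hy (mem_of_mem_erase hy)
      exact notMem_erase x C (by rw [this]; exact hxC)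
    ext D
    simp only [mem_insert, mem_erase]
    constructor
    · rintro (rfl | ⟨h1, h2, h3 | ⟨h4, h5⟩⟩)
      · exact hCm
      · exact absurd h3 h1
      · exact h5
    · intro hD
      by_cases h : D = C
      · exact Or.inl h
      · exact Or.inr ⟨fun h' => hnm (h' ▸ hD), fun h' => hne (h' ▸ hD), Or.inr ⟨h, hD⟩⟩
  · intro PB h; rfl

open Classical in
/-- block weight -/
noncomputable def gw (m : α → ℕ) (B : Finset α) : ℕ :=
  if ∀ i ∈ B, ∀ j ∈ B, m i = m j then (B.card - 1).factorial else 0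

theorem gw_insert (m : α → ℕ) (B : Finset α) (hB : B.Nonempty) (x : α) (hx : x ∉ B) :
    gw m (insert x B) = (B.filter fun i => m i = m x).card * gw m B := by
  unfold gw
  by_cases h : ∀ i ∈ B, ∀ j ∈ B, m i = m j
  · rw [if_pos h]
    obtain ⟨b, hb⟩ := hB
    by_cases hbx : m b = m x
    · have h1 : B.filter (fun i => m i = m x) = B :=
        filter_true_of_mem fun i hi => (h i hi b hb).trans hbx
      rw [h1, if_pos, card_insert_of_notMem hx, Nat.add_sub_cancel]
      · exact (Nat.mul_factorial_pred (card_pos.2 ⟨b, hb⟩).ne').symm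
      · have : ∀ i ∈ insert x B, m i = m x := by
          intro i hi
          rcases mem_insert.1 hi with rfl | hi
          · rfl
          · exact (h i hi b hb).trans hbx
        intro i hi j hj
        rw [this i hi, this j hj]
    · have h1 : B.filter (fun i => m i = m x) = ∅ :=
        filter_false_of_mem fun i hi h' => hbx ((h b hb i hi).trans h')
      rw [h1, if_neg]
      · simp
      · intro h'
        exact hbx (h' b (mem_insert_of_mem hb) x (mem_insert_self _ _))
  · rw [if_neg h, if_neg, mul_zero]
    intro h'
    exact h fun i hi j hj => h' i (mem_insert_of_mem hi) j (mem_insert_of_mem hj)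

theorem sum_gw (m : α → ℕ) (V : Finset ℕ) (s : Finset α) (hV : ∀ i ∈ s, m i ∈ V) :
    ∑ P : Finpartition s, ∏ B ∈ P.parts, gw m B =
      ∏ v ∈ V, (s.filter fun i => m i = v).card.factorial := by
  induction s using Finset.induction_on with
  | empty =>
    have : ∀ P : Finpartition (∅ : Finset α), P.parts = ∅ := by
      intro P
      exact Finpartition.parts_eq_empty_iff.2 rfl
    have hu : (univ : Finset (Finpartition (∅ : Finset α))).card = 1 := by
      rw [card_univ, Fintype.card_eq_one_iff]
      exact ⟨Finpartition.empty _, fun P => Finpartition.ext ((this P).trans (this _).symm)⟩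
    rw [Finset.sum_congr rfl (fun P _ => by rw [this P])]
    simp [hu]
  | insert x s hx ih =>
    have hxV := hV x (mem_insert_self _ _)
    rw [sum_finp_insert hx (fun p => ∏ B ∈ p, gw m B)]
    have key : ∀ P : Finpartition s, ∑ B ∈ insert ∅ P.parts,
        ∏ C ∈ insert (insert x B) (P.parts.erase B), gw m C =
        (∏ B ∈ P.parts, gw m B) * ((s.filter fun i => m i = m x).card + 1) := by
      intro P
      have hxB : ∀ B ∈ P.parts, x ∉ B := fun B hB h => hx (P.le hB h)
      have hne : ∅ ∉ P.parts := P.bot_notMem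
      have hnm : ∀ B, insert x B ∉ P.parts.erase B := fun B h =>
        hxB _ (mem_of_mem_erase h) (mem_insert_self _ _)
      rw [sum_insert hne, mul_add, mul_one, add_comm]
      congr 1
      · have hc : (s.filter fun i => m i = m x).card =
            ∑ B ∈ P.parts, (B.filter fun i => m i = m x).card := by
          conv_lhs => rw [← P.biUnion_parts]
          rw [filter_biUnion, card_biUnion]
          · rfl
          · intro B hB C hC hBC
            exact disjoint_filter_filter (P.disjoint hB hC hBC)
        rw [hc, mul_sum]
        refine sum_congr rfl fun B hB => ?_
        rw [prod_insert (hnm B), gw_insert m B (P.nonempty_of_mem_parts hB) x (hxB B hB),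
          ← mul_prod_erase _ _ hB]
        ring
      · rw [prod_insert (hnm ∅), erase_eq_of_notMem hne]
        simp [gw]
    rw [sum_congr rfl fun P _ => key P, ← sum_mul, ih fun i hi => hV i (mem_insert_of_mem hi),
      ← mul_prod_erase _ _ hxV, ← mul_prod_erase V _ hxV, filter_insert, if_pos rfl,
      card_insert_of_notMem (by simp [hx]), Nat.factorial_succ]
    have : ∏ v ∈ V.erase (m x), ((insert x s).filter fun i => m i = v).card.factorial =
        ∏ v ∈ V.erase (m x), (s.filter fun i => m i = v).card.factorial := by
      refine prod_congr rfl fun v hv => ?_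
      rw [filter_insert, if_neg (ne_of_mem_erase hv).symm]
    rw [this]
    ring

end Comb

open Classical in
theorem finp_prod (k : ℕ) (a : Fin k → ℕ) (ha : ∀ j, 2 ≤ a j)
    (P : Finpartition (Finset.univ : Finset (Fin k))) :
    ∏ B ∈ P.parts, multT ![∑ j ∈ B, a j] =
      ∑' m : Fin k → ℕ, if ∀ B ∈ P.parts, ∀ i ∈ B, ∀ j ∈ B, m i = m j then
        ∏ j, uw (a j) (m j) else 0 := by
  simp only [multT_single]
  have hsum : ∀ B : P.parts, 2 ≤ ∑ j ∈ B.1, a j := by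
    intro B
    obtain ⟨b, hb⟩ := P.nonempty_of_mem_parts B.2
    exact (ha b).trans (Finset.single_le_sum (f := a) (fun _ _ => Nat.zero_le _) hb)
  rw [← Finset.prod_coe_sort P.parts (fun B => ∑' n, uw (∑ j ∈ B, a j) n)]
  rw [← (pi_hasSum (fun B : P.parts => uw (∑ j ∈ B.1, a j)) (fun B n => uw_nonneg _ _)
    (fun B => uw_summable _ (hsum B))).tsum_eq]
  have hp : ∀ j, P.part j ∈ P.parts := fun j => P.part_mem.2 (Finset.mem_univ j)
  let φ : (P.parts → ℕ) → (Fin k → ℕ) := fun c j => c ⟨P.part j, hp j⟩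
  have hφB : ∀ c (B : P.parts) j, j ∈ B.1 → φ c j = c B := by
    intro c B j hj
    change c ⟨P.part j, hp j⟩ = c B
    congr 1
    exact Subtype.ext (P.part_eq_of_mem B.2 hj)
  have hφ : Function.Injective φ := by
    intro c d h
    funext B
    obtain ⟨b, hb⟩ := P.nonempty_of_mem_parts B.2
    rw [← hφB c B b hb, ← hφB d B b hb, h]
  rw [← hφ.tsum_eq]
  · refine tsum_congr fun c => ?_
    rw [if_pos]
    · have h1 : ∏ j, uw (a j) (φ c j) = ∏ B ∈ P.parts, ∏ j ∈ B, uw (a j) (φ c j) := by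
        conv_lhs => rw [← P.biUnion_parts]
        exact Finset.prod_biUnion P.disjoint
      rw [h1, ← Finset.prod_coe_sort P.parts]
      refine Finset.prod_congr rfl fun B _ => ?_
      rw [Finset.prod_congr rfl fun j hj => by rw [hφB c B j hj]]
      obtain ⟨b, hb⟩ := P.nonempty_of_mem_parts B.2
      by_cases ho : Odd (c B)
      · simp only [uw, if_pos ho]
        rw [← Finset.prod_pow_eq_pow_sum]
        simp
      · rw [Finset.prod_eq_zero hb] <;> simp [uw, ho]
    · intro B hB i hi j hj
      rw [hφB c ⟨B, hB⟩ i hi, hφB c ⟨B, hB⟩ j hj]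
  · intro m hm
    have hc : ∀ B ∈ P.parts, ∀ i ∈ B, ∀ j ∈ B, m i = m j := by
      by_contra h
      exact hm (if_neg h)
    refine ⟨fun B => m (P.nonempty_of_mem_parts B.2).choose, ?_⟩
    funext j
    exact hc _ (hp j) _ (P.nonempty_of_mem_parts (hp j)).choose_spec _
      (P.mem_part (Finset.mem_univ j))

/-- Symmetric sum formula for multiple t-star values (Theorem `adelaide`). -/
theorem multTStar_symmetric_sum (k : ℕ) (hk : 1 ≤ k) (a : Fin k → ℕ)
    (ha : ∀ j, 2 ≤ a j) :
    ∑ σ : Equiv.Perm (Fin k), multTStar (fun j => a (σ j)) =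
      ∑ P : Finpartition (Finset.univ : Finset (Fin k)),
        (∏ B ∈ P.parts, (Nat.factorial (B.card - 1) : ℝ)) *
          ∏ B ∈ P.parts, multT ![∑ j ∈ B, a j] := by
  classical
  have hS : Summable (fun m : Fin k → ℕ => ∏ j, uw (a j) (m j)) :=
    (pi_hasSum (fun j => uw (a j)) (fun j n => uw_nonneg _ _)
      (fun j => uw_summable _ (ha j))).summable
  have hIf : ∀ (p : (Fin k → ℕ) → Prop) [DecidablePred p],
      Summable (fun m : Fin k → ℕ => if p m then ∏ j, uw (a j) (m j) else 0) := by
    intro p _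
    refine Summable.of_nonneg_of_le (fun m => ?_) (fun m => ?_) hS
    · split_ifs
      · exact Finset.prod_nonneg fun j _ => uw_nonneg _ _
      · exact le_rfl
    · split_ifs
      · exact le_rfl
      · exact Finset.prod_nonneg fun j _ => uw_nonneg _ _
  simp only [multTStar_eq, finp_prod k a ha, ← tsum_mul_left]
  rw [← Summable.tsum_finsetSum
      fun (σ : Equiv.Perm (Fin k)) _ => hIf (fun m => Antitone (m ∘ σ)),
    ← Summable.tsum_finsetSum
      fun (P : Finpartition (Finset.univ : Finset (Fin k))) _ =>
        (hIf (fun m => ∀ B ∈ P.parts, ∀ i ∈ B, ∀ j ∈ B, m i = m j)).mul_left _]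
  refine tsum_congr fun m => ?_
  have h1 := card_antitone k m
  rw [← sum_gw m (Finset.univ.image m) Finset.univ
    (fun i _ => Finset.mem_image_of_mem _ (Finset.mem_univ i))] at h1
  rw [← Finset.sum_filter, Finset.sum_const, nsmul_eq_mul]
  have h2 := congrArg (fun n : ℕ => (n : ℝ)) h1
  rw [show ((Finset.univ.filter fun σ : Equiv.Perm (Fin k) => Antitone (m ∘ σ)).card : ℝ) = _
    from h2]
  push_cast
  rw [Finset.sum_mul]
  refine Finset.sum_congr rfl fun P _ => ?_
  by_cases hc : ∀ B ∈ P.parts, ∀ i ∈ B, ∀ j ∈ B, m i = m j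
  · rw [if_pos hc]
    congr 1
    refine Finset.prod_congr rfl fun B hB => ?_
    rw [gw, if_pos (hc B hB)]
  · rw [if_neg hc, mul_zero]
    push Not at hc
    obtain ⟨B, hB, i, hi, j, hj, hij⟩ := hc
    rw [Finset.prod_eq_zero hB, zero_mul]
    rw [gw, if_neg, Nat.cast_zero]
    intro h
    exact hij (h i hi j hj)
end

section
/- For integers n ≥ 2 and k ≥ 1, t*({n}_k) = Σ_{λ ⊢ k} 1 / (m_1(λ)! · 1^{m_1(λ)} · m_2(λ)! · 2^{m_2(λ)} ···) · Π_{j=1}^{ℓ(λ)} t(n·λ_j), where the sum is over all integer partitions λ = (λ_1 ≥ λ_2 ≥ ... ≥ λ_{ℓ(λ)}) of k. -/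
open Finset PowerSeries
open scoped PowerSeries.WithPiTopology

noncomputable def tsG (p : ℕ → ℝ) : PowerSeries ℝ :=
  Nat.Partition.genFun (fun i c => p i ^ c / ((Nat.factorial c : ℝ) * (i : ℝ) ^ c))

lemma ts_factor (p : ℕ → ℝ) (i : ℕ) (hi : i ≠ 0) :
    (1 : PowerSeries ℝ) + ∑' j, (p i ^ (j+1) / ((Nat.factorial (j+1) : ℝ) * (i : ℝ) ^ (j+1))) •
      (X : PowerSeries ℝ) ^ (i * (j + 1)) =
    expand i hi (rescale (p i / i) (exp ℝ)) := by
  have hs := Nat.Partition.summable_genFun_term'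
    (fun i c => p i ^ c / ((Nat.factorial c : ℝ) * (i : ℝ) ^ c)) hi
  ext d
  rw [map_add, hs.map_tsum _ (WithPiTopology.continuous_coeff _ _)]
  simp only [map_smul, coeff_X_pow, smul_eq_mul, mul_ite, mul_one, mul_zero]
  by_cases hd : i ∣ d
  · obtain ⟨m, rfl⟩ := hd
    rw [coeff_expand_mul, coeff_rescale, coeff_exp]
    rcases m with _ | m
    · have : ∀ j : ℕ, ¬ (0 = i * (j + 1)) := fun j h => by
        have := Nat.mul_eq_zero.1 h.symm
        omega
      simp [hi]
    · rw [tsum_eq_single m]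
      · have : i * (m + 1) ≠ 0 := by positivity
        have hi' : (i : ℝ) ≠ 0 := by exact_mod_cast hi
        have hf : ((m + 1).factorial : ℝ) ≠ 0 := by exact_mod_cast Nat.factorial_ne_zero _
        rw [coeff_one, if_neg this, if_pos rfl]
        rw [div_pow]
        simp
        field_simp
      · intro b hb
        rw [if_neg]
        intro h
        have := Nat.eq_of_mul_eq_mul_left (Nat.pos_of_ne_zero hi) h
        omega
  · rw [coeff_expand_of_not_dvd _ _ _ hd, coeff_one, if_neg (by rintro rfl; simp at hd)]
    have : ∀ j : ℕ, ¬ (d = i * (j + 1)) := fun j h => hd ⟨_, h⟩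
    simp [this]

lemma ts_hasProd (p : ℕ → ℝ) :
    HasProd (fun i : ℕ => expand (i+1) (Nat.succ_ne_zero i)
      (rescale (p (i+1) / ((i+1 : ℕ) : ℝ)) (exp ℝ))) (tsG p) := by
  have := Nat.Partition.hasProd_genFun
    (fun i c => p i ^ c / ((Nat.factorial c : ℝ) * (i : ℝ) ^ c))
  have e := funext fun i : ℕ => ts_factor p (i+1) (Nat.succ_ne_zero i)
  rw [← e]
  exact this

lemma ts_mul (p q : ℕ → ℝ) : tsG (fun i => p i + q i) = tsG p * tsG q := by
  refine (ts_hasProd _).unique ?_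
  convert (ts_hasProd p).mul (ts_hasProd q) using 2 with i
  rw [← map_mul, exp_mul_exp_eq_exp_add, add_div]

lemma ts_zero : tsG (fun _ => 0) = 1 := by
  refine (ts_hasProd _).unique ?_
  convert hasProd_one using 2 with i
  simp

lemma ts_coeff (p : ℕ → ℝ) (k : ℕ) : coeff k (tsG p) = ∑ μ : Nat.Partition k,
    (1 / ∏ i ∈ μ.parts.toFinset,
      ((Nat.factorial (μ.parts.count i) : ℝ) * (i : ℝ) ^ (μ.parts.count i))) *
          (μ.parts.map p).prod := by
  rw [tsG, Nat.Partition.coeff_genFun]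
  refine Finset.sum_congr rfl fun μ _ => ?_
  rw [Finset.prod_multiset_map_count, Finsupp.prod, Multiset.toFinsupp_support]
  simp only [Multiset.toFinsupp_apply, Finset.prod_div_distrib]
  ring

lemma ts_card (k : ℕ) (μ : Nat.Partition k) :
    (#{g : Equiv.Perm (Fin k) | g.cycleType = μ.parts.filter (fun n => 2 ≤ n)} : ℝ) *
    ∏ i ∈ μ.parts.toFinset,
      ((Nat.factorial (μ.parts.count i) : ℝ) * (i : ℝ) ^ (μ.parts.count i)) = k.factorial := by
  have h := Equiv.Perm.card_of_cycleType_mul_eq (Fin k) (μ.parts.filter (fun n => 2 ≤ n))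
  set m := μ.parts.filter (fun n => 2 ≤ n) with hm
  have hsplit : μ.parts = m + Multiset.replicate (μ.parts.count 1) 1 := by
    rw [← Multiset.filter_eq', hm]
    nth_rw 1 [← Multiset.filter_add_not (fun n => 2 ≤ n) μ.parts]
    congr 1
    refine Multiset.filter_congr fun x hx => ?_
    have := μ.parts_pos hx
    omega
  have hsum : m.sum + μ.parts.count 1 = k := by
    have := μ.parts_sum
    rw [hsplit] at this
    simpa using this
  have h2 : ∀ a ∈ m, 2 ≤ a := fun a ha => (Multiset.mem_filter.1 ha).2
  rw [Fintype.card_fin, if_pos ⟨by omega, h2⟩] at h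
  rw [← h]
  have e : k - m.sum = μ.parts.count 1 := by omega
  rw [e]
  push_cast
  congr 1
  rw [Finset.prod_mul_distrib]
  have hp : ∏ i ∈ μ.parts.toFinset, (i : ℝ) ^ (μ.parts.count i) = (m.prod : ℕ) := by
    have : μ.parts.prod = m.prod := by
      conv_lhs => rw [hsplit]
      simp
    rw [← this, Finset.prod_multiset_count]
    push_cast
    rfl
  have hm1 : 1 ∉ m.toFinset := by
    intro h
    have := h2 1 (Multiset.mem_toFinset.1 h)
    omega
  have hf : ∏ i ∈ μ.parts.toFinset, (Nat.factorial (μ.parts.count i) : ℝ) =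
      (μ.parts.count 1).factorial * ∏ i ∈ m.toFinset, (Nat.factorial (m.count i) : ℝ) := by
    have h3 : ∏ i ∈ μ.parts.toFinset, (Nat.factorial (μ.parts.count i) : ℝ) =
        ∏ i ∈ insert 1 m.toFinset, (Nat.factorial (μ.parts.count i) : ℝ) := by
      refine Finset.prod_subset ?_ ?_
      · intro x hx
        have hx := Multiset.mem_toFinset.1 hx
        have := μ.parts_pos hx
        rw [Finset.mem_insert, Multiset.mem_toFinset, hm, Multiset.mem_filter]
        by_cases h1 : x = 1
        · exact Or.inl h1
        · exact Or.inr ⟨hx, by omega⟩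
      · intro x _ hx
        rw [Multiset.mem_toFinset] at hx
        simp [Multiset.count_eq_zero_of_notMem hx]
    rw [h3, Finset.prod_insert hm1]
    congr 1
    refine Finset.prod_congr rfl fun x hx => ?_
    rw [hm, Multiset.count_filter_of_pos (h2 x (Multiset.mem_toFinset.1 hx))]
  rw [hp, hf]
  push_cast
  ring

lemma ts_sum_one (k : ℕ) : ∑ μ : Nat.Partition k,
    (1 / ∏ i ∈ μ.parts.toFinset,
      ((Nat.factorial (μ.parts.count i) : ℝ) * (i : ℝ) ^ (μ.parts.count i))) = 1 := by
  have hk : (k.factorial : ℝ) ≠ 0 := by exact_mod_cast Nat.factorial_ne_zero _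
  have h1 : ∀ μ : Nat.Partition k, (1 / ∏ i ∈ μ.parts.toFinset,
      ((Nat.factorial (μ.parts.count i) : ℝ) * (i : ℝ) ^ (μ.parts.count i))) =
      (#{g : Equiv.Perm (Fin k) | g.cycleType = μ.parts.filter (fun n => 2 ≤ n)} : ℝ) /
        k.factorial := by
    intro μ
    have h := ts_card k μ
    have h0 : ∏ i ∈ μ.parts.toFinset,
      ((Nat.factorial (μ.parts.count i) : ℝ) * (i : ℝ) ^ (μ.parts.count i)) ≠ 0 := by
      intro h0
      rw [h0, mul_zero] at h
      exact hk h.symm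
    rw [div_eq_div_iff h0 hk, h, one_mul]
  simp_rw [h1]
  rw [← Finset.sum_div, div_eq_one_iff_eq hk, ← Nat.cast_sum]
  congr 1
  have hc : k.factorial = #(Finset.univ : Finset (Equiv.Perm (Fin k))) := by
    rw [Finset.card_univ, Fintype.card_perm, Fintype.card_fin]
  have key : ∀ (j : ℕ) (hj : Fintype.card (Fin k) = j),
      ∃ F : Equiv.Perm (Fin k) → Nat.Partition j, ∀ g (μ : Nat.Partition j),
        F g = μ ↔ g.cycleType = μ.parts.filter (fun n => 2 ≤ n) := by
    rintro j rfl
    refine ⟨fun g => g.partition, fun g μ => ⟨?_, ?_⟩⟩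
    · rintro rfl
      exact Equiv.Perm.filter_parts_partition_eq_cycleType.symm
    · intro h
      have hsplit : μ.parts = μ.parts.filter (fun n => 2 ≤ n) +
          Multiset.replicate (μ.parts.count 1) 1 := by
        rw [← Multiset.filter_eq']
        nth_rw 1 [← Multiset.filter_add_not (fun n => 2 ≤ n) μ.parts]
        congr 1
        refine Multiset.filter_congr fun x hx => ?_
        have := μ.parts_pos hx
        omega
      rw [← h] at hsplit
      have hs := μ.parts_sum
      rw [hsplit] at hs
      simp only [Multiset.sum_add, Multiset.sum_replicate, Equiv.Perm.sum_cycleType,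
        smul_eq_mul, mul_one] at hs
      rw [Nat.Partition.ext_iff, Equiv.Perm.parts_partition, hsplit]
      congr 2
      omega
  obtain ⟨F, hF⟩ := key k (Fintype.card_fin k)
  rw [hc, Finset.card_eq_sum_card_fiberwise (f := F) (t := Finset.univ) (fun _ _ => by simp)]
  refine Finset.sum_congr rfl fun μ _ => ?_
  congr 1
  ext g
  simp [hF]

lemma ts_single (x : ℝ) : tsG (fun i => x ^ i) = PowerSeries.mk (fun k => x ^ k) := by
  ext k
  rw [ts_coeff, coeff_mk]
  have : ∀ μ : Nat.Partition k, (μ.parts.map (fun i => x ^ i)).prod = x ^ k := by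
    intro μ
    conv_rhs => rw [← μ.parts_sum]
    generalize μ.parts = s
    induction s using Multiset.induction_on with
    | empty => simp
    | cons a s ih => simp [ih, pow_add]
  simp_rw [this]
  rw [← Finset.sum_mul, ts_sum_one, one_mul]

open Classical in
noncomputable def tsF (x : ℕ → ℝ) {k : ℕ} (g : Fin k → ℕ) : ℝ :=
  if Antitone g then ∏ i, x (g i) else 0

noncomputable def tsH (x : ℕ → ℝ) (N k : ℕ) : ℝ :=
  ∑ g ∈ Fintype.piFinset (fun _ : Fin k => range N), tsF x g

lemma tsH_zero_right (x : ℕ → ℝ) (N : ℕ) : tsH x N 0 = 1 := by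
  simp [tsH, tsF, Subsingleton.antitone]

lemma tsH_zero_left (x : ℕ → ℝ) (k : ℕ) : tsH x 0 (k+1) = 0 := by
  simp [tsH]

lemma ts_cons_antitone {k : ℕ} (N : ℕ) (g : Fin k → ℕ) (hg : ∀ i, g i ≤ N) :
    Antitone (Fin.cons N g : Fin (k+1) → ℕ) ↔ Antitone g := by
  constructor
  · intro h i j hij
    simpa using h (Fin.succ_le_succ_iff.2 hij)
  · intro h i j
    refine Fin.cases ?_ (fun i => ?_) i <;> refine Fin.cases ?_ (fun j => ?_) j
    · simp
    · simpa using hg j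
    · intro h; simp at h
    · intro hij
      simpa using h (Fin.succ_le_succ_iff.1 hij)

lemma tsH_succ (x : ℕ → ℝ) (N k : ℕ) :
    tsH x (N+1) (k+1) = tsH x N (k+1) + x N * tsH x (N+1) k := by
  rw [tsH, ← Finset.sum_filter_add_sum_filter_not _ (fun g => g 0 ≠ N)]
  congr 1
  · rw [tsH]
    symm
    refine Finset.sum_subset ?_ ?_
    · intro g hg
      simp only [Finset.mem_filter, Fintype.mem_piFinset, Finset.mem_range] at hg ⊢
      exact ⟨fun i => (hg i).trans (Nat.lt_succ_self _), (hg 0).ne⟩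
    · intro g hg hg'
      rw [tsF, if_neg]
      intro ha
      apply hg'
      simp only [Finset.mem_filter, Fintype.mem_piFinset, Finset.mem_range] at hg ⊢
      intro i
      have h1 := ha (Fin.zero_le i)
      have h2 := hg.1 0
      have h3 := hg.2
      omega
  · rw [tsH, Finset.mul_sum]
    refine Finset.sum_nbij' (fun g => Fin.tail g) (fun g => Fin.cons N g) ?_ ?_ ?_ ?_ ?_
    · intro g hg
      simp only [Finset.mem_filter, Fintype.mem_piFinset, Finset.mem_range] at hg ⊢
      exact fun i => hg.1 _
    · intro g hg
      simp only [Finset.mem_filter, Fintype.mem_piFinset, Finset.mem_range] at hg ⊢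
      refine ⟨fun i => ?_, by simp⟩
      refine Fin.cases ?_ (fun i => ?_) i
      · simp
      · simpa using hg i
    · intro g hg
      simp only [Finset.mem_filter, not_not] at hg
      rw [← hg.2, Fin.cons_self_tail]
    · intro g hg
      simp
    · intro g hg
      simp only [Finset.mem_filter, Fintype.mem_piFinset, Finset.mem_range, not_not] at hg
      have e : g = Fin.cons N (Fin.tail g) := by rw [← hg.2, Fin.cons_self_tail]
      have ha := ts_cons_antitone N (Fin.tail g) (fun i => Nat.lt_succ_iff.1 (hg.1 _))
      conv_lhs => rw [e]
      rw [tsF, tsF]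
      by_cases h : Antitone (Fin.tail g)
      · rw [if_pos h, if_pos (ha.2 h), Fin.prod_univ_succ]
        simp
      · rw [if_neg h, if_neg (fun h' => h (ha.1 h')), mul_zero]

lemma ts_geom (x : ℝ) : PowerSeries.mk (fun k => x ^ k) * (1 - C x * X) = 1 := by
  ext d
  rw [mul_sub, mul_one, ← mul_assoc, map_sub]
  rcases d with _ | d
  · simp
  · rw [coeff_succ_mul_X, mul_comm _ (C x), coeff_C_mul, coeff_one]
    simp [pow_succ']

lemma tsH_gen (x : ℕ → ℝ) (N : ℕ) :
    PowerSeries.mk (tsH x N) = tsG (fun i => ∑ a ∈ range N, x a ^ i) := by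
  induction N with
  | zero =>
    simp only [Finset.range_zero, Finset.sum_empty, ts_zero]
    ext d
    rcases d with _ | d
    · simp [tsH_zero_right]
    · simp [tsH_zero_left, coeff_one]
  | succ N ih =>
    simp only [Finset.sum_range_succ]
    rw [ts_mul, ← ih, ts_single]
    have h : PowerSeries.mk (tsH x (N+1)) * (1 - C (x N) * X) = PowerSeries.mk (tsH x N) := by
      ext d
      rw [mul_sub, mul_one, ← mul_assoc, map_sub]
      rcases d with _ | d
      · simp [tsH_zero_right]
      · rw [coeff_succ_mul_X, mul_comm _ (C (x N)), coeff_C_mul]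
        simp [tsH_succ]
    rw [← h, mul_assoc, mul_comm (1 - _), ts_geom, mul_one]

lemma ts_main (x : ℕ → ℝ) (hx : ∀ a, 0 ≤ x a) (hs : ∀ p, 0 < p → Summable (fun a => x a ^ p))
    (k : ℕ) : ∑' g : Fin k → ℕ, tsF x g = ∑ μ : Nat.Partition k,
    (1 / ∏ i ∈ μ.parts.toFinset,
      ((Nat.factorial (μ.parts.count i) : ℝ) * (i : ℝ) ^ (μ.parts.count i))) *
          (μ.parts.map (fun p => ∑' a, x a ^ p)).prod := by
  have hF : ∀ g : Fin k → ℕ, 0 ≤ tsF x g := by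
    intro g
    rw [tsF]
    split_ifs
    · exact Finset.prod_nonneg fun i _ => hx _
    · exact le_rfl
  have hmono : Monotone (fun N => Fintype.piFinset (fun _ : Fin k => range N)) := by
    intro a b hab
    exact Fintype.piFinset_subset _ _ fun _ => Finset.range_mono hab
  have hlim : Filter.Tendsto (fun N => tsH x N k) Filter.atTop (nhds (∑ μ : Nat.Partition k,
    (1 / ∏ i ∈ μ.parts.toFinset,
      ((Nat.factorial (μ.parts.count i) : ℝ) * (i : ℝ) ^ (μ.parts.count i))) *
          (μ.parts.map (fun p => ∑' a, x a ^ p)).prod)) := by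
    have : ∀ N, tsH x N k = ∑ μ : Nat.Partition k,
      (1 / ∏ i ∈ μ.parts.toFinset,
        ((Nat.factorial (μ.parts.count i) : ℝ) * (i : ℝ) ^ (μ.parts.count i))) *
          (μ.parts.map (fun p => ∑ a ∈ range N, x a ^ p)).prod := by
      intro N
      rw [← ts_coeff, ← tsH_gen, coeff_mk]
    simp_rw [this]
    refine tendsto_finsetSum _ fun μ _ => ?_
    refine Filter.Tendsto.const_mul _ ?_
    refine tendsto_multiset_prod _ fun p hp => ?_
    exact (hs p (μ.parts_pos hp)).hasSum.tendsto_sum_nat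
  have hHmono : Monotone (fun N => tsH x N k) := by
    intro a b hab
    exact Finset.sum_le_sum_of_subset_of_nonneg (hmono hab) fun g _ _ => hF g
  have hcov : ∀ g : Fin k → ℕ, ∃ N, g ∈ Fintype.piFinset (fun _ : Fin k => range N) := by
    intro g
    refine ⟨∑ i, g i + 1, ?_⟩
    simp only [Fintype.mem_piFinset, Finset.mem_range]
    intro i
    have := Finset.single_le_sum (f := g) (fun i _ => Nat.zero_le _) (Finset.mem_univ i)
    omega
  have htop := Filter.tendsto_atTop_finset_of_monotone hmono hcov
  have hsum : Summable (fun g : Fin k → ℕ => tsF x g) := by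
    refine summable_of_sum_le hF (c := ∑ μ : Nat.Partition k,
      (1 / ∏ i ∈ μ.parts.toFinset,
        ((Nat.factorial (μ.parts.count i) : ℝ) * (i : ℝ) ^ (μ.parts.count i))) *
          (μ.parts.map (fun p => ∑' a, x a ^ p)).prod) fun u => ?_
    obtain ⟨N, hN⟩ := (htop.eventually (Filter.eventually_ge_atTop u)).exists
    exact (Finset.sum_le_sum_of_subset_of_nonneg hN fun g _ _ => hF g).trans
      (hHmono.ge_of_tendsto hlim N)
  exact tendsto_nhds_unique (hsum.hasSum.comp htop) hlim

lemma ts_multT (m : ℕ) : multT ![m] = ∑' a : ℕ, 1 / ((2 * a + 1 : ℕ) : ℝ) ^ m := by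
  rw [multT]
  let e : ℕ ≃ {f : Fin 1 → ℕ // StrictAnti f ∧ ∀ i, Odd (f i)} :=
    { toFun := fun a => ⟨fun _ => 2 * a + 1, Subsingleton.strictAnti _, fun _ => ⟨a, rfl⟩⟩
      invFun := fun f => f.1 0 / 2
      left_inv := fun a => by simp; omega
      right_inv := fun f => by
        ext i
        obtain rfl : i = 0 := Subsingleton.elim _ _
        obtain ⟨c, hc⟩ := f.2.2 0
        simp only
        omega }
  rw [← e.tsum_eq]
  refine tsum_congr fun a => ?_
  simp [e]

lemma ts_multTStar (n k : ℕ) : multTStar (fun _ : Fin k => n) =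
    ∑' g : Fin k → ℕ, tsF (fun a => 1 / ((2 * a + 1 : ℕ) : ℝ) ^ n) g := by
  rw [multTStar]
  let e : {g : Fin k → ℕ // Antitone g} ≃ {f : Fin k → ℕ // Antitone f ∧ ∀ i, Odd (f i)} :=
    { toFun := fun g => ⟨fun i => 2 * g.1 i + 1,
        fun i j h => by have := g.2 h; simp only; omega, fun i => ⟨g.1 i, rfl⟩⟩
      invFun := fun f => ⟨fun i => f.1 i / 2,
        fun i j h => Nat.div_le_div_right (f.2.1 h)⟩
      left_inv := fun a => by
        ext i
        simp only
        omega
      right_inv := fun f => by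
        ext i
        obtain ⟨c, hc⟩ := f.2.2 i
        simp only
        omega }
  rw [← e.tsum_eq]
  have h := tsum_subtype {g : Fin k → ℕ | Antitone g}
    (fun g => ∏ i, 1 / ((2 * g i + 1 : ℕ) : ℝ) ^ n)
  refine Eq.trans ?_ (h.trans ?_)
  · rfl
  · refine tsum_congr fun g => ?_
    rw [tsF, Set.indicator_apply]
    rfl

/-- Formula for `t*({n}_k)` as a sum over integer partitions of `k`
(Corollary `saus`). -/
theorem multTStar_repeat_eq_sum_partitions (n k : ℕ) (hn : 2 ≤ n) (hk : 1 ≤ k) :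
    multTStar (fun _ : Fin k => n) =
      ∑ μ : Nat.Partition k,
        (1 /
            ∏ i ∈ μ.parts.toFinset,
              ((Nat.factorial (μ.parts.count i) : ℝ) * (i : ℝ) ^ (μ.parts.count i))) *
          (μ.parts.map (fun p => multT ![n * p])).prod := by
  have hpow : ∀ p a : ℕ, (1 / ((2 * a + 1 : ℕ) : ℝ) ^ n) ^ p =
      1 / ((2 * a + 1 : ℕ) : ℝ) ^ (n * p) := by
    intro p a
    rw [div_pow, one_pow, pow_mul]
  rw [ts_multTStar, ts_main]
  · simp_rw [ts_multT, hpow]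
  · intro a
    positivity
  · intro p hp
    simp_rw [hpow]
    have h1 : 1 < n * p := by nlinarith
    exact (Real.summable_one_div_nat_pow.2 h1).comp_injective
      (i := fun a : ℕ => 2 * a + 1) (fun a b h => by simp only at h; omega)
end
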